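/- arXiv:1607.03942 — 5 statements merged into one kernel-verified Lean document; each statement's English description precedes it below -/
import Mathlib

section
/- Let F be an infinite field of characteristic different from 2, let R be a unital F-algebra admitting a regular grading by an abelian group H that satisfies condition (R1), and let A = M_n(R) carry a grading by a group G such that (Gr1) R (identified with the scalar matrices) is a homogeneous subalgebra contained in A_ε and (Gr2) M_n(F) is a homogeneous subalgebra. If the algebra B = M_n(F), with the G-grading inherited from A, satisfies the primeness property for graded central polynomials, then A also satisfies the primeness property for graded central polynomials. -/
section GradedDefs

variable {F : Type*} [Field F] {G : Type*} [Group G] {A : Type*} [Ring A] [Algebra F A]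

/-- An internal algebra grading of `A` by the group `G`: the components are independent,
span `A`, and multiply according to the group operation. -/
structure IsAlgGrading [DecidableEq G] (𝒜 : G → Submodule F A) : Prop where
  internal : DirectSum.IsInternal 𝒜
  mul_mem : ∀ {g h : G} {x y : A}, x ∈ 𝒜 g → y ∈ 𝒜 h → x * y ∈ 𝒜 (g * h)

/-- An admissible (graded) substitution: the variable `x_{i,g}` is replaced by an element
of the homogeneous component of degree `g`. -/
def GradedSubst (𝒜 : G → Submodule F A) (a : ℕ × G → A) : Prop := ∀ p : ℕ × G, a p ∈ 𝒜 p.2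

/-- `f` is a graded polynomial identity. -/
def IsGradedIdentity (𝒜 : G → Submodule F A) (f : FreeAlgebra F (ℕ × G)) : Prop :=
  ∀ a : ℕ × G → A, GradedSubst 𝒜 a → FreeAlgebra.lift F a f = 0

/-- `f` is a graded central polynomial. -/
def IsGradedCentral (𝒜 : G → Submodule F A) (f : FreeAlgebra F (ℕ × G)) : Prop :=
  ¬ IsGradedIdentity 𝒜 f ∧
    ∀ a : ℕ × G → A, GradedSubst 𝒜 a → FreeAlgebra.lift F a f ∈ Set.center A

/-- `f` only uses (graded) variables from the set `S`. -/
def UsesVars (S : Set (ℕ × G)) (f : FreeAlgebra F (ℕ × G)) : Prop :=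
  f ∈ Algebra.adjoin F (FreeAlgebra.ι F '' S)

/-- The primeness property for graded central polynomials: if a product of two polynomials
in disjoint sets of variables is graded central, then both factors are graded central. -/
def HasGradedPrimeness (𝒜 : G → Submodule F A) : Prop :=
  ∀ (S T : Set (ℕ × G)) (f g : FreeAlgebra F (ℕ × G)),
    Disjoint S T → UsesVars S f → UsesVars T g →
    IsGradedCentral 𝒜 (f * g) →
    IsGradedCentral 𝒜 f ∧ IsGradedCentral 𝒜 g

end GradedDefs

section Regular

variable {F : Type*} [Field F] {H : Type*} [CommGroup H] {R : Type*} [Ring R] [Algebra F R]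

/-- A regular grading of `R` by an abelian group `H` with commutation function `β`:
it is a grading such that (P1) every tuple of degrees is realized by elements with
non-zero product and (P2) homogeneous elements commute up to the scalar given by `β`. -/
structure IsRegularGrading [DecidableEq H] (ℛ : H → Submodule F R) (β : H → H → Fˣ) :
    Prop where
  internal : DirectSum.IsInternal ℛ
  mul_mem : ∀ {g h : H} {x y : R}, x ∈ ℛ g → y ∈ ℛ h → x * y ∈ ℛ (g * h)
  prod_ne_zero : ∀ (m : ℕ) (hs : Fin m → H), ∃ r : Fin m → R,
    (∀ i, r i ∈ ℛ (hs i)) ∧ (List.ofFn r).prod ≠ 0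
  comm : ∀ {g h : H} {x y : R}, x ∈ ℛ g → y ∈ ℛ h → x * y = ((β g h : Fˣ) : F) • (y * x)

end Regular

section CondR1

variable {F : Type*} [Field F] {H : Type*} [CommGroup H] {R : Type*} [Ring R] [Algebra F R]

/-- Condition (R1): for any two monomials in disjoint sets of variables that are not
`H`-graded identities for `R`, their product is not an `H`-graded identity for `R`. -/
def CondR1 (ℛ : H → Submodule F R) : Prop :=
  ∀ w₁ w₂ : List (ℕ × H), w₁.Disjoint w₂ →
    ¬ IsGradedIdentity ℛ ((w₁.map (FreeAlgebra.ι F)).prod) →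
    ¬ IsGradedIdentity ℛ ((w₂.map (FreeAlgebra.ι F)).prod) →
    ¬ IsGradedIdentity ℛ ((w₁.map (FreeAlgebra.ι F)).prod * (w₂.map (FreeAlgebra.ι F)).prod)

end CondR1

section MatrixEmb

/-- The embedding of `Mₙ(F)` in `Mₙ(R)` applying `algebraMap F R` entrywise. -/
noncomputable def matScalarEmb (F R : Type*) [Field F] [Ring R] [Algebra F R] (n : ℕ) :
    Matrix (Fin n) (Fin n) F →ₐ[F] Matrix (Fin n) (Fin n) R :=
  (Algebra.ofId F R).mapMatrix

end MatrixEmb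


section RegHelpers

set_option linter.unusedSectionVars false

variable {F : Type*} [Field F] {H : Type*} [CommGroup H] [DecidableEq H]
  {R : Type*} [Ring R] [Algebra F R]

/-- The set of values of the monomial `w` on graded substitutions with degrees `h`. -/
def MonVals (ℛ : H → Submodule F R) {Y : Type*} (h : Y → H) (w : List Y) : Set R :=
  {x | ∃ r : Y → R, (∀ y, r y ∈ ℛ (h y)) ∧ x = (w.map r).prod}

def IsMon (ℛ : H → Submodule F R) (V : Set R) : Prop :=
  ∃ w : List (ℕ × H), V = MonVals ℛ Prod.snd w

lemma isMon_monVals (ℛ : H → Submodule F R) {Y : Type*} (h : Y → H) (w : List Y) :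
    IsMon ℛ (MonVals ℛ h w) := by
  classical
  refine ⟨w.map (fun y => (w.idxOf y, h y)), ?_⟩
  ext x
  constructor
  · rintro ⟨r, hr, rfl⟩
    refine ⟨fun p => if hp : ∃ y ∈ w, (w.idxOf y, h y) = p then r hp.choose else 0, ?_, ?_⟩
    · intro p
      dsimp only
      split_ifs with hp
      · have := hr hp.choose
        have h2 := hp.choose_spec.2
        rw [← congrArg Prod.snd h2]
        exact this
      · exact zero_mem _
    · rw [List.map_map]
      congr 1
      apply List.map_congr_left
      intro y hy
      have hp : ∃ y' ∈ w, (w.idxOf y', h y') = (w.idxOf y, h y) := ⟨y, hy, rfl⟩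
      simp only [Function.comp]
      rw [dif_pos hp]
      have h2 := hp.choose_spec
      have h3 := congrArg Prod.fst h2.2
      rw [(List.idxOf_inj h2.1).1 h3]
  · rintro ⟨a, ha, rfl⟩
    refine ⟨fun y => a (w.idxOf y, h y), fun y => ha (w.idxOf y, h y), ?_⟩
    rw [List.map_map]; rfl

lemma lift_word {X A : Type*} [Ring A] [Algebra F A] (a : X → A) (w : List X) :
    FreeAlgebra.lift F a ((w.map (FreeAlgebra.ι F)).prod) = (w.map a).prod := by
  rw [map_list_prod, List.map_map]
  congr 1
  apply List.map_congr_left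
  intro x _
  simp

lemma IsMon.exists_mul_ne {ℛ : H → Submodule F R} (hR1 : CondR1 ℛ) {V W : Set R}
    (hV : IsMon ℛ V) (hW : IsMon ℛ W) (hV0 : ∃ v ∈ V, v ≠ 0) (hW0 : ∃ v ∈ W, v ≠ 0) :
    ∃ v ∈ V, ∃ w ∈ W, v * w ≠ 0 := by
  obtain ⟨w1, rfl⟩ := hV
  obtain ⟨w2, rfl⟩ := hW
  obtain ⟨_, ⟨r1, hr1, rfl⟩, h1⟩ := hV0
  obtain ⟨_, ⟨r2, hr2, rfl⟩, h2⟩ := hW0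
  have key := hR1 (w1.map fun p => (2 * p.1, p.2)) (w2.map fun p => (2 * p.1 + 1, p.2)) ?_ ?_ ?_
  · unfold IsGradedIdentity at key
    push Not at key
    obtain ⟨a, ha, hne⟩ := key
    rw [map_mul, lift_word, lift_word, List.map_map, List.map_map] at hne
    exact ⟨_, ⟨a ∘ fun p => (2 * p.1, p.2), fun y => ha (2 * y.1, y.2), rfl⟩, _,
      ⟨a ∘ fun p => (2 * p.1 + 1, p.2), fun y => ha (2 * y.1 + 1, y.2), rfl⟩, hne⟩
  · intro x hx hy
    simp only [List.mem_map] at hx hy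
    obtain ⟨p, _, rfl⟩ := hx
    obtain ⟨q, _, hq⟩ := hy
    have := congrArg Prod.fst hq
    simp at this
    omega
  · intro hid
    have := hid (fun p => r1 (p.1 / 2, p.2)) (fun p => hr1 (p.1 / 2, p.2))
    rw [lift_word, List.map_map] at this
    apply h1
    rw [← this]
    congr 1
    apply List.map_congr_left
    intro y _
    simp
  · intro hid
    have := hid (fun p => r2 (p.1 / 2, p.2)) (fun p => hr2 (p.1 / 2, p.2))
    rw [lift_word, List.map_map] at this
    apply h2
    rw [← this]
    congr 1
    apply List.map_congr_left
    intro y _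
    have : (2 * y.1 + 1) / 2 = y.1 := by omega
    simp [this]

/-- the set of products -/
def MSet (V W : Set R) : Set R := {x | ∃ v ∈ V, ∃ w ∈ W, x = v * w}

lemma IsMon.mul {ℛ : H → Submodule F R} {V W : Set R}
    (hV : IsMon ℛ V) (hW : IsMon ℛ W) : IsMon ℛ (MSet V W) := by
  obtain ⟨w1, rfl⟩ := hV
  obtain ⟨w2, rfl⟩ := hW
  have := isMon_monVals ℛ (Sum.elim (Prod.snd : ℕ × H → H) (Prod.snd : ℕ × H → H))
    (w1.map Sum.inl ++ w2.map Sum.inr)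
  convert this using 1
  ext x
  constructor
  · rintro ⟨_, ⟨r1, hr1, rfl⟩, _, ⟨r2, hr2, rfl⟩, rfl⟩
    refine ⟨Sum.elim r1 r2, ?_, ?_⟩
    · rintro (y | y)
      · exact hr1 y
      · exact hr2 y
    · simp [Function.comp_def]
  · rintro ⟨r, hr, rfl⟩
    refine ⟨_, ⟨fun y => r (Sum.inl y), fun y => hr (Sum.inl y), rfl⟩, _,
      ⟨fun y => r (Sum.inr y), fun y => hr (Sum.inr y), rfl⟩, ?_⟩
    simp [Function.comp_def]

lemma IsMon.single (ℛ : H → Submodule F R) (l : H) : IsMon ℛ (ℛ l : Set R) := by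
  have := isMon_monVals ℛ (fun _ : Unit => l) [()]
  convert this using 1
  ext x
  constructor
  · intro hx
    exact ⟨fun _ => x, fun _ => hx, by simp⟩
  · rintro ⟨r, hr, rfl⟩
    simpa using hr ()

lemma one_mem_reg {ℛ : H → Submodule F R} {β : H → H → Fˣ} (hreg : IsRegularGrading ℛ β) :
    (1 : R) ∈ ℛ 1 := by
  have hind := hreg.internal.submodule_iSupIndep
  have htop := hreg.internal.submodule_iSup_eq_top
  have h1 : (1 : R) ∈ ℛ 1 ⊔ ⨆ (j) (_ : j ≠ 1), ℛ j := by
    have : (⊤ : Submodule F R) ≤ ℛ 1 ⊔ ⨆ (j) (_ : j ≠ 1), ℛ j := by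
      rw [← htop]
      refine iSup_le fun i => ?_
      by_cases hi : i = 1
      · subst hi; exact le_sup_left
      · exact le_trans (le_iSup₂_of_le i hi le_rfl) le_sup_right
    exact this trivial
  obtain ⟨e, he, e', he', hsum⟩ := Submodule.mem_sup.1 h1
  have hx : ∀ g, ∀ x ∈ ℛ g, x * e = x := by
    intro g x hxg
    have h2 : x * e' ∈ ⨆ (j) (_ : j ≠ g), ℛ j := by
      have : (⨆ (j) (_ : j ≠ 1), ℛ j) ≤
          (⨆ (j) (_ : j ≠ g), ℛ j).comap (LinearMap.mulLeft F x) := by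
        refine iSup₂_le fun j hj y hy => ?_
        have h3 := hreg.mul_mem hxg hy
        have hne : g * j ≠ g := by simpa using hj
        exact (le_iSup₂_of_le (f := fun j (_ : j ≠ g) => ℛ j) (g * j) hne le_rfl) h3
      exact this he'
    have h4 : x * e' ∈ ℛ g := by
      have : x * e' = x - x * e := by
        rw [eq_sub_iff_add_eq, ← mul_add, add_comm e' e, hsum, mul_one]
      rw [this]
      refine sub_mem hxg ?_
      simpa using hreg.mul_mem hxg he
    have h5 : x * e' = 0 := by
      exact Submodule.disjoint_def.1 (hind g) _ h4 h2
    calc x * e = x * (e + e') := by rw [mul_add, h5, add_zero]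
      _ = x := by rw [hsum, mul_one]
  have hall : ∀ x : R, x * e = x := by
    have : (⊤ : Submodule F R) ≤ LinearMap.ker (LinearMap.mulRight F e - LinearMap.id) := by
      rw [← htop]
      refine iSup_le fun i y hy => ?_
      simp [hx i y hy]
    intro x
    have := this (show x ∈ ⊤ from trivial)
    simpa [sub_eq_zero] using this
  have := hall 1
  rw [one_mul] at this
  rwa [← this]

lemma IsMon.deg {ℛ : H → Submodule F R} {β : H → H → Fˣ} (hreg : IsRegularGrading ℛ β)
    {V : Set R} (hV : IsMon ℛ V) : ∃ d, ∀ v ∈ V, v ∈ ℛ d := by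
  obtain ⟨w, rfl⟩ := hV
  refine ⟨(w.map Prod.snd).prod, ?_⟩
  rintro _ ⟨r, hr, rfl⟩
  induction w with
  | nil => simpa using one_mem_reg hreg
  | cons y w ih => simpa using hreg.mul_mem (hr y) ih

lemma beta_mul {ℛ : H → Submodule F R} {β : H → H → Fˣ} (hreg : IsRegularGrading ℛ β)
    (x y z : H) : β (x * y) z = β x z * β y z := by
  obtain ⟨r, hr, hne⟩ := hreg.prod_ne_zero 3 ![x, y, z]
  have h0 : r 0 ∈ ℛ x := hr 0
  have h1 : r 1 ∈ ℛ y := hr 1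
  have h2 : r 2 ∈ ℛ z := hr 2
  simp only [List.ofFn_succ, List.ofFn_zero, List.prod_cons, List.prod_nil, mul_one] at hne
  change r 0 * (r 1 * r 2) ≠ 0 at hne
  have e1 : r 0 * (r 1 * r 2) = ((β x z * β y z : Fˣ) : F) • (r 2 * (r 0 * r 1)) := by
    rw [hreg.comm h1 h2, mul_smul_comm, ← mul_assoc, hreg.comm h0 h2, smul_mul_assoc, smul_smul,
      mul_assoc, Units.val_mul, mul_comm]
  have e2 : r 0 * (r 1 * r 2) = ((β (x * y) z : Fˣ) : F) • (r 2 * (r 0 * r 1)) := by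
    rw [← mul_assoc, hreg.comm (hreg.mul_mem h0 h1) h2]
  have hz : r 2 * (r 0 * r 1) ≠ 0 := by
    intro h; rw [h, smul_zero] at e1; exact hne e1
  rw [e1] at e2
  exact (Units.ext (smul_left_injective F hz e2)).symm

lemma IsMon.beta_eq_one {ℛ : H → Submodule F R} {β : H → H → Fˣ} (hreg : IsRegularGrading ℛ β)
    (hR1 : CondR1 ℛ) {V : Set R} (hV : IsMon ℛ V) (hV0 : ∃ v ∈ V, v ≠ 0) {d : H}
    (hd : ∀ v ∈ V, v ∈ ℛ d) (hc : ∀ v ∈ V, v ∈ Set.center R) (l : H) : β d l = 1 := by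
  have hT0 : ∃ v ∈ (ℛ l : Set R), v ≠ 0 := by
    obtain ⟨r, hr, hne⟩ := hreg.prod_ne_zero 1 ![l]
    exact ⟨r 0, hr 0, by simpa using hne⟩
  obtain ⟨v, hv, t, ht, hne⟩ := hV.exists_mul_ne hR1 (IsMon.single ℛ l) hV0 hT0
  have h1 := hreg.comm (hd v hv) ht
  have hcm : v * t = t * v := ((Set.mem_center_iff.1 (hc v hv)).comm t).eq
  rw [hcm] at h1
  have hne' : t * v ≠ 0 := by
    rw [← hcm]; exact hne
  have h2 : (1 : F) • (t * v) = ((β d l : Fˣ) : F) • (t * v) := by rw [one_smul]; exact h1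
  exact (Units.ext (smul_left_injective F hne' h2)).symm

lemma IsMon.central {ℛ : H → Submodule F R} {β : H → H → Fˣ} (hreg : IsRegularGrading ℛ β)
    (hR1 : CondR1 ℛ) {V W : Set R} (hV : IsMon ℛ V) (hW : IsMon ℛ W)
    (hV0 : ∃ v ∈ V, v ≠ 0) (hW0 : ∃ v ∈ W, v ≠ 0)
    (h1 : ∀ v ∈ V, ∀ w ∈ W, v * w ∈ Set.center R)
    (h2 : ∀ l, ∀ t ∈ ℛ l, ∀ v ∈ V, ∀ w ∈ W, (t * v - v * t) * w ∈ Set.center R) :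
    ∀ v ∈ V, v ∈ Set.center R := by
  obtain ⟨h, hh⟩ := hV.deg hreg
  obtain ⟨k, hk⟩ := hW.deg hreg
  have hVW0 : ∃ v ∈ MSet V W, v ≠ 0 := by
    obtain ⟨v, hv, w, hw, hne⟩ := hV.exists_mul_ne hR1 hW hV0 hW0
    exact ⟨_, ⟨v, hv, w, hw, rfl⟩, hne⟩
  have hbeta : ∀ l, β h l = 1 := by
    intro l
    by_contra hne
    have hT0 : ∃ v ∈ (ℛ l : Set R), v ≠ 0 := by
      obtain ⟨r, hr, hne⟩ := hreg.prod_ne_zero 1 ![l]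
      exact ⟨r 0, hr 0, by simpa using hne⟩
    have hTVW0 : ∃ v ∈ MSet (ℛ l : Set R) (MSet V W), v ≠ 0 := by
      obtain ⟨v, hv, w, hw, hne⟩ := (IsMon.single ℛ l).exists_mul_ne hR1 (hV.mul hW) hT0 hVW0
      exact ⟨_, ⟨v, hv, w, hw, rfl⟩, hne⟩
    have a1 := (hV.mul hW).beta_eq_one hreg hR1 hVW0 (d := h * k)
      (by rintro _ ⟨v, hv, w, hw, rfl⟩; exact hreg.mul_mem (hh v hv) (hk w hw))
      (by rintro _ ⟨v, hv, w, hw, rfl⟩; exact h1 v hv w hw)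
    have a2 := ((IsMon.single ℛ l).mul (hV.mul hW)).beta_eq_one hreg hR1 hTVW0 (d := l * (h * k))
      (by
        rintro _ ⟨t, ht, _, ⟨v, hv, w, hw, rfl⟩, rfl⟩
        exact hreg.mul_mem ht (hreg.mul_mem (hh v hv) (hk w hw)))
      (by
        rintro _ ⟨t, ht, _, ⟨v, hv, w, hw, rfl⟩, rfl⟩
        have h3 := h2 l t ht v hv w hw
        have hne' : (1 - ((β h l : Fˣ) : F)) ≠ 0 := by
          intro h; apply hne; ext; simpa using (sub_eq_zero.1 h).symm
        have h4 : t * (v * w) = (1 - ((β h l : Fˣ) : F))⁻¹ • ((t * v - v * t) * w) := by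
          rw [hreg.comm (hh v hv) ht]
          have : t * v - ((β h l : Fˣ) : F) • (t * v) = (1 - ((β h l : Fˣ) : F)) • (t * v) := by
            rw [sub_smul, one_smul]
          rw [this, smul_mul_assoc, smul_smul, inv_mul_cancel₀ hne', one_smul, mul_assoc]
        rw [h4]
        exact (Subalgebra.center F R).smul_mem h3 _)
    have a3 : ∀ z, β l z = 1 := by
      intro z
      have := a2 z
      rw [beta_mul hreg, a1 z, mul_one] at this
      exact this
    obtain ⟨r, hr, hne2⟩ := hreg.prod_ne_zero 2 ![l, h]
    have b0 : r 0 ∈ ℛ l := hr 0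
    have b1 : r 1 ∈ ℛ h := hr 1
    simp only [List.ofFn_succ, List.ofFn_zero, List.prod_cons, List.prod_nil, mul_one] at hne2
    change r 0 * r 1 ≠ 0 at hne2
    have c1 := hreg.comm b0 b1
    rw [a3 h, Units.val_one, one_smul] at c1
    have c2 := hreg.comm b1 b0
    rw [← c1] at c2
    have h2 : (1 : F) • (r 0 * r 1) = ((β h l : Fˣ) : F) • (r 0 * r 1) := by
      rw [one_smul]; exact c2
    exact hne (Units.ext (smul_left_injective F hne2 h2)).symm
  intro v hv
  have htop := hreg.internal.submodule_iSup_eq_top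
  have : (⊤ : Submodule F R) ≤
      LinearMap.ker (LinearMap.mulRight F v - LinearMap.mulLeft F v) := by
    rw [← htop]
    refine iSup_le fun i y hy => ?_
    have := hreg.comm (hh v hv) hy
    rw [hbeta, Units.val_one, one_smul] at this
    simp [this]
  rw [Semigroup.mem_center_iff]
  intro x
  have := this (show x ∈ ⊤ from trivial)
  simpa [sub_eq_zero] using this

lemma vand {V Y : Type*} [Infinite F] [AddCommGroup V] [Module F V] (U : Submodule F V)
    (s : Finset (Multiset Y)) (u : Multiset Y → V)
    (h : ∀ t : Y → F, ∑ α ∈ s, (α.map t).prod • u α ∈ U) : ∀ α ∈ s, u α ∈ U := by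
  classical
  intro α hα
  by_contra hn
  obtain ⟨φ, hφ, hφU⟩ := Submodule.exists_le_ker_of_notMem hn
  let p : MvPolynomial Y F := ∑ α ∈ s, MvPolynomial.monomial (Multiset.toFinsupp α) (φ (u α))
  have hp : p = 0 := by
    apply MvPolynomial.funext
    intro t
    have h1 := hφU (h t)
    rw [LinearMap.mem_ker, map_sum] at h1
    rw [map_zero, ← h1, map_sum]
    apply Finset.sum_congr rfl
    intro γ _
    rw [MvPolynomial.eval_monomial, map_smul, smul_eq_mul, mul_comm]
    congr 1
    rw [Finsupp.prod, Multiset.toFinsupp_support, Finset.prod_multiset_map_count]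
    simp
  have h2 := congrArg (MvPolynomial.coeff (Multiset.toFinsupp α)) hp
  rw [MvPolynomial.coeff_sum, Finset.sum_eq_single α] at h2
  · simp at h2; exact hφ h2
  · intro b _ hb
    rw [MvPolynomial.coeff_monomial, if_neg]
    intro h; exact hb (Multiset.toFinsupp.injective h)
  · intro h; exact absurd hα h

lemma perm_scalar {ℛ : H → Submodule F R} {β : H → H → Fˣ} (hreg : IsRegularGrading ℛ β)
    {Y : Type*} (h : Y → H) {w w' : List Y} (hp : w.Perm w') :
    ∃ c : F, ∀ r : Y → R, (∀ y, r y ∈ ℛ (h y)) → (w.map r).prod = c • (w'.map r).prod := by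
  induction hp with
  | nil => exact ⟨1, fun r _ => by simp⟩
  | cons x _ ih =>
    obtain ⟨c, hc⟩ := ih
    exact ⟨c, fun r hr => by simp [hc r hr]⟩
  | swap x y l =>
    refine ⟨β (h y) (h x), fun r hr => ?_⟩
    simp only [List.map_cons, List.prod_cons]
    rw [← mul_assoc, hreg.comm (hr y) (hr x), smul_mul_assoc, mul_assoc]
  | trans _ _ ih1 ih2 =>
    obtain ⟨c, hc⟩ := ih1
    obtain ⟨d, hd⟩ := ih2
    exact ⟨c * d, fun r hr => by rw [hc r hr, hd r hr, smul_smul]⟩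

end RegHelpers

section MatHelpers

set_option linter.unusedSectionVars false

variable {F : Type*} [Field F] {R : Type*} [Ring R] [Algebra F R] {n : ℕ}

/-- `r • M` for `r` in `R` and `M` a matrix over `F`. -/
noncomputable def sm (n : ℕ) (r : R) (X : Matrix (Fin n) (Fin n) F) : Matrix (Fin n) (Fin n) R :=
  Matrix.scalar (Fin n) r * matScalarEmb F R n X

lemma sm_apply (r : R) (X : Matrix (Fin n) (Fin n) F) (i j : Fin n) :
    sm n r X i j = X i j • r := by
  simp [sm, matScalarEmb, Matrix.diagonal_mul, Algebra.ofId_apply, Algebra.smul_def,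
    Algebra.commutes]

lemma sm_mul (r r' : R) (X X' : Matrix (Fin n) (Fin n) F) :
    sm n r X * sm n r' X' = sm n (r * r') (X * X') := by
  ext i j
  simp [Matrix.mul_apply, sm_apply, Finset.sum_smul, smul_smul, mul_comm]

lemma sm_one : sm n (1 : R) (1 : Matrix (Fin n) (Fin n) F) = 1 := by
  simp [sm]

lemma sm_smul_left (c : F) (r : R) (X : Matrix (Fin n) (Fin n) F) :
    sm n (c • r) X = c • sm n r X := by
  ext i j; simp [sm_apply, smul_smul, mul_comm]

lemma sm_smul_right (c : F) (r : R) (X : Matrix (Fin n) (Fin n) F) :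
    sm n r (c • X) = c • sm n r X := by
  ext i j; simp [sm_apply, smul_smul, mul_comm]

lemma sm_add_left (r r' : R) (X : Matrix (Fin n) (Fin n) F) :
    sm n (r + r') X = sm n r X + sm n r' X := by
  ext i j; simp [sm_apply]

lemma sm_sub_left (r r' : R) (X : Matrix (Fin n) (Fin n) F) :
    sm n (r - r') X = sm n r X - sm n r' X := by
  ext i j; simp [sm_apply, smul_sub]

lemma sm_add_right (r : R) (X X' : Matrix (Fin n) (Fin n) F) :
    sm n r (X + X') = sm n r X + sm n r X' := by
  ext i j; simp [sm_apply, add_smul]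

lemma sm_zero_left (X : Matrix (Fin n) (Fin n) F) : sm n (0 : R) X = 0 := by
  ext i j; simp [sm_apply]

lemma sm_zero_right (r : R) : sm n r (0 : Matrix (Fin n) (Fin n) F) = 0 := by
  ext i j; simp [sm_apply]

lemma sm_eq_scalar (r : R) : sm n r (1 : Matrix (Fin n) (Fin n) F) = Matrix.scalar (Fin n) r := by
  simp [sm]

lemma sm_sum_right {ι : Type*} (s : Finset ι) (r : R) (X : ι → Matrix (Fin n) (Fin n) F) :
    sm n r (∑ i ∈ s, X i) = ∑ i ∈ s, sm n r (X i) := by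
  ext i j; simp [sm_apply, Matrix.sum_apply, Finset.sum_smul]

lemma sm_list_prod {Y : Type*} (w : List Y) (r : Y → R) (M : Y → Matrix (Fin n) (Fin n) F) :
    (w.map fun y => sm n (r y) (M y)).prod = sm n (w.map r).prod (w.map M).prod := by
  induction w with
  | nil => simp [sm_one]
  | cons y w ih => simp [ih, sm_mul]

lemma sm_eq_zero {r : R} (hr : r ≠ 0) {X : Matrix (Fin n) (Fin n) F} (h : sm n r X = 0) :
    X = 0 := by
  ext i j
  have := congrFun (congrFun h i) j
  rw [sm_apply] at this
  simpa [hr] using this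

lemma center_of_sm {r : R} (hr : r ≠ 0) {X : Matrix (Fin n) (Fin n) F}
    (h : sm n r X ∈ Set.center (Matrix (Fin n) (Fin n) R)) :
    X ∈ Set.center (Matrix (Fin n) (Fin n) F) := by
  rw [Semigroup.mem_center_iff] at h ⊢
  intro Y
  have h1 := h (sm n 1 Y)
  rw [sm_mul, sm_mul, one_mul, mul_one] at h1
  rw [← sub_eq_zero]
  apply sm_eq_zero hr
  have : Y * X - X * Y = Y * X + (-1 : F) • (X * Y) := by simp [sub_eq_add_neg]
  rw [this, sm_add_right, sm_smul_right, h1]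
  simp

lemma center_of_scalar [NeZero n] {r : R}
    (h : Matrix.scalar (Fin n) r ∈ Set.center (Matrix (Fin n) (Fin n) R)) :
    r ∈ Set.center R := by
  rw [Matrix.center_eq_scalar_image] at h
  obtain ⟨x, hx, hxr⟩ := h
  have := Matrix.scalar_inj.1 hxr
  rwa [← this]

lemma scalar_center {r : R} (h : r ∈ Set.center R) :
    Matrix.scalar (Fin n) r ∈ Set.center (Matrix (Fin n) (Fin n) R) := by
  rw [Matrix.center_eq_scalar_image]
  exact ⟨r, h, rfl⟩

lemma eq_smul_one {X : Matrix (Fin n) (Fin n) F}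
    (h : X ∈ Set.center (Matrix (Fin n) (Fin n) F)) : ∃ c : F, X = c • 1 := by
  rw [Matrix.center_eq_range] at h
  obtain ⟨c, rfl⟩ := h
  exact ⟨c, by ext i j; simp [Matrix.diagonal_apply, Matrix.one_apply]⟩

lemma isMon_sm_central {H : Type*} [CommGroup H] [DecidableEq H] [NeZero n]
    {ℛ : H → Submodule F R} {β : H → H → Fˣ} (hreg : IsRegularGrading ℛ β)
    (hR1 : CondR1 ℛ) {V W : Set R} (hV : IsMon ℛ V) (hW : IsMon ℛ W)
    (hV0 : ∃ v ∈ V, v ≠ 0) (hW0 : ∃ v ∈ W, v ≠ 0) (X : Matrix (Fin n) (Fin n) F)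
    (h1 : ∀ v ∈ V, ∀ w ∈ W, sm n (v * w) X ∈ Set.center (Matrix (Fin n) (Fin n) R))
    (h2 : ∀ l, ∀ t ∈ ℛ l, ∀ v ∈ V, ∀ w ∈ W,
      sm n ((t * v - v * t) * w) X ∈ Set.center (Matrix (Fin n) (Fin n) R)) :
    ∀ v ∈ V, sm n v X ∈ Set.center (Matrix (Fin n) (Fin n) R) := by
  intro v hv
  obtain ⟨v1, hv1, w1, hw1, hne⟩ := hV.exists_mul_ne hR1 hW hV0 hW0
  obtain ⟨c, rfl⟩ := eq_smul_one (center_of_sm hne (h1 v1 hv1 w1 hw1))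
  by_cases hc : c = 0
  · subst hc
    rw [zero_smul, sm_zero_right]
    exact Set.zero_mem_center
  have key : ∀ r : R, sm n r (c • (1 : Matrix (Fin n) (Fin n) F)) ∈
      Set.center (Matrix (Fin n) (Fin n) R) → r ∈ Set.center R := by
    intro r hr
    apply center_of_scalar (n := n)
    have : Matrix.scalar (Fin n) r = c⁻¹ • sm n r (c • (1 : Matrix (Fin n) (Fin n) F)) := by
      rw [sm_smul_right, smul_smul, inv_mul_cancel₀ hc, one_smul, sm_eq_scalar]
    rw [this]
    exact (Subalgebra.center F _).smul_mem hr _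
  have := hV.central hreg hR1 hW hV0 hW0 (fun v hv w hw => key _ (h1 v hv w hw))
    (fun l t ht v hv w hw => key _ (h2 l t ht v hv w hw)) v hv
  rw [sm_smul_right, sm_eq_scalar]
  exact (Subalgebra.center F _).smul_mem (scalar_center this) _

end MatHelpers

section FreeHelpers

set_option linter.unusedSectionVars false

variable {F : Type*} [Field F] {G : Type*} [Group G] {A : Type*} [Ring A] [Algebra F A]

/-- span of the values of `f`. -/
def valSpan (𝒜 : G → Submodule F A) (f : FreeAlgebra F (ℕ × G)) : Submodule F A :=
  Submodule.span F {x | ∃ a, GradedSubst 𝒜 a ∧ x = FreeAlgebra.lift F a f}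

lemma lift_congr_vars {S : Set (ℕ × G)} {f : FreeAlgebra F (ℕ × G)} (hf : UsesVars S f)
    {a b : ℕ × G → A} (hab : ∀ p ∈ S, a p = b p) :
    FreeAlgebra.lift F a f = FreeAlgebra.lift F b f := by
  have : Algebra.adjoin F (FreeAlgebra.ι F '' S) ≤
      AlgHom.equalizer (FreeAlgebra.lift F a) (FreeAlgebra.lift F b) := by
    apply Algebra.adjoin_le
    rintro _ ⟨p, hp, rfl⟩
    simp [hab p hp]
  exact this hf

lemma exists_combined {𝒜 : G → Submodule F A} {S T : Set (ℕ × G)} {f g : FreeAlgebra F (ℕ × G)}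
    (hST : Disjoint S T) (hf : UsesVars S f) (hg : UsesVars T g)
    {a b : ℕ × G → A} (ha : GradedSubst 𝒜 a) (hb : GradedSubst 𝒜 b) :
    ∃ c, GradedSubst 𝒜 c ∧
      FreeAlgebra.lift F c (f * g) = FreeAlgebra.lift F a f * FreeAlgebra.lift F b g := by
  classical
  refine ⟨S.piecewise a b, ?_, ?_⟩
  · intro p
    by_cases hp : p ∈ S
    · simpa [hp] using ha p
    · simpa [hp] using hb p
  · rw [map_mul]
    congr 1
    · exact lift_congr_vars hf fun p hp => by simp [hp]
    · refine lift_congr_vars hg fun p hp => ?_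
      have : p ∉ S := fun h => Set.disjoint_left.1 hST h hp
      simp [this]

lemma valSpan_mul {𝒜 : G → Submodule F A} {S T : Set (ℕ × G)} {f g : FreeAlgebra F (ℕ × G)}
    (hST : Disjoint S T) (hf : UsesVars S f) (hg : UsesVars T g)
    (hc : ∀ a : ℕ × G → A, GradedSubst 𝒜 a → FreeAlgebra.lift F a (f * g) ∈ Set.center A)
    {u v : A} (hu : u ∈ valSpan 𝒜 f) (hv : v ∈ valSpan 𝒜 g) : u * v ∈ Set.center A := by
  have : valSpan 𝒜 f * valSpan 𝒜 g ≤ Subalgebra.toSubmodule (Subalgebra.center F A) := by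
    rw [valSpan, valSpan, Submodule.span_mul_span, Submodule.span_le]
    rintro _ ⟨_, ⟨a, ha, rfl⟩, _, ⟨b, hb, rfl⟩, rfl⟩
    obtain ⟨c, hc1, hc2⟩ := exists_combined hST hf hg ha hb
    have := hc c hc1
    rw [hc2] at this
    exact this
  exact this (Submodule.mul_mem_mul hu hv)

lemma poly_aux (a : ℕ × G → A) (t : A) (f : FreeAlgebra F (ℕ × G)) :
    ∃ q : Polynomial A, (∀ τ : F, FreeAlgebra.lift F (fun p => a p + τ • (t * a p - a p * t)) f =
      q.eval (algebraMap F A τ)) ∧ q.coeff 0 = FreeAlgebra.lift F a f ∧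
      q.coeff 1 = t * FreeAlgebra.lift F a f - FreeAlgebra.lift F a f * t := by
  induction f using FreeAlgebra.induction with
  | grade0 r =>
    refine ⟨Polynomial.C (algebraMap F A r), ?_, ?_, ?_⟩
    · intro τ; simp
    · simp
    · simp [Polynomial.coeff_C, Algebra.commutes]
  | grade1 x =>
    refine ⟨Polynomial.C (a x) + Polynomial.C (t * a x - a x * t) * Polynomial.X, ?_, ?_, ?_⟩
    · intro τ; simp [Algebra.smul_def, Algebra.commutes]
    · simp
    · simp [Polynomial.coeff_C]
  | mul f g ihf ihg =>
    obtain ⟨p, hp, hp0, hp1⟩ := ihf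
    obtain ⟨q, hq, hq0, hq1⟩ := ihg
    refine ⟨p * q, ?_, ?_, ?_⟩
    · intro τ
      rw [map_mul, hp, hq, Polynomial.eval, Polynomial.eval, Polynomial.eval,
        Polynomial.eval₂_mul_noncomm]
      intro k
      exact (Algebra.commutes τ _).symm
    · simp [Polynomial.mul_coeff_zero, hp0, hq0]
    · rw [Polynomial.mul_coeff_one, hp0, hp1, hq0, hq1, map_mul]
      noncomm_ring
  | add f g ihf ihg =>
    obtain ⟨p, hp, hp0, hp1⟩ := ihf
    obtain ⟨q, hq, hq0, hq1⟩ := ihg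
    refine ⟨p + q, ?_, ?_, ?_⟩
    · intro τ; simp [hp, hq]
    · simp [hp0, hq0]
    · simp [hp1, hq1]; noncomm_ring

lemma valSpan_ad [Infinite F] [DecidableEq G] {𝒜 : G → Submodule F A} (hA : IsAlgGrading 𝒜)
    (f : FreeAlgebra F (ℕ × G))
    {t : A} (ht : t ∈ 𝒜 1) {u : A} (hu : u ∈ valSpan 𝒜 f) : t * u - u * t ∈ valSpan 𝒜 f := by
  have : valSpan 𝒜 f ≤ (valSpan 𝒜 f).comap (LinearMap.mulLeft F t - LinearMap.mulRight F t) := by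
    conv_lhs => rw [valSpan]
    rw [Submodule.span_le]
    rintro _ ⟨a, ha, rfl⟩
    change t * FreeAlgebra.lift F a f - FreeAlgebra.lift F a f * t ∈ valSpan 𝒜 f
    obtain ⟨q, hq, -, hq1⟩ := poly_aux a t f
    rw [← hq1]
    by_contra hn
    obtain ⟨φ, hφ, hφU⟩ := Submodule.exists_le_ker_of_notMem hn
    let p : Polynomial F := ∑ i ∈ Finset.range (q.natDegree + 1), Polynomial.monomial i (φ (q.coeff i))
    have hp : p = 0 := by
      apply Polynomial.funext
      intro τ
      have h1 : FreeAlgebra.lift F (fun p => a p + τ • (t * a p - a p * t)) f ∈ valSpan 𝒜 f := by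
        refine Submodule.subset_span ⟨_, ?_, rfl⟩
        intro p
        refine add_mem (ha p) (Submodule.smul_mem _ _ (sub_mem ?_ ?_))
        · simpa using hA.mul_mem ht (ha p)
        · simpa using hA.mul_mem (ha p) ht
      have h2 := hφU h1
      rw [hq, LinearMap.mem_ker, Polynomial.eval_eq_sum_range, map_sum] at h2
      rw [Polynomial.eval_zero, ← h2, Polynomial.eval_finsetSum]
      apply Finset.sum_congr rfl
      intro i _
      rw [Polynomial.eval_monomial, ← map_pow, ← Algebra.commutes, ← Algebra.smul_def, map_smul,
        smul_eq_mul, mul_comm]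
    have h3 := congrArg (fun p => Polynomial.coeff p 1) hp
    simp only [p, Polynomial.finsetSum_coeff, Polynomial.coeff_monomial, Polynomial.coeff_zero,
      Finset.sum_ite_eq', Finset.mem_range] at h3
    split_ifs at h3 with h4
    · exact hφ h3
    · apply hφ
      rw [Polynomial.coeff_eq_zero_of_natDegree_lt (by omega), map_zero]
  exact this hu

lemma exists_words {S : Set (ℕ × G)} {f : FreeAlgebra F (ℕ × G)} (hf : UsesVars S f) :
    ∃ (m : ℕ) (c : Fin m → F) (w : Fin m → List (ℕ × G)),
      (∀ i, ∀ p ∈ w i, p ∈ S) ∧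
      f = ∑ i, c i • ((w i).map (FreeAlgebra.ι F)).prod := by
  have h1 : f ∈ Submodule.span F (Submonoid.closure (FreeAlgebra.ι F '' S) :
      Set (FreeAlgebra F (ℕ × G))) := by
    rw [← Algebra.adjoin_eq_span]; exact hf
  obtain ⟨m, c, g, hg⟩ := Submodule.mem_span_set'.1 h1
  have h3 : ∀ x ∈ Submonoid.closure (FreeAlgebra.ι F '' S), ∃ w : List (ℕ × G),
      (∀ p ∈ w, p ∈ S) ∧ (w.map (FreeAlgebra.ι F)).prod = x := by
    intro x hx
    induction hx using Submonoid.closure_induction with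
    | mem x hx =>
      obtain ⟨p, hp, rfl⟩ := hx
      exact ⟨[p], by simpa using hp, by simp⟩
    | one => exact ⟨[], by simp, by simp⟩
    | mul x y _ _ hx hy =>
      obtain ⟨w1, h1, h1'⟩ := hx
      obtain ⟨w2, h2, h2'⟩ := hy
      refine ⟨w1 ++ w2, ?_, by simp [h1', h2']⟩
      intro p hp
      rcases List.mem_append.1 hp with h | h
      · exact h1 p h
      · exact h2 p h
  have h2 := fun i => h3 (g i) (g i).2
  choose w hw hw' using h2
  exact ⟨m, c, w, hw, by simp_rw [hw', hg]⟩

end FreeHelpers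

section Decomp

set_option linter.unusedSectionVars false

variable {F : Type*} [Field F] {H : Type*} [CommGroup H] [DecidableEq H]
  {R : Type*} [Ring R] [Algebra F R] {G : Type*} [Group G] [DecidableEq G] {n : ℕ}

lemma component_span {ℛ : H → Submodule F R} {β : H → H → Fˣ} (hreg : IsRegularGrading ℛ β)
    {𝒜 : G → Submodule F (Matrix (Fin n) (Fin n) R)} (hA : IsAlgGrading 𝒜)
    (hGr1 : ∀ r : R, Matrix.scalar (Fin n) r ∈ 𝒜 1)
    (hGr2 : ∀ M : Matrix (Fin n) (Fin n) F,
      matScalarEmb F R n M ∈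
        ⨆ g : G, (LinearMap.range (matScalarEmb F R n).toLinearMap ⊓ 𝒜 g))
    (g : G) : 𝒜 g ≤ Submodule.span F {x | ∃ (h : H) (r : R) (M : Matrix (Fin n) (Fin n) F),
      r ∈ ℛ h ∧ matScalarEmb F R n M ∈ 𝒜 g ∧ x = sm n r M} := by
  set C : G → Submodule F (Matrix (Fin n) (Fin n) R) := fun g => Submodule.span F
    {x | ∃ (h : H) (r : R) (M : Matrix (Fin n) (Fin n) F),
      r ∈ ℛ h ∧ matScalarEmb F R n M ∈ 𝒜 g ∧ x = sm n r M} with hC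
  have hCA : ∀ g, C g ≤ 𝒜 g := by
    intro g
    rw [hC, Submodule.span_le]
    rintro _ ⟨h, r, M, hr, hM, rfl⟩
    simpa [sm] using hA.mul_mem (hGr1 r) hM
  have h1 : ∀ (h : H) (r : R), r ∈ ℛ h → ∀ M : Matrix (Fin n) (Fin n) F, sm n r M ∈ iSup C := by
    intro h r hr M
    have : (⨆ g : G, (LinearMap.range (matScalarEmb F R n).toLinearMap ⊓ 𝒜 g)) ≤
        (iSup C).comap (LinearMap.mulLeft F (Matrix.scalar (Fin n) r)) := by
      refine iSup_le fun g => ?_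
      rintro _ ⟨⟨M, rfl⟩, hM⟩
      exact (le_iSup C g) (Submodule.subset_span ⟨h, r, M, hr, hM, rfl⟩)
    exact this (hGr2 M)
  have h2 : ∀ (r : R) (M : Matrix (Fin n) (Fin n) F), sm n r M ∈ iSup C := by
    intro r M
    let L : R →ₗ[F] Matrix (Fin n) (Fin n) R :=
      { toFun := fun r => sm n r M
        map_add' := fun x y => sm_add_left x y M
        map_smul' := fun c x => sm_smul_left c x M }
    have : (⊤ : Submodule F R) ≤ (iSup C).comap L := by
      rw [← hreg.internal.submodule_iSup_eq_top]
      exact iSup_le fun h r hr => h1 h r hr M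
    exact this (show r ∈ ⊤ from trivial)
  have h3 : ∀ x, x ∈ iSup C := by
    intro x
    have : x = ∑ i, ∑ j, sm n (x i j) (Matrix.single i j (1 : F)) := by
      conv_lhs => rw [Matrix.matrix_eq_sum_single x]
      refine Finset.sum_congr rfl fun i _ => Finset.sum_congr rfl fun j _ => ?_
      ext k l
      simp [sm_apply, Matrix.single_apply]
    rw [this]
    exact Submodule.sum_mem _ fun i _ => Submodule.sum_mem _ fun j _ => h2 _ _
  intro x hx
  have h4 : x ∈ C g ⊔ ⨆ (j) (_ : j ≠ g), C j := by
    have : iSup C ≤ C g ⊔ ⨆ (j) (_ : j ≠ g), C j := by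
      refine iSup_le fun i => ?_
      by_cases hi : i = g
      · subst hi; exact le_sup_left
      · exact le_trans (le_iSup₂_of_le i hi le_rfl) le_sup_right
    exact this (h3 x)
  obtain ⟨c, hc, d, hd, hsum⟩ := Submodule.mem_sup.1 h4
  have hd' : d ∈ ⨆ (j) (_ : j ≠ g), 𝒜 j := (iSup₂_mono fun j _ => hCA j) hd
  have hd'' : d ∈ 𝒜 g := by
    have : d = x - c := by rw [← hsum]; abel
    rw [this]
    exact sub_mem hx (hCA g hc)
  have := Submodule.disjoint_def.1 (hA.internal.submodule_iSupIndep g) _ hd'' hd'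
  rw [this, add_zero] at hsum
  rw [← hsum]
  exact hc

lemma component_sum {ℛ : H → Submodule F R} {β : H → H → Fˣ} (hreg : IsRegularGrading ℛ β)
    {𝒜 : G → Submodule F (Matrix (Fin n) (Fin n) R)} (hA : IsAlgGrading 𝒜)
    (hGr1 : ∀ r : R, Matrix.scalar (Fin n) r ∈ 𝒜 1)
    (hGr2 : ∀ M : Matrix (Fin n) (Fin n) F,
      matScalarEmb F R n M ∈
        ⨆ g : G, (LinearMap.range (matScalarEmb F R n).toLinearMap ⊓ 𝒜 g))
    (g : G) (x : Matrix (Fin n) (Fin n) R) (hx : x ∈ 𝒜 g) :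
    ∃ (N : ℕ) (h : ℕ → H) (r : ℕ → R) (M : ℕ → Matrix (Fin n) (Fin n) F),
      (∀ j, r j ∈ ℛ (h j)) ∧ (∀ j, matScalarEmb F R n (M j) ∈ 𝒜 g) ∧
      x = ∑ j ∈ Finset.range N, sm n (r j) (M j) := by
  obtain ⟨N, c, y, hy⟩ := Submodule.mem_span_set'.1 (component_span hreg hA hGr1 hGr2 g hx)
  have h1 := fun i => (y i).2
  choose h r M hr hM hyM using h1
  refine ⟨N, fun j => if hj : j < N then h ⟨j, hj⟩ else 1,
    fun j => if hj : j < N then c ⟨j, hj⟩ • r ⟨j, hj⟩ else 0,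
    fun j => if hj : j < N then M ⟨j, hj⟩ else 0, ?_, ?_, ?_⟩
  · intro j
    dsimp only
    split_ifs with hj
    · exact Submodule.smul_mem _ _ (hr _)
    · exact zero_mem _
  · intro j
    dsimp only
    split_ifs with hj
    · exact hM _
    · rw [map_zero]; exact zero_mem _
  · rw [← hy, Finset.sum_range]
    refine Finset.sum_congr rfl fun i _ => ?_
    rw [hyM i]
    simp [sm_smul_left]

/-- Variables lying over `S`. -/
def overVars (S : Set (ℕ × G)) : Set (ℕ × G) := {p | ((Nat.unpair p.1).1, p.2) ∈ S}

lemma decomp [Infinite F] {ℛ : H → Submodule F R} {β : H → H → Fˣ} (hreg : IsRegularGrading ℛ β)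
    {𝒜 : G → Submodule F (Matrix (Fin n) (Fin n) R)} (hA : IsAlgGrading 𝒜)
    (hGr1 : ∀ r : R, Matrix.scalar (Fin n) r ∈ 𝒜 1)
    (hGr2 : ∀ M : Matrix (Fin n) (Fin n) F,
      matScalarEmb F R n M ∈
        ⨆ g : G, (LinearMap.range (matScalarEmb F R n).toLinearMap ⊓ 𝒜 g))
    {S : Set (ℕ × G)} {f : FreeAlgebra F (ℕ × G)} (hf : UsesVars S f)
    (a : ℕ × G → Matrix (Fin n) (Fin n) R) (ha : GradedSubst 𝒜 a) :
    ∃ (s : Finset (Multiset (ℕ × G))) (V : Multiset (ℕ × G) → Set R)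
      (P : Multiset (ℕ × G) → FreeAlgebra F (ℕ × G)) (v : Multiset (ℕ × G) → R)
      (M : ℕ × G → Matrix (Fin n) (Fin n) F),
      (∀ α, IsMon ℛ (V α)) ∧ (∀ α, v α ∈ V α) ∧ (∀ α, UsesVars (overVars S) (P α)) ∧
      GradedSubst (fun g : G => Submodule.comap (matScalarEmb F R n).toLinearMap (𝒜 g)) M ∧
      FreeAlgebra.lift F a f = ∑ α ∈ s, sm n (v α) (FreeAlgebra.lift F M (P α)) ∧
      ∀ α ∈ s, ∀ v' ∈ V α, ∀ M' : ℕ × G → Matrix (Fin n) (Fin n) F,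
        GradedSubst (fun g : G => Submodule.comap (matScalarEmb F R n).toLinearMap (𝒜 g)) M' →
        sm n v' (FreeAlgebra.lift F M' (P α)) ∈ valSpan 𝒜 f := by
  classical
  have h1 := fun p : ℕ × G => component_sum hreg hA hGr1 hGr2 p.2 (a p) (ha p)
  choose N h r M hr hM haM using h1
  let dn : ℕ × G → ℕ × G := fun y => ((Nat.unpair y.1).1, y.2)
  let dj : ℕ × G → ℕ := fun y => (Nat.unpair y.1).2
  let hd : ℕ × G → H := fun y => h (dn y) (dj y)
  let r0 : ℕ × G → R := fun y => r (dn y) (dj y)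
  let M0 : ℕ × G → Matrix (Fin n) (Fin n) F := fun y => M (dn y) (dj y)
  let Φ : FreeAlgebra F (ℕ × G) →ₐ[F] FreeAlgebra F (ℕ × G) :=
    FreeAlgebra.lift F fun p => ∑ j ∈ Finset.range (N p), FreeAlgebra.ι F (Nat.pair p.1 j, p.2)
  have hΦf : UsesVars (overVars S) (Φ f) := by
    have : Algebra.adjoin F (FreeAlgebra.ι F '' S) ≤
        (Algebra.adjoin F (FreeAlgebra.ι F '' overVars S)).comap Φ := by
      apply Algebra.adjoin_le
      rintro _ ⟨p, hp, rfl⟩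
      change Φ (FreeAlgebra.ι F p) ∈ Algebra.adjoin F (FreeAlgebra.ι F '' overVars S)
      simp only [Φ, FreeAlgebra.lift_ι_apply]
      refine Subalgebra.sum_mem _ fun j _ => Algebra.subset_adjoin ⟨_, ?_, rfl⟩
      simpa [overVars] using hp
    exact this hf
  obtain ⟨m, c, w, hw, hsum⟩ := exists_words hΦf
  have hperm : ∀ i, ∃ σ : F, ∀ r : ℕ × G → R, (∀ y, r y ∈ ℛ (hd y)) →
      ((w i).map r).prod = σ • (((w i : Multiset (ℕ × G)).toList).map r).prod := by
    intro i
    apply perm_scalar hreg hd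
    rw [← Multiset.coe_eq_coe, Multiset.coe_toList]
  choose σ hσ using hperm
  let s : Finset (Multiset (ℕ × G)) := Finset.univ.image fun i => (w i : Multiset (ℕ × G))
  let P : Multiset (ℕ × G) → FreeAlgebra F (ℕ × G) := fun α =>
    ∑ i with (w i : Multiset (ℕ × G)) = α, (c i * σ i) • ((w i).map (FreeAlgebra.ι F)).prod
  have hPhi : ∀ b : ℕ × G → Matrix (Fin n) (Fin n) R, FreeAlgebra.lift F b (Φ f) =
      FreeAlgebra.lift F
        (fun p => ∑ j ∈ Finset.range (N p), b (Nat.pair p.1 j, p.2)) f := by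
    intro b
    have : (FreeAlgebra.lift F b).comp Φ = FreeAlgebra.lift F
        (fun p => ∑ j ∈ Finset.range (N p), b (Nat.pair p.1 j, p.2)) := by
      ext p : 1
      funext p
      simp [Φ]
    exact DFunLike.congr_fun this f
  -- expansion
  have hexp : ∀ (r' : ℕ × G → R) (M' : ℕ × G → Matrix (Fin n) (Fin n) F),
      (∀ y, r' y ∈ ℛ (hd y)) →
      FreeAlgebra.lift F (fun y => sm n (r' y) (M' y)) (Φ f) =
        ∑ α ∈ s, sm n (α.toList.map r').prod (FreeAlgebra.lift F M' (P α)) := by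
    intro r' M' hr'
    rw [hsum, map_sum]
    have e1 : ∀ α, sm n (α.toList.map r').prod (FreeAlgebra.lift F M' (P α)) =
        ∑ i with (w i : Multiset (ℕ × G)) = α,
          FreeAlgebra.lift F (fun y => sm n (r' y) (M' y))
            (c i • ((w i).map (FreeAlgebra.ι F)).prod) := by
      intro α
      simp only [P]
      rw [map_sum, sm_sum_right]
      refine Finset.sum_congr rfl fun i hi => ?_
      have hi' := (Finset.mem_filter.1 hi).2
      rw [map_smul, map_smul, lift_word, lift_word, sm_list_prod, hσ i r' hr', hi', sm_smul_left,
        sm_smul_right, smul_smul]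
    simp_rw [e1]
    rw [Finset.sum_fiberwise_of_maps_to]
    intro i _
    exact Finset.mem_image_of_mem _ (Finset.mem_univ i)
  refine ⟨s, fun α => MonVals ℛ hd α.toList, P, fun α => (α.toList.map r0).prod, M0, ?_, ?_, ?_,
    ?_, ?_, ?_⟩
  · intro α; exact isMon_monVals ℛ hd _
  · intro α; exact ⟨r0, fun y => hr _ _, rfl⟩
  · intro α
    refine Subalgebra.sum_mem _ fun i _ => Subalgebra.smul_mem _ (Subalgebra.list_prod_mem _ ?_) _
    intro x hx
    obtain ⟨p, hp, rfl⟩ := List.mem_map.1 hx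
    exact Algebra.subset_adjoin ⟨p, hw i p hp, rfl⟩
  · intro y
    exact hM (dn y) (dj y)
  · rw [← hexp r0 M0 (fun y => hr _ _), hPhi]
    congr 2
    funext p
    rw [haM p]
    simp [r0, M0, dn, dj]
  · rintro α hα _ ⟨r', hr', rfl⟩ M' hM'
    refine vand (valSpan 𝒜 f) s
      (fun α => sm n (α.toList.map r').prod (FreeAlgebra.lift F M' (P α))) ?_ α hα
    intro t
    have e2 : ∑ α ∈ s, (α.map t).prod •
        sm n (α.toList.map r').prod (FreeAlgebra.lift F M' (P α)) =
        FreeAlgebra.lift F (fun y => sm n (t y • r' y) (M' y)) (Φ f) := by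
      rw [hexp (fun y => t y • r' y) M' (fun y => Submodule.smul_mem _ _ (hr' y))]
      refine Finset.sum_congr rfl fun α _ => ?_
      rw [← sm_smul_left]
      congr 1
      have : (α.map t).prod = (α.toList.map t).prod := by
        conv_lhs => rw [← Multiset.coe_toList α]
        simp only [Multiset.map_coe, Multiset.prod_coe]
      rw [this]
      generalize α.toList = l
      induction l with
      | nil => simp
      | cons y l ih =>
        simp only [List.map_cons, List.prod_cons]
        rw [← ih, smul_mul_smul_comm]
    rw [e2, hPhi]
    refine Submodule.subset_span ⟨_, ?_, rfl⟩
    intro p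
    refine Submodule.sum_mem _ fun j _ => ?_
    have := hA.mul_mem (hGr1 (t (Nat.pair p.1 j, p.2) • r' (Nat.pair p.1 j, p.2)))
      (hM' (Nat.pair p.1 j, p.2))
    simpa [sm] using this

end Decomp

/-- Let `R` be a unital algebra over an infinite field `F` of
characteristic `≠ 2` admitting a regular grading by an abelian group `H` satisfying
(R1), and let `A = Mₙ(R)` carry a `G`-grading such that (Gr1) the scalar matrices `R`
form a homogeneous subalgebra contained in the neutral component and (Gr2) `Mₙ(F)` is a
homogeneous subalgebra.  If `B = Mₙ(F)` with the inherited `G`-grading has the primeness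
property for graded central polynomials, then so does `A`. -/
theorem matrix_over_regular_primeness
    (F : Type*) [Field F] [Infinite F] (hchar : (2 : F) ≠ 0)
    {H : Type*} [CommGroup H] [DecidableEq H]
    {R : Type*} [Ring R] [Algebra F R]
    (ℛ : H → Submodule F R) (β : H → H → Fˣ)
    (hreg : IsRegularGrading ℛ β) (hR1 : CondR1 ℛ)
    {G : Type*} [Group G] [DecidableEq G] (n : ℕ)
    (𝒜 : G → Submodule F (Matrix (Fin n) (Fin n) R))
    (hA : IsAlgGrading 𝒜)
    (hGr1 : ∀ r : R, Matrix.scalar (Fin n) r ∈ 𝒜 1)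
    (hGr2 : ∀ M : Matrix (Fin n) (Fin n) F,
      matScalarEmb F R n M ∈
        ⨆ g : G, (LinearMap.range (matScalarEmb F R n).toLinearMap ⊓ 𝒜 g))
    (hB : HasGradedPrimeness
      (fun g : G => Submodule.comap (matScalarEmb F R n).toLinearMap (𝒜 g))) :
    HasGradedPrimeness 𝒜 := by
  intro S T f g hST hf hg hfg
  obtain ⟨hnid, hcen⟩ := hfg
  have hn : NeZero n := by
    refine ⟨?_⟩
    rintro rfl
    apply hnid
    intro a _
    exact Subsingleton.elim _ _
  have hUU : ∀ u ∈ valSpan 𝒜 f, ∀ v ∈ valSpan 𝒜 g, u * v ∈ Set.center _ :=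
    fun u hu v hv => valSpan_mul hST hf hg hcen hu hv
  have had : ∀ (f : FreeAlgebra F (ℕ × G)) (t v : R) (X : Matrix (Fin n) (Fin n) F),
      sm n v X ∈ valSpan 𝒜 f → sm n (t * v - v * t) X ∈ valSpan 𝒜 f := by
    intro f t v X hX
    have := valSpan_ad hA f (hGr1 t) hX
    rw [← sm_eq_scalar (F := F), sm_mul, sm_mul, one_mul, mul_one, ← sm_sub_left] at this
    exact this
  have hover : Disjoint (overVars S) (overVars T) := by
    rw [Set.disjoint_left]
    intro p h1 h2
    exact Set.disjoint_left.1 hST h1 h2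
  -- central in `B`
  have hPQ : ∀ (V W : Set R) (P Q : FreeAlgebra F (ℕ × G)), IsMon ℛ V → IsMon ℛ W →
      (∃ v ∈ V, v ≠ 0) → (∃ v ∈ W, v ≠ 0) →
      (∀ v' ∈ V, ∀ M' : ℕ × G → Matrix (Fin n) (Fin n) F,
        GradedSubst (fun g : G => Submodule.comap (matScalarEmb F R n).toLinearMap (𝒜 g)) M' →
        sm n v' (FreeAlgebra.lift F M' P) ∈ valSpan 𝒜 f) →
      (∀ v' ∈ W, ∀ M' : ℕ × G → Matrix (Fin n) (Fin n) F,
        GradedSubst (fun g : G => Submodule.comap (matScalarEmb F R n).toLinearMap (𝒜 g)) M' →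
        sm n v' (FreeAlgebra.lift F M' Q) ∈ valSpan 𝒜 g) →
      ∀ M' : ℕ × G → Matrix (Fin n) (Fin n) F,
        GradedSubst (fun g : G => Submodule.comap (matScalarEmb F R n).toLinearMap (𝒜 g)) M' →
        FreeAlgebra.lift F M' (P * Q) ∈ Set.center (Matrix (Fin n) (Fin n) F) := by
    intro V W P Q hV hW hV0 hW0 h1 h2 M' hM'
    obtain ⟨v, hv, w, hw, hne⟩ := hV.exists_mul_ne hR1 hW hV0 hW0
    have := hUU _ (h1 v hv M' hM') _ (h2 w hw M' hM')
    rw [sm_mul, ← map_mul] at this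
    exact center_of_sm hne this
  -- a nonzero value
  have hnz : ∃ (V W : Set R), IsMon ℛ V ∧ IsMon ℛ W ∧
      (∃ v ∈ V, v ≠ 0) ∧ (∃ v ∈ W, v ≠ 0) ∧ (∀ v ∈ V, sm n v (1 : Matrix (Fin n) (Fin n) F) ∈ valSpan 𝒜 f) ∧
      (∀ v ∈ W, sm n v (1 : Matrix (Fin n) (Fin n) F) ∈ valSpan 𝒜 g) := by
    unfold IsGradedIdentity at hnid
    push Not at hnid
    obtain ⟨a, ha, hane⟩ := hnid
    obtain ⟨s, V, P, v, M, hV, hv, hP, hM, hsum, hval⟩ := decomp hreg hA hGr1 hGr2 hf a ha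
    obtain ⟨s', W, Q, w, N, hW, hw, hQ, hN, hsum', hval'⟩ := decomp hreg hA hGr1 hGr2 hg a ha
    rw [map_mul, hsum, hsum', Finset.sum_mul_sum] at hane
    obtain ⟨α, hα, hane⟩ := Finset.exists_ne_zero_of_sum_ne_zero hane
    obtain ⟨γ, hγ, hane⟩ := Finset.exists_ne_zero_of_sum_ne_zero hane
    rw [sm_mul] at hane
    have hv0 : ∃ v ∈ V α, v ≠ 0 := ⟨v α, hv α, by
      intro h; rw [h, zero_mul, sm_zero_left] at hane; exact hane rfl⟩
    have hw0 : ∃ v ∈ W γ, v ≠ 0 := ⟨w γ, hw γ, by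
      intro h; rw [h, mul_zero, sm_zero_left] at hane; exact hane rfl⟩
    have hcB := hB (overVars S) (overVars T) (P α) (Q γ) hover (hP α) (hQ γ) ⟨by
      intro hid
      obtain ⟨c, hc, hc'⟩ := exists_combined hover (hP α) (hQ γ) hM hN
      rw [hid c hc] at hc'
      rw [← hc', sm_zero_right] at hane
      exact hane rfl, hPQ _ _ _ _ (hV α) (hW γ) hv0 hw0 (hval α hα) (hval' γ hγ)⟩
    have scal : ∀ (f P : FreeAlgebra F (ℕ × G)) (V : Set R),
        IsGradedCentral
          (fun g : G => Submodule.comap (matScalarEmb F R n).toLinearMap (𝒜 g)) P →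
        (∀ v' ∈ V, ∀ M' : ℕ × G → Matrix (Fin n) (Fin n) F,
        GradedSubst (fun g : G => Submodule.comap (matScalarEmb F R n).toLinearMap (𝒜 g)) M' →
        sm n v' (FreeAlgebra.lift F M' P) ∈ valSpan 𝒜 f) →
        ∀ v ∈ V, sm n v (1 : Matrix (Fin n) (Fin n) F) ∈ valSpan 𝒜 f := by
      intro f P V hP hval v hv
      obtain ⟨hn, hc⟩ := hP
      unfold IsGradedIdentity at hn
      push Not at hn
      obtain ⟨M, hM, hne⟩ := hn
      obtain ⟨c, hcM⟩ := eq_smul_one (hc M hM)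
      have hc0 : c ≠ 0 := by
        rintro rfl
        rw [zero_smul] at hcM
        exact hne hcM
      have := Submodule.smul_mem _ c⁻¹ (hval v hv M hM)
      rw [hcM, sm_smul_right, smul_smul, inv_mul_cancel₀ hc0, one_smul] at this
      exact this
    exact ⟨V α, W γ, hV α, hW γ, hv0, hw0, scal f _ _ hcB.1 (hval α hα),
      scal g _ _ hcB.2 (hval' γ hγ)⟩
  obtain ⟨V0, W0, hV0, hW0, hV0n, hW0n, hV0f, hW0g⟩ := hnz
  refine ⟨⟨?_, ?_⟩, ⟨?_, ?_⟩⟩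
  · intro hid
    apply hnid
    intro a ha
    rw [map_mul, hid a ha, zero_mul]
  · intro a ha
    obtain ⟨s, V, P, v, M, hV, hv, hP, hM, hsum, hval⟩ := decomp hreg hA hGr1 hGr2 hf a ha
    rw [hsum]
    refine (Subalgebra.center F _).sum_mem fun α hα => ?_
    by_cases hv0 : v α = 0
    · rw [hv0, sm_zero_left]; exact zero_mem _
    refine isMon_sm_central hreg hR1 (hV α) hW0 ⟨_, hv α, hv0⟩ hW0n _ ?_ ?_ _ (hv α)
    · intro v hv w hw
      have := hUU _ (hval α hα v hv M hM) _ (hW0g w hw)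
      rwa [sm_mul, mul_one] at this
    · intro l t ht v hv w hw
      have := hUU _ (had _ t _ _ (hval α hα v hv M hM)) _ (hW0g w hw)
      rwa [sm_mul, mul_one] at this
  · intro hid
    apply hnid
    intro a ha
    rw [map_mul, hid a ha, mul_zero]
  · intro a ha
    obtain ⟨s, V, P, v, M, hV, hv, hP, hM, hsum, hval⟩ := decomp hreg hA hGr1 hGr2 hg a ha
    rw [hsum]
    refine (Subalgebra.center F _).sum_mem fun α hα => ?_
    by_cases hv0 : v α = 0
    · rw [hv0, sm_zero_left]; exact zero_mem _
    obtain ⟨d, hd⟩ := (hV α).deg hreg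
    obtain ⟨e, he⟩ := hV0.deg hreg
    refine isMon_sm_central hreg hR1 (hV α) hV0 ⟨_, hv α, hv0⟩ hV0n _ ?_ ?_ _ (hv α)
    · intro v hv w hw
      have := hUU _ (hV0f w hw) _ (hval α hα v hv M hM)
      rw [sm_mul, one_mul] at this
      rw [hreg.comm (hd v hv) (he w hw), sm_smul_left]
      exact (Subalgebra.center F _).smul_mem this _
    · intro l t ht v hv w hw
      have := hUU _ (hV0f w hw) _ (had _ t _ _ (hval α hα v hv M hM))
      rw [sm_mul, one_mul] at this
      have hmem : t * v - v * t ∈ ℛ (l * d) := by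
        refine sub_mem (hreg.mul_mem ht (hd v hv)) ?_
        rw [mul_comm l d]
        exact hreg.mul_mem (hd v hv) ht
      rw [hreg.comm hmem (he w hw), sm_smul_left]
      exact (Subalgebra.center F _).smul_mem this _
end

section
/- Let F be an infinite field of characteristic different from 2 and let E be the Grassmann algebra of a countable-dimensional F-vector space. The algebra M_n(E) satisfies the primeness property for ordinary central polynomials: if f(x_1,…,x_r) and g(x_{r+1},…,x_s) are polynomials in disjoint sets of variables in the free associative algebra F⟨X⟩ and f·g is a central polynomial for M_n(E), then both f and g are central polynomials for M_n(E). -/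
section Ordinary

variable (F : Type*) [Field F] (A : Type*) [Ring A] [Algebra F A]

/-- `f` is an ordinary polynomial identity for `A`. -/
def IsIdentity (f : FreeAlgebra F ℕ) : Prop := ∀ a : ℕ → A, FreeAlgebra.lift F a f = 0

/-- `f` is an ordinary central polynomial for `A`. -/
def IsCentral (f : FreeAlgebra F ℕ) : Prop :=
  ¬ IsIdentity F A f ∧ ∀ a : ℕ → A, FreeAlgebra.lift F a f ∈ Set.center A

/-- The primeness property for ordinary central polynomials: if a product of two
polynomials in disjoint sets of variables is central, then both factors are central. -/
def HasPrimeness : Prop :=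
  ∀ (S T : Set ℕ) (f g : FreeAlgebra F ℕ),
    Disjoint S T → f ∈ Algebra.adjoin F (FreeAlgebra.ι F '' S) →
    g ∈ Algebra.adjoin F (FreeAlgebra.ι F '' T) →
    IsCentral F A (f * g) → IsCentral F A f ∧ IsCentral F A g

end Ordinary

section Grassmann

variable (F : Type*) [Field F]

/-- The Grassmann algebra of a countable dimensional `F`-vector space. -/
noncomputable abbrev Grassmann : Type _ := ExteriorAlgebra F (ℕ →₀ F)

/-- The homogeneous components `E₀`, `E₁` of the canonical `ℤ/2`-grading of the
Grassmann algebra: the spans of the products of an even (resp. odd) number of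
generators. -/
noncomputable def GrassComp (z : ZMod 2) : Submodule F (Grassmann F) :=
  ⨆ i : {m : ℕ // (m : ZMod 2) = z},
    LinearMap.range (ExteriorAlgebra.ι F (M := ℕ →₀ F)) ^ (i : ℕ)

/-- The `ℤ/2`-degree of the block of the entry `(i, j)` in `(a+b) × (a+b)` matrices. -/
def blk (a b : ℕ) (i j : Fin (a + b)) : ZMod 2 :=
  if ((i : ℕ) < a ↔ (j : ℕ) < a) then 0 else 1

/-- The underlying set of the algebra `M_{a,b}(E)`: matrices whose diagonal blocks have
entries in `E₀` and whose off-diagonal blocks have entries in `E₁`. -/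
noncomputable def MabSet (a b : ℕ) :
    Set (Matrix (Fin (a + b)) (Fin (a + b)) (Grassmann F)) :=
  {M | ∀ i j, M i j ∈ GrassComp F (blk a b i j)}

/-- The homogeneous component of degree `z` of the canonical `ℤ/2`-grading of
`M_{a,b}(E)`. -/
noncomputable def MabComp (a b : ℕ) (z : ZMod 2) :
    Set (Matrix (Fin (a + b)) (Fin (a + b)) (Grassmann F)) :=
  {M | M ∈ MabSet F a b ∧ ∀ i j, blk a b i j ≠ z → M i j = 0}

end Grassmann


namespace MGP
open CliffordAlgebra

variable {F : Type*} [Field F]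

/-- The parity involution. -/
noncomputable abbrev sg : Grassmann F →ₐ[F] Grassmann F := CliffordAlgebra.involute

/-- The generators. -/
noncomputable abbrev gen (i : ℕ) : Grassmann F := ExteriorAlgebra.ι F (Finsupp.single i 1)

lemma ι_mul_eq (m : ℕ →₀ F) (z : Grassmann F) :
    ExteriorAlgebra.ι F m * z = sg z * ExteriorAlgebra.ι F m := by
  induction z using CliffordAlgebra.induction with
  | algebraMap r => rw [AlgHom.commutes, Algebra.commutes]
  | ι x =>
    rw [involute_ι, neg_mul]
    exact eq_neg_of_add_eq_zero_left (ExteriorAlgebra.ι_add_mul_swap m x)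
  | mul a b ha hb => rw [map_mul, ← mul_assoc, ha, mul_assoc, hb, mul_assoc]
  | add a b ha hb => rw [map_add, mul_add, add_mul, ha, hb]

lemma even_commute {z : Grassmann F} (hz : sg z = z) (w : Grassmann F) : w * z = z * w := by
  induction w using CliffordAlgebra.induction with
  | algebraMap r => rw [Algebra.commutes]
  | ι x => have := ι_mul_eq x z; rw [hz] at this; exact this
  | mul a b ha hb => rw [mul_assoc, hb, ← mul_assoc, ha, mul_assoc]
  | add a b ha hb => rw [mul_add, add_mul, ha, hb]

lemma eventually_contract (w : Grassmann F) :
    ∃ N, ∀ i ≥ N, contractRight w (Finsupp.lapply (R := F) i : (ℕ →₀ F) →ₗ[F] F) = 0 := by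
  induction w using CliffordAlgebra.right_induction with
  | algebraMap r => exact ⟨0, fun i _ => contractRight_algebraMap _ _ _⟩
  | add a b ha hb =>
    obtain ⟨N, hN⟩ := ha
    obtain ⟨M, hM⟩ := hb
    refine ⟨max N M, fun i hi => ?_⟩
    rw [map_add, LinearMap.add_apply, hN i (le_trans (le_max_left _ _) hi),
      hM i (le_trans (le_max_right _ _) hi), add_zero]
  | mul_ι m x hx =>
    obtain ⟨N, hN⟩ := hx
    obtain ⟨M, hM⟩ : ∃ M, ∀ i ≥ M, m i = 0 := by
      refine ⟨m.support.sup id + 1, fun i hi => ?_⟩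
      by_contra h
      have : i ≤ m.support.sup id := Finset.le_sup (f := id) (Finsupp.mem_support_iff.2 h)
      omega
    refine ⟨max N M, fun i hi => ?_⟩
    rw [contractRight_mul_ι, hN i (le_trans (le_max_left _ _) hi), Finsupp.lapply_apply,
      hM i (le_trans (le_max_right _ _) hi), zero_smul, zero_mul, sub_zero]

lemma eq_zero_of_mul_gen {w : Grassmann F} (h : ∀ i, w * gen i = 0) : w = 0 := by
  obtain ⟨N, hN⟩ := eventually_contract w
  have := contractRight_mul_ι (Q := (0 : QuadraticForm F (ℕ →₀ F)))
    (Finsupp.lapply (R := F) N : (ℕ →₀ F) →ₗ[F] F) (Finsupp.single N 1) w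
  have h' := h N
  unfold gen at h'
  rw [hN N le_rfl, h'] at this
  simpa using this.symm

lemma even_of_central {z : Grassmann F} (hz : ∀ w, w * z = z * w) : sg z = z := by
  rw [← sub_eq_zero]
  refine eq_zero_of_mul_gen fun i => ?_
  rw [sub_mul, ← ι_mul_eq, hz, sub_self]

lemma involute_map (l : (ℕ →₀ F) →ₗ[F] (ℕ →₀ F)) (x : Grassmann F) :
    sg (ExteriorAlgebra.map l x) = ExteriorAlgebra.map l (sg x) := by
  have : (sg (F := F)).comp (ExteriorAlgebra.map l) = (ExteriorAlgebra.map l).comp sg := by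
    apply ExteriorAlgebra.hom_ext
    ext i
    simp
  exact DFunLike.congr_fun this x

lemma exists_split : ∃ s1 s2 : Grassmann F →ₐ[F] Grassmann F,
    (∀ x, sg (s1 x) = s1 (sg x)) ∧ (∀ x, sg (s2 x) = s2 (sg x)) ∧
    ∀ φ ψ : Grassmann F →ₗ[F] F, ∃ Φ : Grassmann F →ₗ[F] F,
      ∀ a b, Φ (s1 a * s2 b) = φ a * ψ b := by
  let e : (ℕ →₀ F) ≃ₗ[F] (ℕ →₀ F) × (ℕ →₀ F) :=
    (Finsupp.domLCongr (Equiv.natSumNatEquivNat.symm)).trans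
      (Finsupp.sumFinsuppLEquivProdFinsupp F)
  let l1 : (ℕ →₀ F) →ₗ[F] (ℕ →₀ F) := e.symm.toLinearMap ∘ₗ LinearMap.inl F _ _
  let l2 : (ℕ →₀ F) →ₗ[F] (ℕ →₀ F) := e.symm.toLinearMap ∘ₗ LinearMap.inr F _ _
  let Q0 : QuadraticForm F (ℕ →₀ F) := 0
  let D0 : Grassmann F →ₐ[F] CliffordAlgebra (Q0.prod Q0) :=
    ExteriorAlgebra.lift F ⟨(CliffordAlgebra.ι (Q0.prod Q0)) ∘ₗ e.toLinearMap, fun m => by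
      simp [Q0]⟩
  let D := (ofProd Q0 Q0).comp D0
  have h1 : D.comp (ExteriorAlgebra.map l1) =
      GradedTensorProduct.includeLeft (evenOdd Q0) (evenOdd Q0) := by
    apply ExteriorAlgebra.hom_ext
    ext i
    simp [D, D0, l1, Q0]
  have h2 : D.comp (ExteriorAlgebra.map l2) =
      GradedTensorProduct.includeRight (evenOdd Q0) (evenOdd Q0) := by
    apply ExteriorAlgebra.hom_ext
    ext i
    simp [D, D0, l2, Q0]
  refine ⟨ExteriorAlgebra.map l1, ExteriorAlgebra.map l2, involute_map _, involute_map _, ?_⟩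
  intro φ ψ
  refine ⟨(TensorProduct.lid F F).toLinearMap ∘ₗ (TensorProduct.map φ ψ) ∘ₗ
    (GradedTensorProduct.of F (evenOdd Q0) (evenOdd Q0)).symm.toLinearMap ∘ₗ D.toLinearMap, ?_⟩
  intro a b
  have h1' := DFunLike.congr_fun h1 a
  have h2' := DFunLike.congr_fun h2 b
  simp only [AlgHom.comp_apply] at h1' h2'
  have : D (ExteriorAlgebra.map l1 a * ExteriorAlgebra.map l2 b) =
      GradedTensorProduct.of F (evenOdd Q0) (evenOdd Q0) (a ⊗ₜ[F] b) := by
    rw [map_mul, AlgHom.comp_apply, AlgHom.comp_apply]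
    rw [AlgHom.comp_apply] at h1' h2'
    rw [h1', h2']
    rw [GradedTensorProduct.includeLeft_apply, GradedTensorProduct.includeRight_apply,
      GradedTensorProduct.tmul_one_mul_one_tmul]
  simp only [LinearMap.comp_apply, AlgHom.toLinearMap_apply, this]
  simp

section core
variable {n : ℕ}

lemma center_scalar {m : Matrix (Fin n) (Fin n) (Grassmann F)} (hm : m ∈ Set.center _) :
    ∃ z : Grassmann F, sg z = z ∧ m = Matrix.scalar (Fin n) z := by
  rw [Matrix.center_eq_scalar_image] at hm
  obtain ⟨z, hz, rfl⟩ := hm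
  exact ⟨z, even_of_central (Semigroup.mem_center_iff.1 hz), rfl⟩

lemma scalar_center {z : Grassmann F} (hz : sg z = z) :
    Matrix.scalar (Fin n) z ∈ Set.center (Matrix (Fin n) (Fin n) (Grassmann F)) := by
  rw [Matrix.center_eq_scalar_image]
  exact ⟨z, Semigroup.mem_center_iff.2 (even_commute hz), rfl⟩

/-- coefficient matrices commute up to scalars implies scalar -/
lemma commute_of_conj {R : Type*} [Ring R] [Algebra F R] {p x q : R} (hx : x * x = 0)
    (hqp : p * q = 1) (μ : F) (h : (1 + x) * p * (1 - x) = μ • p) : Commute x p := by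
  have e1 : p + x * p - p * x - x * p * x = μ • p := by rw [← h]; noncomm_ring
  have e2 : x * p - x * p * x = μ • (x * p) := by
    have := congrArg (fun t => x * t) e1
    simp only [mul_sub, mul_add, ← mul_assoc, hx, zero_mul, mul_smul_comm] at this
    rw [← this]; abel
  have e3 : x * p * x = μ • (x * p * x) := by
    have := congrArg (fun t => t * x) e2
    simp only [sub_mul, mul_assoc, hx, mul_zero, smul_mul_assoc, sub_zero] at this
    simpa only [mul_assoc] using this
  by_cases hμ : μ = 1
  · subst hμ
    rw [one_smul] at e1 e2
    have e4 : x * p * x = 0 := by simpa using e2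
    rw [e4, sub_zero, add_sub_assoc, add_eq_left, sub_eq_zero] at e1
    exact e1
  · have hμ' : (1 - μ) ≠ 0 := sub_ne_zero.2 (Ne.symm hμ)
    have e4 : x * p * x = 0 := by
      have : (1 - μ) • (x * p * x) = 0 := by rw [sub_smul, one_smul, ← e3, sub_self]
      exact (smul_eq_zero_iff_right hμ').1 this
    rw [e4, sub_zero] at e2
    have e5 : x * p = 0 := by
      have : (1 - μ) • (x * p) = 0 := by rw [sub_smul, one_smul, ← e2, sub_self]
      exact (smul_eq_zero_iff_right hμ').1 this
    have e6 : x = 0 := by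
      have := congrArg (· * q) e5
      simpa [mul_assoc, hqp] using this
    rw [e6]; exact Commute.zero_left _

lemma map_conj (φ : Grassmann F →ₗ[F] F) (u v : Matrix (Fin n) (Fin n) F)
    (x : Matrix (Fin n) (Fin n) (Grassmann F)) :
    (u.map (algebraMap F _) * x * v.map (algebraMap F _)).map φ = u * x.map φ * v := by
  ext i j
  simp only [Matrix.map_apply, Matrix.mul_apply, map_sum, ← Algebra.commutes, ← Algebra.smul_def,
    map_smul, smul_eq_mul, Finset.sum_mul, Finset.mul_sum]
  refine Finset.sum_congr rfl fun k _ => Finset.sum_congr rfl fun l _ => ?_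
  ring

lemma eq_zero_of_coeffs {x y : Matrix (Fin n) (Fin n) (Grassmann F)}
    (h : ∀ φ ψ : Grassmann F →ₗ[F] F, x.map φ * y.map ψ = 0) : x * y = 0 := by
  let b := Module.Basis.ofVectorSpace F (Grassmann F)
  ext i j
  have key : ∀ m, ∑ k, b.repr (x i k) m • y k j = 0 := by
    intro m
    rw [← Module.forall_dual_apply_eq_zero_iff F]
    intro ψ
    have := congrFun (congrFun (h (b.coord m) ψ) i) j
    simpa [Matrix.mul_apply] using this
  classical
  let S := Finset.univ.biUnion fun k => (b.repr (x i k)).support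
  have hx : ∀ k, x i k = ∑ m ∈ S, b.repr (x i k) m • b m := by
    intro k
    conv_lhs => rw [← b.linearCombination_repr (x i k)]
    rw [Finsupp.linearCombination_apply]
    refine Finsupp.sum_of_support_subset _ ?_ _ (by simp)
    exact Finset.subset_biUnion_of_mem (fun k => (b.repr (x i k)).support) (Finset.mem_univ k)
  rw [Matrix.mul_apply]
  have : ∀ k, x i k * y k j = ∑ m ∈ S, b m * (b.repr (x i k) m • y k j) := by
    intro k
    conv_lhs => rw [hx k]
    rw [Finset.sum_mul]
    refine Finset.sum_congr rfl fun m _ => ?_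
    rw [smul_mul_assoc, mul_smul_comm]
  simp_rw [this]
  rw [Finset.sum_comm]
  simp_rw [← Finset.mul_sum, key]
  simp

lemma ext_coeffs {x y : Matrix (Fin n) (Fin n) (Grassmann F)}
    (h : ∀ φ : Grassmann F →ₗ[F] F, x.map φ = y.map φ) : x = y := by
  ext i j
  rw [← sub_eq_zero, ← Module.forall_dual_apply_eq_zero_iff F]
  intro φ
  rw [map_sub, sub_eq_zero]
  exact congrFun (congrFun (h φ) i) j

lemma scalar_of_coeffs [NeZero n] {x : Matrix (Fin n) (Fin n) (Grassmann F)}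
    (h : ∀ φ : Grassmann F →ₗ[F] F, ∃ c : F, x.map φ = Matrix.scalar (Fin n) c) :
    x = Matrix.scalar (Fin n) (x 0 0) := by
  apply ext_coeffs
  intro φ
  obtain ⟨c, hc⟩ := h φ
  have h00 : φ (x 0 0) = c := by
    have := congrFun (congrFun hc 0) 0
    simpa using this
  rw [hc]
  ext i j
  by_cases hij : i = j <;> simp [hij, h00]

lemma coeffs_mul (s1 s2 : Grassmann F →ₐ[F] Grassmann F)
    (φ ψ Φ : Grassmann F →ₗ[F] F) (hΦ : ∀ a b, Φ (s1 a * s2 b) = φ a * ψ b)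
    (x y : Matrix (Fin n) (Fin n) (Grassmann F)) :
    (x.map s1 * y.map s2).map Φ = x.map φ * y.map ψ := by
  ext i j
  simp [Matrix.mul_apply, hΦ]

lemma exists_parity (h2 : (2 : F) ≠ 0) {x y : Matrix (Fin n) (Fin n) (Grassmann F)}
    (B : ∀ φ ψ : Grassmann F →ₗ[F] F,
      (x.map sg).map φ * (y.map sg).map ψ = x.map φ * y.map ψ)
    (hxy : x * y ≠ 0) :
    ∃ (ε : F) (φ ψ : Grassmann F →ₗ[F] F), (ε = 1 ∨ ε = -1) ∧ (∀ w, φ (sg w) = ε * φ w) ∧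
      (∀ w, ψ (sg w) = ε * ψ w) ∧ x.map φ * y.map ψ ≠ 0 := by
  obtain ⟨φ, ψ, hne⟩ : ∃ φ ψ : Grassmann F →ₗ[F] F, x.map φ * y.map ψ ≠ 0 := by
    by_contra! hcon
    exact hxy (eq_zero_of_coeffs hcon)
  let σ : Grassmann F →ₗ[F] Grassmann F := (sg (F := F)).toLinearMap
  have hσσ : ∀ w, σ (sg w) = w := fun w => involute_involute w
  have hσ : ∀ w, σ w = sg w := fun w => rfl
  by_cases hp : x.map (φ + φ ∘ₗ σ) * y.map (ψ + ψ ∘ₗ σ) = 0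
  · by_cases hm : x.map (φ - φ ∘ₗ σ) * y.map (ψ - ψ ∘ₗ σ) = 0
    · exfalso
      apply hne
      have a1 : ∀ (z : Matrix (Fin n) (Fin n) (Grassmann F)) (χ : Grassmann F →ₗ[F] F),
        z.map (χ + χ ∘ₗ σ) = z.map χ + (z.map sg).map χ := by
        intro z χ; ext i j; rfl
      have a2 : ∀ (z : Matrix (Fin n) (Fin n) (Grassmann F)) (χ : Grassmann F →ₗ[F] F),
        z.map (χ - χ ∘ₗ σ) = z.map χ - (z.map sg).map χ := by
        intro z χ; ext i j; rfl
      rw [a1, a1] at hp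
      rw [a2, a2] at hm
      have h4 : (2 * 2 : F) • (x.map φ * y.map ψ) = 0 := by
        have e : (x.map φ + (x.map sg).map φ) * (y.map ψ + (y.map sg).map ψ) +
          (x.map φ - (x.map sg).map φ) * (y.map ψ - (y.map sg).map ψ) =
          (2 : F) • (x.map φ * y.map ψ) + (2 : F) • ((x.map sg).map φ * (y.map sg).map ψ) := by
          simp only [two_smul]
          noncomm_ring
        rw [hp, hm, B, add_zero, ← two_smul F, smul_smul] at e
        exact e.symm
      exact (smul_eq_zero_iff_right (mul_ne_zero h2 h2)).1 h4
    · refine ⟨-1, _, _, Or.inr rfl, ?_, ?_, hm⟩ <;>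
      · intro w
        simp only [LinearMap.sub_apply, LinearMap.comp_apply, hσσ, hσ]
        ring
  · refine ⟨1, _, _, Or.inl rfl, ?_, ?_, hp⟩ <;>
    · intro w
      simp only [LinearMap.add_apply, LinearMap.comp_apply, hσσ, hσ]
      ring

theorem core (h2 : (2 : F) ≠ 0) [NeZero n] (s1 s2 : Grassmann F →ₐ[F] Grassmann F)
    (hs1 : ∀ x, sg (s1 x) = s1 (sg x)) (hs2 : ∀ x, sg (s2 x) = s2 (sg x))
    (hs : ∀ φ ψ : Grassmann F →ₗ[F] F, ∃ Φ : Grassmann F →ₗ[F] F,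
      ∀ a b, Φ (s1 a * s2 b) = φ a * ψ b)
    (X Y : Set (Matrix (Fin n) (Fin n) (Grassmann F)))
    (hconj : ∀ x ∈ X, ∀ u v, u * v = 1 → v * u = 1 → u * x * v ∈ X)
    (H1 : ∀ x ∈ X, ∀ y ∈ Y, x.map s1 * y.map s2 ∈ Set.center (Matrix (Fin n) (Fin n) (Grassmann F)))
    (H3 : ∃ x ∈ X, ∃ y ∈ Y, x * y ≠ 0) :
    X ⊆ Set.center _ ∧ Y ⊆ Set.center _ := by
  have A : ∀ x ∈ X, ∀ y ∈ Y, ∀ φ ψ : Grassmann F →ₗ[F] F, ∃ c : F,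
      x.map φ * y.map ψ = Matrix.scalar (Fin n) c := by
    intro x hx y hy φ ψ
    obtain ⟨Φ, hΦ⟩ := hs φ ψ
    obtain ⟨z, -, hz⟩ := center_scalar (H1 x hx y hy)
    refine ⟨Φ z, ?_⟩
    rw [← coeffs_mul s1 s2 φ ψ Φ hΦ, hz]
    ext i j
    by_cases hij : i = j <;> simp [hij]
  have B : ∀ x ∈ X, ∀ y ∈ Y, ∀ φ ψ : Grassmann F →ₗ[F] F,
      (x.map sg).map φ * (y.map sg).map ψ = x.map φ * y.map ψ := by
    intro x hx y hy φ ψ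
    obtain ⟨Φ, hΦ⟩ := hs φ ψ
    obtain ⟨z, hzz, hz⟩ := center_scalar (H1 x hx y hy)
    rw [← coeffs_mul s1 s2 φ ψ Φ hΦ, ← coeffs_mul s1 s2 φ ψ Φ hΦ]
    congr 1
    have e1 : (x.map sg).map s1 * (y.map sg).map s2 = (x.map s1 * y.map s2).map sg := by
      ext i j
      simp only [Matrix.mul_apply, Matrix.map_apply, map_sum, map_mul, hs1, hs2]
    rw [e1, hz]
    ext i j
    by_cases hij : i = j
    · subst hij; simpa using hzz
    · simp [hij]
  obtain ⟨x0, hx0, y0, hy0, hxy⟩ := H3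
  obtain ⟨ε, φ, ψ, hε, hφ, hψ, hne⟩ := exists_parity h2 (B x0 hx0 y0 hy0) hxy
  obtain ⟨c, hc⟩ := A x0 hx0 y0 hy0 φ ψ
  have hc0 : c ≠ 0 := by
    rintro rfl
    exact hne (by rw [hc, map_zero])
  set p := x0.map φ with hp
  set q := y0.map ψ with hq
  have hscal : ∀ (d : F), Matrix.scalar (Fin n) d = d • (1 : Matrix (Fin n) (Fin n) F) := by
    intro d
    rw [Matrix.smul_one_eq_diagonal]; rfl
  have hpq : p * (c⁻¹ • q) = 1 := by
    rw [mul_smul_comm, hc, hscal, smul_smul, inv_mul_cancel₀ hc0, one_smul]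
  have hqp : (c⁻¹ • q) * p = 1 := mul_eq_one_comm.1 hpq
  -- `p` is scalar
  obtain ⟨p0, hp0⟩ : p ∈ Set.range (Matrix.scalar (Fin n)) := by
    apply Matrix.mem_range_scalar_of_commute_single
    intro i j hij
    set e := Matrix.single i j (1 : F) with he
    have hee : e * e = 0 := by
      rw [he]
      exact Matrix.single_mul_single_of_ne _ _ _ _ hij.symm _
    have huv : (1 + e) * (1 - e) = 1 := by
      rw [add_mul, one_mul, mul_sub, hee]; simp
    have hvu : (1 - e) * (1 + e) = 1 := mul_eq_one_comm.1 huv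
    have hmem := hconj x0 hx0 ((1 + e).map (algebraMap F (Grassmann F)))
      ((1 - e).map (algebraMap F (Grassmann F)))
      (by rw [← Matrix.map_mul, huv]; simp) (by rw [← Matrix.map_mul, hvu]; simp)
    obtain ⟨d, hd⟩ := A _ hmem y0 hy0 φ ψ
    rw [map_conj, ← hp, ← hq] at hd
    refine commute_of_conj hee hpq (c⁻¹ * d) ?_
    have := congrArg (fun t => c⁻¹ • (t * p)) hd
    rw [← smul_mul_assoc, ← mul_smul_comm, mul_assoc, hqp, mul_one, hscal] at this
    rw [this, smul_mul_assoc, one_mul, smul_smul]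
  have hp0' : p0 ≠ 0 := by
    rintro rfl
    rw [map_zero] at hp0
    rw [← hp0, zero_mul] at hpq
    exact zero_ne_one hpq
  have hq0 : q = Matrix.scalar (Fin n) (p0⁻¹ * c) := by
    have h := hc
    rw [← hp0, hscal, hscal, smul_mul_assoc, one_mul] at h
    rw [hscal, ← smul_smul, ← h, smul_smul, inv_mul_cancel₀ hp0', one_smul]
  set q0 := p0⁻¹ * c with hq0def
  have hq0' : q0 ≠ 0 := mul_ne_zero (inv_ne_zero hp0') hc0
  rw [hscal] at hp0 hq0
  have hεε : ε * ε = 1 := by rcases hε with rfl | rfl <;> ring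
  have hφm : ∀ z : Matrix (Fin n) (Fin n) (Grassmann F), (z.map sg).map φ = ε • z.map φ := by
    intro z; ext i j; exact hφ _
  have hψm : ∀ z : Matrix (Fin n) (Fin n) (Grassmann F), (z.map sg).map ψ = ε • z.map ψ := by
    intro z; ext i j; exact hψ _
  -- the values are scalar
  have XS : ∀ x ∈ X, x = Matrix.scalar (Fin n) (x 0 0) := by
    intro x hx
    apply scalar_of_coeffs
    intro χ
    obtain ⟨d, hd⟩ := A x hx y0 hy0 χ ψ
    refine ⟨q0⁻¹ * d, ?_⟩
    rw [← hq, hq0, hscal, mul_smul_comm, mul_one] at hd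
    rw [hscal, ← smul_smul, ← hd, smul_smul, inv_mul_cancel₀ hq0', one_smul]
  have YS : ∀ y ∈ Y, y = Matrix.scalar (Fin n) (y 0 0) := by
    intro y hy
    apply scalar_of_coeffs
    intro χ
    obtain ⟨d, hd⟩ := A x0 hx0 y hy φ χ
    refine ⟨p0⁻¹ * d, ?_⟩
    rw [← hp, ← hp0, hscal, smul_mul_assoc, one_mul] at hd
    rw [hscal, ← smul_smul, ← hd, smul_smul, inv_mul_cancel₀ hp0', one_smul]
  -- parity
  have XP : ∀ x ∈ X, x.map sg = ε • x := by
    intro x hx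
    apply ext_coeffs
    intro χ
    have h := B x hx y0 hy0 χ ψ
    rw [hψm, ← hq, hq0, mul_smul_comm, mul_smul_comm, mul_smul_comm, mul_one, mul_one] at h
    have h' := congrArg (fun t => (q0⁻¹ * ε) • t) h
    simp only [smul_smul] at h'
    have k1 : q0⁻¹ * ε * (ε * q0) = 1 := by
      rw [show q0⁻¹ * ε * (ε * q0) = (ε * ε) * (q0⁻¹ * q0) by ring, hεε, inv_mul_cancel₀ hq0',
        one_mul]
    have k2 : q0⁻¹ * ε * q0 = ε := by field_simp
    rw [k1, k2, one_smul] at h'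
    rw [h']
    ext i j
    simp
  have YP : ∀ y ∈ Y, y.map sg = ε • y := by
    intro y hy
    apply ext_coeffs
    intro χ
    have h := B x0 hx0 y hy φ χ
    rw [hφm, ← hp, ← hp0, smul_mul_assoc, smul_mul_assoc, smul_mul_assoc, one_mul, one_mul] at h
    have h' := congrArg (fun t => (p0⁻¹ * ε) • t) h
    simp only [smul_smul] at h'
    have k1 : p0⁻¹ * ε * (ε * p0) = 1 := by
      rw [show p0⁻¹ * ε * (ε * p0) = (ε * ε) * (p0⁻¹ * p0) by ring, hεε, inv_mul_cancel₀ hp0',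
        one_mul]
    have k2 : p0⁻¹ * ε * p0 = ε := by field_simp
    rw [k1, k2, one_smul] at h'
    rw [h']
    ext i j
    simp
  have XP0 : ∀ x ∈ X, sg (x 0 0) = ε • x 0 0 := fun x hx => congrFun (congrFun (XP x hx) 0) 0
  have YP0 : ∀ y ∈ Y, sg (y 0 0) = ε • y 0 0 := fun y hy => congrFun (congrFun (YP y hy) 0) 0
  rcases hε with rfl | rfl
  · constructor
    · intro x hx
      rw [XS x hx]
      exact scalar_center (by rw [XP0 x hx, one_smul])
    · intro y hy
      rw [YS y hy]
      exact scalar_center (by rw [YP0 y hy, one_smul])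
  · exfalso
    have hα : x0 0 0 = 0 := by
      apply eq_zero_of_mul_gen
      intro i
      set α := x0 0 0 with hαdef
      have hsα : sg α = -α := by rw [XP0 x0 hx0, neg_one_smul]
      have hgg : (gen i : Grassmann F) * gen i = 0 := ExteriorAlgebra.ι_sq_zero _
      have hga : gen i * α = -(α * gen i) := by
        have := ι_mul_eq (Finsupp.single i 1) α
        rw [hsα, neg_mul] at this
        exact this
      have huv : (1 + gen i : Grassmann F) * (1 - gen i) = 1 := by
        rw [add_mul, one_mul, mul_sub, hgg]; simp
      have hvu : (1 - gen i : Grassmann F) * (1 + gen i) = 1 := by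
        rw [sub_mul, one_mul, mul_add, hgg]; simp
      have hmem := hconj x0 hx0 (Matrix.scalar (Fin n) (1 + gen i))
        (Matrix.scalar (Fin n) (1 - gen i)) (by rw [← map_mul, huv, map_one])
        (by rw [← map_mul, hvu, map_one])
      rw [XS x0 hx0, ← map_mul, ← map_mul] at hmem
      have h := XP0 _ hmem
      have h00 : ∀ z : Grassmann F, Matrix.scalar (Fin n) z 0 0 = z := by intro z; simp
      rw [h00, neg_one_smul] at h
      have hval : (1 + gen i) * α * (1 - gen i) = α - (2 : F) • (α * gen i) := by
        have : (1 + gen i) * α * (1 - gen i) = α + gen i * α - α * gen i - gen i * α * gen i := by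
          noncomm_ring
        rw [this, hga, neg_mul, mul_assoc, hgg, two_smul]
        simp only [mul_zero]
        abel
      have hsg : sg (gen i : Grassmann F) = - gen i := involute_ι _
      rw [← hαdef, hval, map_sub, map_smul, map_mul, hsα, hsg, neg_mul_neg] at h
      have h4 : (2 * 2 : F) • (α * gen i) = 0 := by
        have h5 : -α - (2 : F) • (α * gen i) + (α - (2 : F) • (α * gen i)) = 0 := by
          rw [h]; abel
        rw [← smul_smul, two_smul]
        rw [← neg_eq_zero, ← h5]
        abel
      exact (smul_eq_zero_iff_right (mul_ne_zero h2 h2)).1 h4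
    apply hxy
    rw [XS x0 hx0, hα, map_zero, zero_mul]

end core

section free
variable {A : Type*} [Ring A] [Algebra F A]

lemma lift_congr {S : Set ℕ} {f : FreeAlgebra F ℕ}
    (hf : f ∈ Algebra.adjoin F (FreeAlgebra.ι F '' S)) {a b : ℕ → A} (h : ∀ i ∈ S, a i = b i) :
    FreeAlgebra.lift F a f = FreeAlgebra.lift F b f := by
  induction hf using Algebra.adjoin_induction with
  | mem x hx =>
    obtain ⟨i, hi, rfl⟩ := hx
    simp [h i hi]
  | algebraMap r => simp
  | add x y _ _ hx hy => rw [map_add, map_add, hx, hy]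
  | mul x y _ _ hx hy => rw [map_mul, map_mul, hx, hy]

lemma lift_hom {B : Type*} [Ring B] [Algebra F B] (t : A →ₐ[F] B) (a : ℕ → A)
    (f : FreeAlgebra F ℕ) : t (FreeAlgebra.lift F a f) = FreeAlgebra.lift F (fun i => t (a i)) f := by
  have : t.comp (FreeAlgebra.lift F a) = FreeAlgebra.lift F (fun i => t (a i)) := by
    apply FreeAlgebra.hom_ext
    ext i
    simp
  exact DFunLike.congr_fun this f

lemma lift_conj (u v : A) (huv : u * v = 1) (hvu : v * u = 1) (a : ℕ → A)
    (f : FreeAlgebra F ℕ) :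
    u * FreeAlgebra.lift F a f * v = FreeAlgebra.lift F (fun i => u * a i * v) f := by
  induction f using FreeAlgebra.induction with
  | grade0 r => rw [AlgHom.commutes, AlgHom.commutes, ← Algebra.commutes, mul_assoc, huv, mul_one]
  | grade1 x => simp
  | add x y hx hy => rw [map_add, map_add, ← hx, ← hy, mul_add, add_mul]
  | mul x y hx hy =>
    rw [map_mul, map_mul, ← hx, ← hy]
    simp only [mul_assoc]
    rw [← mul_assoc v u, hvu, one_mul]

end free

end MGP

/-- Let `F` be an infinite field of characteristic `≠ 2` and `E` the
Grassmann algebra of a countable dimensional `F`-vector space.  The algebra `Mₙ(E)`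
satisfies the primeness property for ordinary central polynomials. -/
theorem matrix_grassmann_primeness
    (F : Type*) [Field F] [Infinite F] (hchar : (2 : F) ≠ 0) (n : ℕ) :
    HasPrimeness F (Matrix (Fin n) (Fin n) (Grassmann F)) := by
  intro S T f g hST hf hg hfg
  obtain ⟨hni, hcen⟩ := hfg
  have hnf : ¬ IsIdentity F (Matrix (Fin n) (Fin n) (Grassmann F)) f := fun h =>
    hni fun a => by rw [map_mul, h a, zero_mul]
  have hng : ¬ IsIdentity F (Matrix (Fin n) (Fin n) (Grassmann F)) g := fun h =>
    hni fun a => by rw [map_mul, h a, mul_zero]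
  rcases Nat.eq_zero_or_pos n with rfl | hn
  · exact absurd (fun a => Subsingleton.elim _ _) hni
  have : NeZero n := ⟨hn.ne'⟩
  obtain ⟨s1, s2, hs1, hs2, hs⟩ := MGP.exists_split (F := F)
  have key := MGP.core (n := n) hchar s1 s2 hs1 hs2 hs
    (Set.range fun a => FreeAlgebra.lift F a f) (Set.range fun a => FreeAlgebra.lift F a g)
    (by
      rintro _ ⟨a, rfl⟩ u v huv hvu
      exact ⟨_, (MGP.lift_conj u v huv hvu a f).symm⟩)
    (by
      rintro _ ⟨a, rfl⟩ _ ⟨b, rfl⟩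
      classical
      have h := hcen (fun i => if i ∈ S then (a i).map s1 else (b i).map s2)
      rw [map_mul, MGP.lift_congr hf (b := fun i => (a i).map s1) (by intro i hi; simp [hi]),
        MGP.lift_congr hg (b := fun i => (b i).map s2)
          (by intro i hi; simp [Set.disjoint_right.1 hST hi])] at h
      have e1 := MGP.lift_hom (AlgHom.mapMatrix (m := Fin n) s1) a f
      have e2 := MGP.lift_hom (AlgHom.mapMatrix (m := Fin n) s2) b g
      simp only [AlgHom.mapMatrix_apply] at e1 e2
      rw [← e1, ← e2] at h
      exact h)
    (by
      unfold IsIdentity at hni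
      push Not at hni
      obtain ⟨a, ha⟩ := hni
      rw [map_mul] at ha
      exact ⟨_, ⟨a, rfl⟩, _, ⟨a, rfl⟩, ha⟩)
  exact ⟨⟨hnf, fun a => key.1 ⟨a, rfl⟩⟩, ⟨hng, fun a => key.2 ⟨a, rfl⟩⟩⟩
end

section
/- Let F be an infinite field of characteristic different from 2, let G be a group with no non-trivial group homomorphism G → F^×, and let E be the Grassmann algebra. If M_n(E) carries a G-grading such that E (identified with the scalar matrices) is a homogeneous subalgebra contained in the neutral component and M_n(F) is a homogeneous subalgebra whose inherited grading is a crossed product grading, then M_n(E) satisfies the primeness property for graded central polynomials. -/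
section Elementary

variable (F : Type*) [Field F] {G : Type*} [Group G] {n : ℕ}

/-- The homogeneous component of degree `x` of the elementary grading of `Mₙ(F)`
induced by the tuple `v`: it is spanned by the matrix units `E i j` with
`(v i)⁻¹ * v j = x`. -/
def elemComp (v : Fin n → G) (x : G) : Submodule F (Matrix (Fin n) (Fin n) F) where
  carrier := {M | ∀ i j, (v i)⁻¹ * v j ≠ x → M i j = 0}
  add_mem' := by
    intro M N hM hN i j h
    simp [Matrix.add_apply, hM i j h, hN i j h]
  zero_mem' := by intro i j _; simp
  smul_mem' := by
    intro c M hM i j h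
    simp [Matrix.smul_apply, hM i j h]

/-- The subgroup of permutations `σ` of `{1,…,n}` for which the automorphism `Λ_σ`
(which sends `E i j` to `E (σ i) (σ j)`) is a graded automorphism. -/
def GradedPerms (v : Fin n → G) : Subgroup (Equiv.Perm (Fin n)) where
  carrier := {σ | ∀ i j, (v (σ i))⁻¹ * v (σ j) = (v i)⁻¹ * v j}
  one_mem' := by intro i j; simp
  mul_mem' := by
    intro σ τ hσ hτ i j
    simpa [Equiv.Perm.mul_apply] using (hσ (τ i) (τ j)).trans (hτ i j)
  inv_mem' := by
    intro σ hσ i j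
    simpa using (hσ (σ⁻¹ i) (σ⁻¹ j)).symm

/-- The automorphism `Λ_σ` of the matrix algebra, determined by
`Λ_σ (E i j) = E (σ i) (σ j)`. -/
def permConj (σ : Equiv.Perm (Fin n)) (M : Matrix (Fin n) (Fin n) F) :
    Matrix (Fin n) (Fin n) F :=
  M.submatrix ⇑σ.symm ⇑σ.symm

end Elementary

section Facts

variable {F : Type*} [Field F]

/-- The splitting data of the Grassmann algebra used in the proof. -/
structure SuperData (F K : Type*) [Field F] [Ring K] [Algebra F K] where
  L : K →ₐ[F] K
  R : K →ₐ[F] K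
  sgn : K →ₐ[F] K
  θ : K
  split : ∀ φ ψ : Module.Dual F K, ∃ χ : Module.Dual F K, ∀ x y, χ (L x * R y) = φ x * ψ y
  invol : ∀ x, sgn (sgn x) = x
  central : ∀ x, sgn x = x → ∀ y, x * y = y * x
  sgnθ : sgn θ = -θ
  sq : θ * θ = 0
  ne : θ ≠ 0
  comm : ∀ x, R θ * L x = L (sgn x) * R θ
  sgnL : ∀ x, sgn (L x) = L (sgn x)
  sgnR : ∀ x, sgn (R x) = R (sgn x)

theorem exists_equiv_prod (F : Type*) [Field F] :
    Nonempty (((ℕ →₀ F) × (ℕ →₀ F)) ≃ₗ[F] (ℕ →₀ F)) :=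
  ⟨(Finsupp.sumFinsuppLEquivProdFinsupp F).symm.trans
    (Finsupp.domLCongr Equiv.natSumNatEquivNat)⟩

theorem ext_anticomm {M : Type*} [AddCommGroup M] [Module F M] (m : M) (x : ExteriorAlgebra F M) :
    ExteriorAlgebra.ι F m * x = CliffordAlgebra.involute x * ExteriorAlgebra.ι F m := by
  induction x using ExteriorAlgebra.induction with
  | algebraMap r => rw [AlgHom.commutes, Algebra.commutes]
  | ι y =>
    have h := ExteriorAlgebra.ι_add_mul_swap (R := F) m y
    rw [CliffordAlgebra.involute_ι, neg_mul]
    exact eq_neg_of_add_eq_zero_left h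
  | mul a b ha hb => rw [map_mul, ← mul_assoc, ha, mul_assoc, hb, mul_assoc]
  | add a b ha hb => rw [map_add, mul_add, add_mul, ha, hb]

theorem ext_central {M : Type*} [AddCommGroup M] [Module F M] (x : ExteriorAlgebra F M)
    (hx : CliffordAlgebra.involute x = x) (y : ExteriorAlgebra F M) : x * y = y * x := by
  induction y using ExteriorAlgebra.induction with
  | algebraMap r => rw [Algebra.commutes]
  | ι y => rw [ext_anticomm, hx]
  | mul a b ha hb => rw [← mul_assoc, ha, mul_assoc, hb, mul_assoc]
  | add a b ha hb => rw [mul_add, add_mul, ha, hb]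

open scoped TensorProduct in
theorem superData_exists (F : Type*) [Field F] : Nonempty (SuperData F (Grassmann F)) := by
  obtain ⟨e⟩ := exists_equiv_prod F
  let Q : QuadraticForm F (ℕ →₀ F) := 0
  let i : Q.prod Q →qᵢ Q := { toLinearMap := e.toLinearMap, map_app' := by intro m; simp [Q] }
  let j : Q →qᵢ Q.prod Q := { toLinearMap := e.symm.toLinearMap, map_app' := by intro m; simp [Q] }
  let l : Q →qᵢ Q := i.comp (QuadraticMap.Isometry.inl Q Q)
  let r : Q →qᵢ Q := i.comp (QuadraticMap.Isometry.inr Q Q)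
  have hjl : j.comp l = QuadraticMap.Isometry.inl Q Q := by
    ext1 m; exact e.symm_apply_apply (m, 0)
  have hjr : j.comp r = QuadraticMap.Isometry.inr Q Q := by
    ext1 m; exact e.symm_apply_apply (0, m)
  let L : CliffordAlgebra Q →ₐ[F] CliffordAlgebra Q := CliffordAlgebra.map l
  let R : CliffordAlgebra Q →ₐ[F] CliffordAlgebra Q := CliffordAlgebra.map r
  let J : CliffordAlgebra Q →ₐ[F] CliffordAlgebra (Q.prod Q) := CliffordAlgebra.map j
  have hJL : ∀ x, J (L x) = CliffordAlgebra.map (QuadraticMap.Isometry.inl Q Q) x := by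
    intro x
    rw [← hjl, ← CliffordAlgebra.map_comp_map]; rfl
  have hJR : ∀ x, J (R x) = CliffordAlgebra.map (QuadraticMap.Isometry.inr Q Q) x := by
    intro x
    rw [← hjr, ← CliffordAlgebra.map_comp_map]; rfl
  have hinv : ∀ (s : Q →qᵢ Q) (x : CliffordAlgebra Q),
      CliffordAlgebra.involute (CliffordAlgebra.map s x)
        = CliffordAlgebra.map s (CliffordAlgebra.involute x) := by
    intro s x
    have : (CliffordAlgebra.involute).comp (CliffordAlgebra.map s)
        = (CliffordAlgebra.map s).comp (CliffordAlgebra.involute) := by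
      ext m; simp
    exact DFunLike.congr_fun this x
  let m : ℕ →₀ F := Finsupp.single 0 1
  refine ⟨{
    L := L, R := R, sgn := CliffordAlgebra.involute, θ := ExteriorAlgebra.ι F m,
    split := ?_, invol := CliffordAlgebra.involute_involute, central := ext_central,
    sgnθ := CliffordAlgebra.involute_ι _, sq := ExteriorAlgebra.ι_sq_zero m,
    ne := ?_, comm := ?_, sgnL := hinv l,
    sgnR := hinv r }⟩
  · intro φ ψ
    let T : CliffordAlgebra Q ⊗[F] CliffordAlgebra Q →ₗ[F] F :=
      (TensorProduct.lid F F).toLinearMap ∘ₗ TensorProduct.map φ ψ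
    let T' := T ∘ₗ (GradedTensorProduct.of F (CliffordAlgebra.evenOdd Q)
      (CliffordAlgebra.evenOdd Q)).symm.toLinearMap
    refine ⟨T' ∘ₗ (CliffordAlgebra.ofProd Q Q).toLinearMap ∘ₗ J.toLinearMap, fun x y => ?_⟩
    have h1 : J (L x * R y) = CliffordAlgebra.toProd Q Q (x ᵍ⊗ₜ[F] y) := by
      rw [map_mul, hJL, hJR, CliffordAlgebra.toProd, GradedTensorProduct.lift_tmul]
    have h2 : CliffordAlgebra.ofProd Q Q (J (L x * R y)) = (x ᵍ⊗ₜ[F] y) := by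
      rw [h1]; exact DFunLike.congr_fun (CliffordAlgebra.ofProd_comp_toProd Q Q) _
    change T' (CliffordAlgebra.ofProd Q Q (J (L x * R y))) = _
    rw [h2]
    simp [T', T]
  · simp [m, ExteriorAlgebra.ι_eq_zero_iff]
  · intro x
    have := ext_anticomm (F := F) (r m) (L x)
    rw [show R (ExteriorAlgebra.ι F m) = ExteriorAlgebra.ι F (r m) from
      CliffordAlgebra.map_apply_ι r m, this]
    rw [show CliffordAlgebra.involute (L x) = L (CliffordAlgebra.involute x) from hinv l x]

end Facts

section Core2

variable {F K : Type*} [Field F] [Ring K] [Algebra F K]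

/-- Conjugation by a unit as an algebra endomorphism. -/
def conjHom (F : Type*) {K : Type*} [Field F] [Ring K] [Algebra F K]
    (u u' : K) (h : u' * u = 1) (h' : u * u' = 1) : K →ₐ[F] K where
  toFun x := u * x * u'
  map_one' := by simp [h']
  map_mul' x y := by
    calc u * (x * y) * u' = u * x * 1 * y * u' := by simp [mul_assoc]
      _ = _ := by rw [← h]; simp [mul_assoc]
  map_zero' := by simp
  map_add' x y := by simp [mul_add, add_mul]
  commutes' r := by rw [← Algebra.commutes, mul_assoc, h', mul_one]

theorem dual_ext {x y : K} (h : ∀ φ : Module.Dual F K, φ x = φ y) : x = y := by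
  rw [← sub_eq_zero, ← Module.forall_dual_apply_eq_zero_iff F]
  intro φ; simp [h φ]

theorem exists_dual_one {x : K} (h : x ≠ 0) : ∃ φ : Module.Dual F K, φ x = 1 := by
  by_contra hc
  push Not at hc
  apply h
  rw [← Module.forall_dual_apply_eq_zero_iff F]
  intro φ
  by_contra h0
  exact hc ((φ x)⁻¹ • φ) (by simp [h0])

theorem SuperData.tmul_eq (S : SuperData F K) {x x' y y' : K}
    (h : S.L x * S.R y = S.L x' * S.R y') (φ ψ : Module.Dual F K) :
    φ x * ψ y = φ x' * ψ y' := by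
  obtain ⟨χ, hχ⟩ := S.split φ ψ
  rw [← hχ, ← hχ, h]

theorem SuperData.cancel (S : SuperData F K) {x x' y : K} (hy : y ≠ 0)
    (h : S.L x * S.R y = S.L x' * S.R y) : x = x' := by
  obtain ⟨ψ, hψ⟩ := exists_dual_one (F := F) hy
  apply dual_ext (F := F)
  intro φ
  simpa [hψ] using S.tmul_eq h φ ψ

theorem core_scalar (hchar : (2 : F) ≠ 0) (S : SuperData F K) (U W : Set K)
    (hU : ∀ (τ : K →ₐ[F] K), ∀ x ∈ U, τ x ∈ U) (hW : ∀ (τ : K →ₐ[F] K), ∀ x ∈ W, τ x ∈ W)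
    (hc : ∀ x ∈ U, ∀ y ∈ W, ∀ z, x * y * z = z * (x * y))
    (u₀ w₀ : K) (hu₀ : u₀ ∈ U) (hw₀ : w₀ ∈ W) (hu : u₀ ≠ 0) (hw : w₀ ≠ 0) :
    (∀ x ∈ U, S.sgn x = x) ∧ (∀ x ∈ W, S.sgn x = x) := by
  have h1 : ∀ x ∈ U, ∀ y ∈ W, S.sgn (x * y) = x * y := by
    intro x hx y hy
    have := hc _ (hU S.L x hx) _ (hW S.L y hy) (S.R S.θ)
    rw [← map_mul, S.comm] at this
    exact (S.cancel S.ne this).symm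
  have h2 : ∀ x ∈ U, ∀ y ∈ W, ∀ φ ψ : Module.Dual F K, φ (S.sgn x) * ψ (S.sgn y) = φ x * ψ y := by
    intro x hx y hy
    have := h1 _ (hU S.L x hx) _ (hW S.R y hy)
    rw [map_mul, S.sgnL, S.sgnR] at this
    exact S.tmul_eq this
  obtain ⟨φ, hφ⟩ := exists_dual_one (F := F) hu
  obtain ⟨ψ, hψ⟩ := exists_dual_one (F := F) hw
  set c := ψ (S.sgn w₀) with hcdef
  have h3 : ∀ x ∈ U, x = c • S.sgn x := by
    intro x hx
    apply dual_ext (F := F)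
    intro φ'
    have := h2 x hx w₀ hw₀ φ' ψ
    rw [hψ, mul_one] at this
    rw [← this, map_smul, smul_eq_mul, mul_comm]
  have hc2 : c * c = 1 := by
    have e1 := h3 u₀ hu₀
    have e2 : S.sgn u₀ = c • u₀ := by
      conv_lhs => rw [e1]
      rw [map_smul, S.invol]
    rw [e2, smul_smul] at e1
    have := congrArg φ e1
    rw [map_smul, hφ] at this
    simpa using this.symm
  have hc1 : c = 1 := by
    rcases mul_self_eq_one_iff.mp hc2 with h | h
    · exact h
    exfalso
    have h4 : ∀ x ∈ U, S.sgn x = -x := by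
      intro x hx
      have := h3 x hx
      rw [h, neg_smul, one_smul] at this
      rw [eq_neg_iff_add_eq_zero, add_comm, ← eq_neg_iff_add_eq_zero]; exact this
    have hsq : S.R S.θ * S.R S.θ = 0 := by rw [← map_mul, S.sq, map_zero]
    have k1 : (1 - S.R S.θ) * (1 + S.R S.θ) = 1 := by
      rw [sub_mul, mul_add, mul_add, hsq]; simp
    have k2 : (1 + S.R S.θ) * (1 - S.R S.θ) = 1 := by
      rw [add_mul, mul_sub, mul_sub, hsq]; simp
    have h5 := h4 _ (hU (conjHom F _ _ k1 k2) _ (hU S.L u₀ hu₀))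
    have h6 : (conjHom F _ _ k1 k2) (S.L u₀) = S.L u₀ - S.L ((2 : F) • u₀) * S.R S.θ := by
      change (1 + S.R S.θ) * S.L u₀ * (1 - S.R S.θ) = _
      rw [add_mul, one_mul, S.comm, h4 u₀ hu₀, map_neg, mul_sub, mul_one, add_mul,
        mul_assoc (-S.L u₀), hsq, two_smul, map_add, add_mul]
      simp only [mul_zero, neg_mul]
      abel
    rw [h6, map_sub, map_mul, S.sgnL, S.sgnL, S.sgnR, S.sgnθ, map_smul, h4 u₀ hu₀, smul_neg] at h5
    simp only [map_neg, neg_mul_neg] at h5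
    have h7 : S.L ((2 : F) • u₀ + (2 : F) • u₀) * S.R S.θ = S.L 0 * S.R S.θ := by
      rw [map_add, add_mul, map_zero, zero_mul]
      have := congrArg (fun t => -(t + S.L u₀) + S.L ((2 : F) • u₀) * S.R S.θ) h5
      convert this using 1 <;> abel
    have h8 := S.cancel S.ne h7
    rw [← two_smul F ((2 : F) • u₀)] at h8
    simp [hchar, hu] at h8
  refine ⟨fun x hx => ?_, fun y hy => ?_⟩
  · have := h3 x hx
    rw [hc1, one_smul] at this
    exact this.symm
  · have e : S.sgn u₀ = u₀ := by
      have := h3 u₀ hu₀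
      rw [hc1, one_smul] at this
      exact this.symm
    apply dual_ext (F := F)
    intro ψ'
    have := h2 u₀ hu₀ y hy φ ψ'
    rwa [e, hφ, one_mul, one_mul] at this

end Core2

section Core1

variable {F K : Type*} [Field F] [Ring K] [Algebra F K]

theorem map_mul_eq_zero {n : ℕ} (X Y : Matrix (Fin n) (Fin n) K)
    (h : ∀ φ ψ : Module.Dual F K, X.map φ * Y.map ψ = 0) : X * Y = 0 := by
  classical
  let b := Module.Basis.ofVectorSpace F K
  ext i j
  have h1 : ∀ φ : Module.Dual F K, ∑ k, φ (X i k) • Y k j = 0 := by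
    intro φ
    apply dual_ext (F := F)
    intro ψ
    have := congrFun (congrFun (h φ ψ) i) j
    rw [Matrix.mul_apply] at this
    simpa using this
  let T : Finset (Module.Basis.ofVectorSpaceIndex F K) :=
    Finset.univ.biUnion fun k => (b.repr (X i k)).support
  have h2 : ∀ k, X i k = ∑ s ∈ T, b.coord s (X i k) • b s := by
    intro k
    conv_lhs => rw [← b.linearCombination_repr (X i k), Finsupp.linearCombination_apply]
    refine Finsupp.sum_of_support_subset _ ?_ _ (by simp)
    intro s hs
    exact Finset.mem_biUnion.mpr ⟨k, Finset.mem_univ _, hs⟩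
  rw [Matrix.mul_apply]
  calc ∑ k, X i k * Y k j = ∑ k, ∑ s ∈ T, b s * (b.coord s (X i k) • Y k j) := by
        refine Finset.sum_congr rfl fun k _ => ?_
        conv_lhs => rw [h2 k]
        rw [Finset.sum_mul]
        refine Finset.sum_congr rfl fun s _ => ?_
        rw [smul_mul_assoc, mul_smul_comm]
    _ = ∑ s ∈ T, b s * ∑ k, b.coord s (X i k) • Y k j := by
        rw [Finset.sum_comm]
        simp [Finset.mul_sum]
    _ = 0 := Finset.sum_eq_zero fun s _ => by rw [h1, mul_zero]

/-- Rescaling of the entries, i.e. conjugation by an invertible diagonal matrix over `F`. -/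
def diagHom {n : ℕ} (K : Type*) [Ring K] [Algebra F K] (d : Fin n → Fˣ) :
    Matrix (Fin n) (Fin n) K →ₐ[F] Matrix (Fin n) (Fin n) K where
  toFun X := Matrix.of fun i j => ((d i : F) * ((d j)⁻¹ : Fˣ)) • X i j
  map_one' := by
    ext i j
    by_cases h : i = j
    · subst h; simp
    · simp [h]
  map_mul' X Y := by
    ext i j
    simp only [Matrix.of_apply, Matrix.mul_apply, Finset.smul_sum]
    refine Finset.sum_congr rfl fun k _ => ?_
    rw [smul_mul_smul_comm]
    congr 1
    calc (d i : F) * ((d j)⁻¹ : Fˣ) = d i * (((d k)⁻¹ : Fˣ) * (d k : F)) * ((d j)⁻¹ : Fˣ) := by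
          simp
      _ = _ := by ring
  map_zero' := by ext i j; simp
  map_add' X Y := by ext i j; simp
  commutes' r := by
    ext i j
    by_cases h : i = j
    · subst h; simp
    · simp [h, Matrix.algebraMap_matrix_apply]

/-- A linear endomorphism preserving the elementary grading support. -/
def SuppPres {G : Type*} [Group G] {n : ℕ} (v : Fin n → G)
    (Φ : Matrix (Fin n) (Fin n) K → Matrix (Fin n) (Fin n) K) : Prop :=
  ∀ (g : G) (X : Matrix (Fin n) (Fin n) K),
    (∀ i j, (v i)⁻¹ * v j ≠ g → X i j = 0) → ∀ i j, (v i)⁻¹ * v j ≠ g → Φ X i j = 0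

theorem const_of_quasi {G : Type*} [Group G] (hG : ∀ φ : G →* Fˣ, φ = 1)
    (a : G → F) (ha : ∀ g, a g ≠ 0) (h : ∀ g, ∃ d : F, ∀ x, a (g * x) = d * a x) (g : G) :
    a g = a 1 := by
  have h1 : ∀ g x, a (g * x) * a 1 = a g * a x := by
    intro g x
    obtain ⟨d, hd⟩ := h g
    have e := hd 1
    rw [mul_one] at e
    rw [hd, e]; ring
  let φ : G →* Fˣ :=
    { toFun := fun g => Units.mk0 (a g / a 1) (div_ne_zero (ha g) (ha 1))
      map_one' := by ext; simp [ha 1]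
      map_mul' := by
        intro x y
        ext
        have := h1 x y
        have := ha 1
        simp only [Units.val_mk0, Units.val_mul]
        field_simp
        linear_combination h1 x y }
  have h2 := congrArg (fun u : Fˣ => (u : F)) (DFunLike.congr_fun (hG φ) g)
  simp only [MonoidHom.one_apply, Units.val_one] at h2
  have h3 : a g / a 1 = 1 := h2
  rwa [div_eq_one_iff_eq (ha 1)] at h3

theorem exists_good [Infinite F] : ∃ t : Fˣ, (t : F) ≠ 1 ∧ (t : F) * t ≠ 1 := by
  classical
  obtain ⟨t, ht⟩ := Infinite.exists_notMem_finset ({0, 1, -1} : Finset F)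
  simp only [Finset.mem_insert, Finset.mem_singleton, not_or] at ht
  refine ⟨Units.mk0 t ht.1, ht.2.1, ?_⟩
  intro h
  rcases mul_self_eq_one_iff.mp h with h | h
  · exact ht.2.1 h
  · exact ht.2.2 h

theorem core_matrix [Infinite F] (hchar : (2 : F) ≠ 0) (S : SuperData F K)
    {G : Type*} [Group G] (hG : ∀ φ : G →* Fˣ, φ = 1) {n : ℕ}
    (v : Fin n → G) (hv : Function.Bijective v)
    (U W : Set (Matrix (Fin n) (Fin n) K))
    (hU : ∀ Φ : Matrix (Fin n) (Fin n) K →ₐ[F] Matrix (Fin n) (Fin n) K,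
      SuppPres v Φ → ∀ X ∈ U, Φ X ∈ U)
    (hW : ∀ Φ : Matrix (Fin n) (Fin n) K →ₐ[F] Matrix (Fin n) (Fin n) K,
      SuppPres v Φ → ∀ X ∈ W, Φ X ∈ W)
    (hc : ∀ X ∈ U, ∀ Y ∈ W, ∀ Z, X * Y * Z = Z * (X * Y))
    (X₀ Y₀ : Matrix (Fin n) (Fin n) K) (hX₀ : X₀ ∈ U) (hY₀ : Y₀ ∈ W) (h0 : X₀ * Y₀ ≠ 0) :
    (∀ X ∈ U, ∀ Z, X * Z = Z * X) ∧ (∀ X ∈ W, ∀ Z, X * Z = Z * X) := by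
  have hmap : ∀ τ : K →ₐ[F] K, SuppPres v (τ.mapMatrix : Matrix (Fin n) (Fin n) K →ₐ[F] _) := by
    intro τ g X hX i j hij
    simp [hX i j hij]
  have hsc : ∀ X ∈ U, ∀ Y ∈ W, ∃ z : K, X * Y = Matrix.scalar (Fin n) z := by
    intro X hX Y hY
    have : X * Y ∈ Set.range (Matrix.scalar (Fin n)) := by
      rw [Matrix.mem_range_scalar_iff_commute_single']
      intro i j
      exact (hc X hX Y hY _).symm
    obtain ⟨z, hz⟩ := this
    exact ⟨z, hz.symm⟩
  -- step 1
  have s1 : ∀ X ∈ U, ∀ Y ∈ W, ∀ φ ψ : Module.Dual F K, ∃ c : F,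
      X.map φ * Y.map ψ = c • (1 : Matrix (Fin n) (Fin n) F) := by
    intro X hX Y hY φ ψ
    obtain ⟨χ, hχ⟩ := S.split φ ψ
    obtain ⟨z, hz⟩ := hsc _ (hU _ (hmap S.L) X hX) _ (hW _ (hmap S.R) Y hY)
    refine ⟨χ z, ?_⟩
    ext i j
    have := congrArg χ (congrFun (congrFun hz i) j)
    rw [Matrix.mul_apply, map_sum] at this
    simp only [AlgHom.mapMatrix_apply, Matrix.map_apply, hχ] at this
    rw [Matrix.mul_apply]
    simp only [Matrix.map_apply]
    rw [this]
    by_cases h : i = j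
    · subst h; simp
    · simp [h]
  obtain ⟨φ₀, ψ₀, hne⟩ : ∃ φ ψ : Module.Dual F K, X₀.map φ * Y₀.map ψ ≠ 0 := by
    by_contra hcon
    push Not at hcon
    exact h0 (map_mul_eq_zero X₀ Y₀ hcon)
  obtain ⟨c, hcc⟩ := s1 X₀ hX₀ Y₀ hY₀ φ₀ ψ₀
  have hc0 : c ≠ 0 := by rintro rfl; rw [zero_smul] at hcc; exact hne hcc
  set A := X₀.map φ₀ with hA
  set B := Y₀.map ψ₀ with hB
  have hAB : A * (c⁻¹ • B) = 1 := by
    rw [mul_smul_comm, hcc, smul_smul, inv_mul_cancel₀ hc0, one_smul]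
  have hBA : (c⁻¹ • B) * A = 1 := mul_eq_one_comm.mp hAB
  have s2 : ∀ X ∈ U, ∀ φ : Module.Dual F K, ∃ d : F, X.map φ = d • A := by
    intro X hX φ
    obtain ⟨d, hd⟩ := s1 X hX Y₀ hY₀ φ ψ₀
    refine ⟨c⁻¹ * d, ?_⟩
    calc X.map φ = X.map φ * ((c⁻¹ • B) * A) := by rw [hBA, mul_one]
      _ = c⁻¹ • (X.map φ * B * A) := by
        rw [smul_mul_assoc, mul_smul_comm, mul_assoc]
      _ = _ := by rw [hd, smul_mul_assoc, one_mul, smul_smul]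
  have hrow : ∀ i, ∃ k, A i k ≠ 0 := by
    intro i
    by_contra hcon
    push Not at hcon
    have := congrFun (congrFun hAB i) i
    rw [Matrix.mul_apply] at this
    simp [hcon] at this
  -- `A` is diagonal
  have hdiag : ∀ i j, i ≠ j → A i j = 0 := by
    intro i j hij
    by_contra hne
    obtain ⟨t, ht1, ht2⟩ := exists_good (F := F)
    let d : Fin n → Fˣ := fun k => if k = i then t else 1
    have hΦ : SuppPres v (diagHom K d) := by
      intro g X hX i j hij
      simp [diagHom, hX i j hij]
    obtain ⟨e, he⟩ := s2 _ (hU _ hΦ X₀ hX₀) φ₀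
    have he' : ∀ p q, ((d p : F) * ((d q)⁻¹ : Fˣ)) * A p q = e * A p q := by
      intro p q
      have := congrFun (congrFun he p) q
      simpa [diagHom, hA] using this
    have e1 : e = t := by
      have := he' i j
      have h' := mul_right_cancel₀ hne this
      simpa [d, hij.symm] using h'.symm
    obtain ⟨k, hk⟩ := hrow j
    have e2 := mul_right_cancel₀ hk (he' j k)
    rw [e1] at e2
    by_cases hki : k = i
    · subst hki
      have e3 : ((t⁻¹ : Fˣ) : F) = t := by
        have h1 : d j = 1 := if_neg hij.symm
        have h2 : d k = t := if_pos rfl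
        rwa [h1, h2, Units.val_one, one_mul] at e2
      apply ht2
      calc (t : F) * t = t * ((t⁻¹ : Fˣ) : F) := by rw [e3]
        _ = 1 := by simp
    · simp [d, hij.symm, hki] at e2
      exact ht1 e2.symm
  have hdne : ∀ i, A i i ≠ 0 := by
    intro i
    obtain ⟨k, hk⟩ := hrow i
    by_cases h : i = k
    · subst h; exact hk
    · exact absurd (hdiag i k h) hk
  let e : Fin n ≃ G := Equiv.ofBijective v hv
  have hev : ∀ i, e i = v i := fun i => rfl
  have hconst : ∀ i j, A i i = A j j := by
    have key := const_of_quasi hG (fun g => A (e.symm g) (e.symm g)) (fun g => hdne _) ?_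
    · intro i j
      have hi := key (e i)
      have hj := key (e j)
      simp only [Equiv.symm_apply_apply] at hi hj
      rw [hi, hj]
    · intro g
      let σ : Fin n ≃ Fin n := (e.trans (Equiv.mulLeft g)).trans e.symm
      have hvσ : ∀ i, v (σ i) = g * v i := by
        intro i
        rw [← hev, ← hev]
        simp [σ]
      have hΦ : SuppPres v
          ((Matrix.reindexAlgEquiv F K σ.symm).toAlgHom :
            Matrix (Fin n) (Fin n) K →ₐ[F] Matrix (Fin n) (Fin n) K) := by
        intro g' X hX i j hij
        have := hX (σ i) (σ j) (by rw [hvσ, hvσ]; simpa [mul_assoc] using hij)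
        simpa using this
      obtain ⟨d, hd⟩ := s2 _ (hU _ hΦ X₀ hX₀) φ₀
      refine ⟨d, fun x => ?_⟩
      have := congrFun (congrFun hd (e.symm x)) (e.symm x)
      simpa [hA, σ] using this
  -- all values are scalar
  have toScalar : ∀ X : Matrix (Fin n) (Fin n) K,
      (∀ φ : Module.Dual F K, ∃ d : F, X.map φ = d • (1 : Matrix (Fin n) (Fin n) F)) →
      ∃ w, X = Matrix.scalar (Fin n) w := by
    intro X hX
    have o1 : ∀ i j, i ≠ j → X i j = 0 := by
      intro i j hij
      apply dual_ext (F := F)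
      intro φ
      obtain ⟨d, hd⟩ := hX φ
      have := congrFun (congrFun hd i) j
      simpa [hij] using this
    have o2 : ∀ i j, X i i = X j j := by
      intro i j
      apply dual_ext (F := F)
      intro φ
      obtain ⟨d, hd⟩ := hX φ
      have h1 := congrFun (congrFun hd i) i
      have h2 := congrFun (congrFun hd j) j
      simp at h1 h2
      rw [h1, h2]
    rcases isEmpty_or_nonempty (Fin n) with hn | ⟨⟨i₀⟩⟩
    · exact ⟨0, Subsingleton.elim _ _⟩
    · refine ⟨X i₀ i₀, ?_⟩
      ext i j
      by_cases h : i = j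
      · subst h; simp [o2 i i₀]
      · simp [h, o1 i j h]
  have i₀ : Nonempty (Fin n) := by
    by_contra hn
    rw [not_nonempty_iff] at hn
    exact h0 (Subsingleton.elim _ _)
  obtain ⟨i₀⟩ := i₀
  have hAsc : A = (A i₀ i₀) • (1 : Matrix (Fin n) (Fin n) F) := by
    ext i j
    by_cases h : i = j
    · subst h; simp [hconst i i₀]
    · simp [h, hdiag i j h]
  have hUs : ∀ X ∈ U, ∃ w, X = Matrix.scalar (Fin n) w := by
    intro X hX
    refine toScalar X fun φ => ?_
    obtain ⟨d, hd⟩ := s2 X hX φ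
    exact ⟨d * A i₀ i₀, by rw [hd, mul_smul, ← hAsc]⟩
  have hWs : ∀ Y ∈ W, ∃ w, Y = Matrix.scalar (Fin n) w := by
    intro Y hY
    refine toScalar Y fun ψ => ?_
    obtain ⟨d, hd⟩ := s1 X₀ hX₀ Y hY φ₀ ψ
    refine ⟨(A i₀ i₀)⁻¹ * d, ?_⟩
    rw [← hA, hAsc, smul_mul_assoc, one_mul] at hd
    rw [mul_smul, ← hd, smul_smul, inv_mul_cancel₀ (hdne i₀), one_smul]
  have hτs : ∀ (τ : K →ₐ[F] K) (w : K),
      (τ.mapMatrix : Matrix (Fin n) (Fin n) K →ₐ[F] _) (Matrix.scalar (Fin n) w)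
        = Matrix.scalar (Fin n) (τ w) := by
    intro τ w
    ext i j
    by_cases h : i = j
    · subst h; simp
    · simp [h]
  obtain ⟨u₀, hu₀⟩ := hUs X₀ hX₀
  obtain ⟨w₀, hw₀⟩ := hWs Y₀ hY₀
  have fin := core_scalar hchar S {w | Matrix.scalar (Fin n) w ∈ U} {w | Matrix.scalar (Fin n) w ∈ W}
    (fun τ x hx => by
      have := hU _ (hmap τ) _ hx
      rwa [hτs] at this)
    (fun τ x hx => by
      have := hW _ (hmap τ) _ hx
      rwa [hτs] at this)
    (fun x hx y hy z => by
      have := hc _ hx _ hy (Matrix.scalar (Fin n) z)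
      rw [← map_mul, ← map_mul, ← map_mul] at this
      have := congrFun (congrFun this i₀) i₀
      simpa using this)
    u₀ w₀ (by rw [Set.mem_ofPred_eq, ← hu₀]; exact hX₀) (by rw [Set.mem_ofPred_eq, ← hw₀]; exact hY₀)
    (by rintro rfl; rw [hu₀] at h0; simp at h0)
    (by rintro rfl; rw [hw₀] at h0; simp at h0)
  have cent : ∀ w : K, S.sgn w = w → ∀ Z : Matrix (Fin n) (Fin n) K,
      Matrix.scalar (Fin n) w * Z = Z * Matrix.scalar (Fin n) w := by
    intro w hw Z
    ext i j
    simp [S.central w hw]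
  refine ⟨fun X hX => ?_, fun Y hY => ?_⟩
  · obtain ⟨w, rfl⟩ := hUs X hX
    exact cent w (fin.1 w hX)
  · obtain ⟨w, rfl⟩ := hWs Y hY
    exact cent w (fin.2 w hY)

end Core1

section Final

variable {F : Type*} [Field F]

theorem usesVars_congr {G A : Type*} [Group G] [Ring A] [Algebra F A] {S : Set (ℕ × G)}
    {f : FreeAlgebra F (ℕ × G)} (hf : UsesVars S f) (a b : ℕ × G → A)
    (h : ∀ p ∈ S, a p = b p) : FreeAlgebra.lift F a f = FreeAlgebra.lift F b f := by
  refine AlgHom.adjoin_le_equalizer (FreeAlgebra.lift F a) (FreeAlgebra.lift F b) ?_ hf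
  rintro _ ⟨p, hp, rfl⟩
  simp [h p hp]

theorem lift_comp_apply {G A : Type*} [Group G] [Ring A] [Algebra F A]
    (Φ : A →ₐ[F] A) (a : ℕ × G → A) (f : FreeAlgebra F (ℕ × G)) :
    Φ (FreeAlgebra.lift F a f) = FreeAlgebra.lift F (fun p => Φ (a p)) f := by
  have : Φ.comp (FreeAlgebra.lift F a) = FreeAlgebra.lift F (fun p => Φ (a p)) := by
    ext p; simp
  exact DFunLike.congr_fun this f

theorem primeness_of_supp [Infinite F] (hchar : (2 : F) ≠ 0) {K : Type*} [Ring K] [Algebra F K]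
    (D : SuperData F K) {G : Type*} [Group G] (hG : ∀ φ : G →* Fˣ, φ = 1) {n : ℕ}
    (v : Fin n → G) (hv : Function.Bijective v)
    (𝒜 : G → Submodule F (Matrix (Fin n) (Fin n) K))
    (h𝒜 : ∀ g X, X ∈ 𝒜 g ↔ ∀ i j, (v i)⁻¹ * v j ≠ g → X i j = 0) :
    HasGradedPrimeness 𝒜 := by
  classical
  intro S T f g hST hf hg hfg
  obtain ⟨hni, hcen⟩ := hfg
  simp only [IsGradedIdentity, not_forall] at hni
  obtain ⟨a₀, ha₀, hne⟩ := hni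
  rw [map_mul] at hne
  have hclos : ∀ (q : FreeAlgebra F (ℕ × G)) (Φ : Matrix (Fin n) (Fin n) K →ₐ[F] _),
      SuppPres v Φ → ∀ X ∈ {X | ∃ a, GradedSubst 𝒜 a ∧ FreeAlgebra.lift F a q = X},
      Φ X ∈ {X | ∃ a, GradedSubst 𝒜 a ∧ FreeAlgebra.lift F a q = X} := by
    rintro q Φ hΦ _ ⟨a, ha, rfl⟩
    refine ⟨fun p => Φ (a p), fun p => ?_, (lift_comp_apply Φ a q).symm⟩
    rw [h𝒜]
    exact hΦ p.2 (a p) ((h𝒜 _ _).mp (ha p))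
  have main := core_matrix hchar D hG v hv
    {X | ∃ a, GradedSubst 𝒜 a ∧ FreeAlgebra.lift F a f = X}
    {X | ∃ a, GradedSubst 𝒜 a ∧ FreeAlgebra.lift F a g = X}
    (hclos f) (hclos g)
    (by
      rintro _ ⟨a, ha, rfl⟩ _ ⟨b, hb, rfl⟩ Z
      let w : ℕ × G → Matrix (Fin n) (Fin n) K := fun p => if p ∈ S then a p else b p
      have hw : GradedSubst 𝒜 w := by
        intro p
        by_cases h : p ∈ S
        · simpa [w, h] using ha p
        · simpa [w, h] using hb p
      have e1 : FreeAlgebra.lift F a f = FreeAlgebra.lift F w f :=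
        usesVars_congr hf _ _ fun p hp => by simp [w, hp]
      have e2 : FreeAlgebra.lift F b g = FreeAlgebra.lift F w g :=
        usesVars_congr hg _ _ fun p hp => by
          simp [w, Set.disjoint_right.mp hST hp]
      have := hcen w hw
      rw [map_mul, ← e1, ← e2, Semigroup.mem_center_iff] at this
      exact (this Z).symm)
    _ _ ⟨a₀, ha₀, rfl⟩ ⟨a₀, ha₀, rfl⟩ hne
  refine ⟨⟨fun h => ?_, fun a ha => ?_⟩, ⟨fun h => ?_, fun a ha => ?_⟩⟩
  · rw [h a₀ ha₀, zero_mul] at hne; exact hne rfl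
  · rw [Semigroup.mem_center_iff]
    exact fun Z => (main.1 _ ⟨a, ha, rfl⟩ Z).symm
  · rw [h a₀ ha₀, mul_zero] at hne; exact hne rfl
  · rw [Semigroup.mem_center_iff]
    exact fun Z => (main.2 _ ⟨a, ha, rfl⟩ Z).symm

theorem supp_of_grading {K : Type*} [Ring K] [Algebra F K] {G : Type*} [Group G] [DecidableEq G]
    [Finite G] {n : ℕ} (𝒜 : G → Submodule F (Matrix (Fin n) (Fin n) K))
    (hA : IsAlgGrading 𝒜) (hE : ∀ e : K, Matrix.scalar (Fin n) e ∈ 𝒜 1) (v : Fin n → G)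
    (hcross : ∀ g : G,
      Submodule.comap (matScalarEmb F K n).toLinearMap (𝒜 g) = elemComp F v g)
    (g : G) (X : Matrix (Fin n) (Fin n) K) :
    X ∈ 𝒜 g ↔ ∀ i j, (v i)⁻¹ * v j ≠ g → X i j = 0 := by
  classical
  have hsing : ∀ (i j : Fin n) (x : K), Matrix.single i j x ∈ 𝒜 ((v i)⁻¹ * v j) := by
    intro i j x
    have h1 : Matrix.single i j (1 : F) ∈ elemComp F v ((v i)⁻¹ * v j) := by
      intro p q hpq
      by_cases h : i = p ∧ j = q
      · obtain ⟨rfl, rfl⟩ := h; exact absurd rfl hpq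
      · simp [Matrix.single_apply, h]
    rw [← hcross] at h1
    have h2 := hA.mul_mem (hE x) h1
    rw [one_mul] at h2
    convert h2 using 1
    ext p q
    by_cases h : i = p ∧ j = q
    · obtain ⟨rfl, rfl⟩ := h
      simp [matScalarEmb]
    · simp [matScalarEmb, Matrix.single_apply, h]
  have hsub : ∀ (g : G) (X : Matrix (Fin n) (Fin n) K),
      (∀ i j, (v i)⁻¹ * v j ≠ g → X i j = 0) → X ∈ 𝒜 g := by
    intro g X hX
    rw [Matrix.matrix_eq_sum_single X]
    refine Submodule.sum_mem _ fun i _ => Submodule.sum_mem _ fun j _ => ?_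
    by_cases h : (v i)⁻¹ * v j = g
    · rw [← h]; exact hsing i j _
    · rw [hX i j h]; simp
  refine ⟨fun hX => ?_, hsub g X⟩
  have := Fintype.ofFinite G
  let P : G → Matrix (Fin n) (Fin n) K := fun h =>
    Matrix.of fun i j => if (v i)⁻¹ * v j = h then X i j else 0
  have hP : ∀ h, P h ∈ 𝒜 h := fun h => hsub h _ fun i j hij => by simp [P, hij]
  have hsum : ∑ h, P h = X := by
    ext i j
    rw [Matrix.sum_apply]
    simp [P]
  have hXg : X = P g := by
    have hinj := hA.internal.injective
    let D1 : DirectSum G fun h => 𝒜 h := DirectSum.of (fun h => 𝒜 h) g ⟨X, hX⟩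
    let D2 : DirectSum G fun h => 𝒜 h := ∑ h, DirectSum.of (fun h => 𝒜 h) h ⟨P h, hP h⟩
    have hD : D1 = D2 := by
      apply hinj
      simp only [D1, D2, map_sum, DirectSum.coeAddMonoidHom_of, hsum]
    have h2 := congrArg (fun d : DirectSum G fun h => 𝒜 h =>
      (d g : Matrix (Fin n) (Fin n) K)) hD
    simp only [D1, D2, DirectSum.of_eq_same] at h2
    rw [h2, DFinsupp.finsetSum_apply]
    rw [Finset.sum_eq_single g]
    · rw [DirectSum.of_eq_same]
    · intro b _ hb
      rw [DirectSum.of_eq_of_ne _ _ _ hb.symm]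
    · simp
  intro i j hij
  rw [hXg]
  simp [P, hij]

end Final

/-- Let `F` be an infinite field of characteristic `≠ 2`, `G` a group
with no non-trivial homomorphism `G → Fˣ`, and `E` the Grassmann algebra.  If `Mₙ(E)`
carries a `G`-grading such that the scalar matrices `E` lie in the neutral component and
`Mₙ(F)` is a homogeneous subalgebra whose inherited grading is a crossed product grading
(induced by an `n`-tuple of pairwise distinct elements of `G`, with `|G| = n`), then
`Mₙ(E)` satisfies the primeness property for graded central polynomials. -/
theorem matrix_grassmann_graded_primeness
    (F : Type*) [Field F] [Infinite F] (hchar : (2 : F) ≠ 0)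
    {G : Type*} [Group G] [DecidableEq G]
    (hG : ∀ φ : G →* Fˣ, φ = 1)
    (n : ℕ)
    (𝒜 : G → Submodule F (Matrix (Fin n) (Fin n) (Grassmann F)))
    (hA : IsAlgGrading 𝒜)
    (hE : ∀ e : Grassmann F, Matrix.scalar (Fin n) e ∈ 𝒜 1)
    (v : Fin n → G) (hv : Function.Injective v) (hcard : Nat.card G = n)
    (hcross : ∀ g : G,
      Submodule.comap (matScalarEmb F (Grassmann F) n).toLinearMap (𝒜 g)
        = elemComp F v g) :
    HasGradedPrimeness 𝒜 := by
  rcases Nat.eq_zero_or_pos n with hn | hn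
  · subst hn
    intro S T f g _ _ _ hfg
    exact absurd (fun a _ => Subsingleton.elim _ _) hfg.1
  have hfin : Finite G := Nat.finite_of_card_ne_zero (by omega)
  have hbij : Function.Bijective v := by
    have := Fintype.ofFinite G
    rw [Fintype.bijective_iff_injective_and_card]
    exact ⟨hv, by rw [Fintype.card_fin, ← Nat.card_eq_fintype_card, hcard]⟩
  obtain ⟨D⟩ := superData_exists F
  exact primeness_of_supp hchar D hG v hbij 𝒜 (supp_of_grading 𝒜 hA hE v hcross)
end

section
/- Let F be an infinite field of characteristic different from 2. The algebra M_{a,b}(E) satisfies the primeness property for ordinary central polynomials: if f(x_1,…,x_r) and g(x_{r+1},…,x_s) are polynomials in disjoint sets of variables such that f·g is a central polynomial for M_{a,b}(E), then both f and g are central polynomials for M_{a,b}(E). -/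
section OrdinaryOn

variable (F : Type*) [Field F] {A : Type*} [Ring A] [Algebra F A]

/-- `f` is an ordinary polynomial identity for the subalgebra of `A` whose underlying
set is `S`. -/
def IsIdentityOn (S : Set A) (f : FreeAlgebra F ℕ) : Prop :=
  ∀ a : ℕ → A, (∀ k, a k ∈ S) → FreeAlgebra.lift F a f = 0

/-- `f` is an ordinary central polynomial for the subalgebra of `A` whose underlying
set is `S` (its values commute with every element of `S`). -/
def IsCentralOn (S : Set A) (f : FreeAlgebra F ℕ) : Prop :=
  ¬ IsIdentityOn F S f ∧
    ∀ a : ℕ → A, (∀ k, a k ∈ S) →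
      ∀ x ∈ S, FreeAlgebra.lift F a f * x = x * FreeAlgebra.lift F a f

end OrdinaryOn

namespace MabP

section Gr
variable (F : Type*) [Field F]

/-- A splitting of the countable space as a sum of two copies of itself. -/
noncomputable def split : (ℕ →₀ F) ≃ₗ[F] (ℕ →₀ F) × (ℕ →₀ F) :=
  (Finsupp.domLCongr Equiv.natSumNatEquivNat.symm).trans (Finsupp.sumFinsuppLEquivProdFinsupp F)

/-- First embedding of the Grassmann algebra into itself. -/
noncomputable def i1 : Grassmann F →ₐ[F] Grassmann F :=
  ExteriorAlgebra.map ((split F).symm.toLinearMap ∘ₗ LinearMap.inl F _ _)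

/-- Second embedding of the Grassmann algebra into itself. -/
noncomputable def i2 : Grassmann F →ₐ[F] Grassmann F :=
  ExteriorAlgebra.map ((split F).symm.toLinearMap ∘ₗ LinearMap.inr F _ _)

/-- The parity automorphism. -/
noncomputable def inv : Grassmann F →ₐ[F] Grassmann F :=
  CliffordAlgebra.involute

variable {F}

theorem inv_ι (v : ℕ →₀ F) : inv F (ExteriorAlgebra.ι F v) = -ExteriorAlgebra.ι F v :=
  CliffordAlgebra.involute_ι v

theorem inv_i1 (x : Grassmann F) : inv F (i1 F x) = i1 F (inv F x) := by
  have : (inv F).comp (i1 F) = (i1 F).comp (inv F) := by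
    apply ExteriorAlgebra.hom_ext
    ext v
    simp [i1, inv_ι]
  exact DFunLike.congr_fun this x

theorem inv_i2 (x : Grassmann F) : inv F (i2 F x) = i2 F (inv F x) := by
  have : (inv F).comp (i2 F) = (i2 F).comp (inv F) := by
    apply ExteriorAlgebra.hom_ext
    ext v
    simp [i2, inv_ι]
  exact DFunLike.congr_fun this x

theorem ι_mul (v : ℕ →₀ F) (x : Grassmann F) :
    ExteriorAlgebra.ι F v * x = inv F x * ExteriorAlgebra.ι F v := by
  induction x using ExteriorAlgebra.induction with
  | algebraMap r => simp [Algebra.commutes]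
  | ι w =>
    rw [inv_ι, neg_mul, eq_neg_iff_add_eq_zero]
    exact ExteriorAlgebra.ι_add_mul_swap v w
  | mul a b ha hb => rw [map_mul, ← mul_assoc, ha, mul_assoc, hb, mul_assoc]
  | add a b ha hb => rw [map_add, mul_add, add_mul, ha, hb]

theorem even_central (c : Grassmann F) (hc : inv F c = c) (x : Grassmann F) : c * x = x * c := by
  induction x using ExteriorAlgebra.induction with
  | algebraMap r => simp [Algebra.commutes]
  | ι w => rw [ι_mul, hc]
  | mul a b ha hb => rw [← mul_assoc, ha, mul_assoc, hb, mul_assoc]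
  | add a b ha hb => rw [mul_add, add_mul, ha, hb]

open scoped TensorProduct in
theorem exists_prod_functional (φ ψ : Grassmann F →ₗ[F] F) :
    ∃ θ : Grassmann F →ₗ[F] F, ∀ x y, θ (i1 F x * i2 F y) = φ x * ψ y := by
  let Q : QuadraticForm F (ℕ →₀ F) := 0
  let I : Q →qᵢ (Q.prod Q) := { (split F).toLinearMap with map_app' := fun m => by simp [Q] }
  let P : Grassmann F →ₐ[F] (CliffordAlgebra.evenOdd Q ᵍ⊗[F] CliffordAlgebra.evenOdd Q) :=
    (CliffordAlgebra.ofProd Q Q).comp (CliffordAlgebra.map I)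
  have hP : ∀ v, P (ExteriorAlgebra.ι F v) =
      CliffordAlgebra.ι Q (split F v).1 ᵍ⊗ₜ[F] 1 + 1 ᵍ⊗ₜ[F] CliffordAlgebra.ι Q (split F v).2 :=
    fun v => (congrArg (CliffordAlgebra.ofProd Q Q) (CliffordAlgebra.map_apply_ι I v)).trans
      (CliffordAlgebra.ofProd_ι_mk Q Q _ _)
  have h1 : P.comp (i1 F) = GradedTensorProduct.includeLeft _ _ := by
    apply ExteriorAlgebra.hom_ext
    apply LinearMap.ext
    intro v
    have := hP ((split F).symm (v, 0))
    rw [LinearEquiv.apply_symm_apply] at this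
    simp only [map_zero, GradedTensorProduct.tmul, TensorProduct.tmul_zero, add_zero] at this
    simp only [i1, AlgHom.comp_toLinearMap, LinearMap.comp_apply, AlgHom.toLinearMap_apply,
      ExteriorAlgebra.map_apply_ι]
    refine (Eq.trans ?_ this)
    rfl
  have h2 : P.comp (i2 F) = GradedTensorProduct.includeRight _ _ := by
    apply ExteriorAlgebra.hom_ext
    apply LinearMap.ext
    intro v
    have := hP ((split F).symm (0, v))
    rw [LinearEquiv.apply_symm_apply] at this
    simp only [map_zero, GradedTensorProduct.tmul, TensorProduct.zero_tmul, zero_add] at this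
    simp only [i2, AlgHom.comp_toLinearMap, LinearMap.comp_apply, AlgHom.toLinearMap_apply,
      ExteriorAlgebra.map_apply_ι]
    refine (Eq.trans ?_ this)
    rfl
  refine ⟨(LinearMap.mul' F F ∘ₗ TensorProduct.map φ ψ) ∘ₗ
    (GradedTensorProduct.of F _ _).symm.toLinearMap ∘ₗ P.toLinearMap, fun x y => ?_⟩
  have e1 : P (i1 F x) = x ᵍ⊗ₜ[F] 1 := DFunLike.congr_fun h1 x
  have e2 : P (i2 F y) = 1 ᵍ⊗ₜ[F] y := DFunLike.congr_fun h2 y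
  simp only [LinearMap.comp_apply, AlgHom.toLinearMap_apply, map_mul, e1, e2,
    GradedTensorProduct.tmul_one_mul_one_tmul]
  simp [GradedTensorProduct.tmul]

theorem exists_φ0 : ∃ φ : Grassmann F →ₗ[F] F, φ 1 = 0 ∧
    φ (ExteriorAlgebra.ι F (Finsupp.single 0 1)) = 1 := by
  refine ⟨Finsupp.lapply 0 ∘ₗ ExteriorAlgebra.ιInv, ?_, ?_⟩
  · have h := DFunLike.congr_fun
      (ExteriorAlgebra.ιInv_comp_map (0 : (ℕ →₀ F) →ₗ[F] (ℕ →₀ F))) (1 : Grassmann F)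
    simp only [LinearMap.comp_apply, AlgHom.toLinearMap_apply, map_one] at h
    rw [LinearMap.zero_apply] at h
    rw [LinearMap.comp_apply, h, map_zero]
  · simp [ExteriorAlgebra.ι_leftInverse _]

theorem eq_zero_of_functional (x : Grassmann F) (h : ∀ φ : Grassmann F →ₗ[F] F, φ x = 0) :
    x = 0 :=
  (Module.forall_dual_apply_eq_zero_iff F x).1 h

theorem sum_mul_eq_zero {n : Type*} [Fintype n] (x y : n → Grassmann F)
    (h : ∀ φ ψ : Grassmann F →ₗ[F] F, ∑ j, φ (x j) * ψ (y j) = 0) : ∑ j, x j * y j = 0 := by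
  let b := Module.Basis.ofVectorSpace F (Grassmann F)
  have ht : ∑ j, TensorProduct.tmul F (x j) (y j) = 0 := by
    apply (b.tensorProduct b).ext_elem
    rintro ⟨s, t⟩
    have := h (b.coord s) (b.coord t)
    simp only [Module.Basis.coord_apply] at this
    simp [map_sum, Finsupp.finsetSum_apply, ← this, mul_comm]
  simpa using congrArg (LinearMap.mul' F (Grassmann F)) ht

variable (F) in
theorem mem_GrassComp_zero (h2 : (2 : F) ≠ 0) (x : Grassmann F) :
    (x ∈ GrassComp F 0 ↔ inv F x = x) ∧ (x ∈ GrassComp F 1 ↔ inv F x = -x) := by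
  have e0 : ∀ y ∈ GrassComp F 0, inv F y = y := fun y hy =>
    CliffordAlgebra.involute_eq_of_mem_even hy
  have e1 : ∀ y ∈ GrassComp F 1, inv F y = -y := fun y hy =>
    CliffordAlgebra.involute_eq_of_mem_odd hy
  have hx : x ∈ GrassComp F 0 ⊔ GrassComp F 1 := by
    have := (CliffordAlgebra.evenOdd_isCompl (0 : QuadraticForm F (ℕ →₀ F))).sup_eq_top
    change x ∈ CliffordAlgebra.evenOdd _ 0 ⊔ CliffordAlgebra.evenOdd _ 1
    rw [this]; trivial
  obtain ⟨y, hy, z, hz, rfl⟩ := Submodule.mem_sup.1 hx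
  have t : ∀ w : Grassmann F, w + w = 0 → w = 0 := fun w hw => by
    have : (2 : F) • w = 0 := by rw [two_smul, hw]
    exact (smul_eq_zero.1 this).resolve_left h2
  refine ⟨⟨e0 _, fun h => ?_⟩, ⟨e1 _, fun h => ?_⟩⟩
  · rw [map_add, e0 y hy, e1 z hz] at h
    have : z = 0 := t z (by
      rw [← sub_eq_zero] at h
      rw [← neg_eq_zero, ← h]; abel)
    simpa [this] using hy
  · rw [map_add, e0 y hy, e1 z hz] at h
    have : y = 0 := t y (by
      rw [← sub_eq_zero] at h
      rw [← h]; abel)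
    simpa [this] using hz

end Gr

section Alg
variable {F : Type*} [Field F] {n : Type*} [Fintype n] [DecidableEq n]

theorem alg_core (h2 : (2 : F) ≠ 0) (D : Matrix n n F) (hD : D * D = 1)
    (hDs : ∀ i j, D * Matrix.single i j 1 * D = Matrix.single i j 1 ∨
      D * Matrix.single i j 1 * D = - Matrix.single i j 1)
    (U W : Set (Matrix n n F))
    (hUW : ∀ u ∈ U, ∀ w ∈ W, ∃ c : F, u * w = c • (1 : Matrix n n F))
    (hp : ∀ u ∈ U, u + D * u * D ∈ U) (hm : ∀ u ∈ U, u - D * u * D ∈ U)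
    (hE : ∀ u ∈ U, ∀ Y, D * Y * D = Y → u * Y - Y * u ∈ U)
    (hO : ∀ u ∈ U, ∀ Y, D * Y * D = -Y → u * Y - Y * (D * u * D) ∈ U)
    (hne : ∃ u ∈ U, ∃ w ∈ W, u * w ≠ 0) :
    (∀ u ∈ U, ∃ c : F, u = c • (1 : Matrix n n F)) ∧
      (∀ w ∈ W, ∃ c : F, w = c • (1 : Matrix n n F)) := by
  have t : ∀ w : Matrix n n F, w + w = 0 → w = 0 := fun w hw => by
    have : (2 : F) • w = 0 := by rw [two_smul, hw]
    exact (smul_eq_zero.1 this).resolve_left h2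
  have hDDD : ∀ u : Matrix n n F, D * (D * u * D) * D = u := fun u => by
    calc D * (D * u * D) * D = (D * D) * u * (D * D) := by noncomm_ring
      _ = u := by simp [hD]
  -- a homogeneous element
  have hhom : ∃ u ∈ U, ∃ w ∈ W, u * w ≠ 0 ∧ (D * u * D = u ∨ D * u * D = -u) := by
    obtain ⟨u, hu, w, hw, huw⟩ := hne
    by_cases h : (u + D * u * D) * w = 0
    · refine ⟨_, hm u hu, w, hw, fun h' => huw ?_, Or.inr ?_⟩
      · apply t
        calc u * w + u * w = (u + D * u * D) * w + (u - D * u * D) * w := by noncomm_ring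
          _ = 0 := by rw [h, h', add_zero]
      · rw [mul_sub, sub_mul, hDDD]; abel
    · refine ⟨_, hp u hu, w, hw, h, Or.inl ?_⟩
      rw [mul_add, add_mul, hDDD]; abel
  obtain ⟨u, hu, w, hw, huw, hpar⟩ := hhom
  obtain ⟨l, hl⟩ := hUW u hu w hw
  have hl0 : l ≠ 0 := by rintro rfl; simp [hl] at huw
  have hwu : w * u = l • (1 : Matrix n n F) := by
    have h1 : u * (l⁻¹ • w) = 1 := by
      rw [mul_smul_comm, hl, smul_smul, inv_mul_cancel₀ hl0, one_smul]
    have h3 := mul_eq_one_comm.1 h1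
    rw [smul_mul_assoc] at h3
    rw [← h3, smul_smul, mul_inv_cancel₀ hl0, one_smul]
  have key : ∀ Y, u * Y - Y * u ∈ U → ∃ c : F, u * Y - Y * u = c • u := by
    intro Y hY
    obtain ⟨c, hc⟩ := hUW _ hY w hw
    refine ⟨l⁻¹ * c, ?_⟩
    have h3 : (u * Y - Y * u) * w * u = c • u := by rw [hc, smul_mul_assoc, one_mul]
    rw [mul_assoc, hwu, mul_smul_comm, mul_one] at h3
    rw [← smul_smul, ← h3, smul_smul, inv_mul_cancel₀ hl0, one_smul]
  have hu0 : u ≠ 0 := by rintro rfl; simp at huw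
  -- the element is even
  have hev : D * u * D = u := by
    rcases hpar with h | h
    · exact h
    exfalso
    have hDu : D * u = - (u * D) := by
      calc D * u = (D * u * D) * D := by rw [mul_assoc, hD, mul_one]
        _ = _ := by rw [h, neg_mul]
    obtain ⟨c, hc⟩ := key D (hE u hu D (by rw [hD, one_mul]))
    rw [hDu, sub_neg_eq_add] at hc
    -- 2 u D = c u
    have h4 : w * (u * D + u * D) = w * (c • u) := by rw [hc]
    rw [mul_add, ← mul_assoc, hwu, mul_smul_comm, hwu, smul_mul_assoc, one_mul, smul_smul,
      ← smul_add, mul_comm c l, ← smul_smul] at h4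
    have h5 : D + D = c • (1 : Matrix n n F) := smul_right_injective _ hl0 h4
    have h6 : u * (D + D) = (D + D) * u := by rw [h5]; simp
    rw [mul_add, add_mul, hDu] at h6
    have h7 : (u * D + u * D) + (u * D + u * D) = 0 := by
      nth_rewrite 1 [h6]; abel
    have h8 := t _ (t _ h7)
    apply hu0
    calc u = u * D * D := by rw [mul_assoc, hD, mul_one]
      _ = 0 := by rw [h8, zero_mul]
  -- the element is scalar
  have hsc : ∃ c : F, u = c • (1 : Matrix n n F) := by
    have hcom : u ∈ Set.range (Matrix.scalar n) := by
      apply Matrix.mem_range_scalar_of_commute_single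
      intro i j hij
      have hmem : u * Matrix.single i j 1 - Matrix.single i j 1 * u ∈ U := by
        rcases hDs i j with h | h
        · exact hE u hu _ h
        · have := hO u hu _ h
          rwa [hev] at this
      obtain ⟨c, hc⟩ := key _ hmem
      set Y : Matrix n n F := Matrix.single i j 1 with hY
      have hYY : Y * Y = 0 := by simp [hY, hij.symm]
      have hc' : u * Y = Y * u + c • u := by rw [← hc]; abel
      have h3 : u * (Y * Y) = (Y * Y) * u + (2 * c) • (Y * u) + (c * c) • u := by
        rw [← mul_assoc, hc', add_mul, mul_assoc, hc', smul_mul_assoc, hc', mul_add, smul_add,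
          mul_smul_comm, smul_smul, two_mul, add_smul, mul_assoc]
        abel
      rw [hYY, mul_zero, zero_mul, zero_add] at h3
      have h4 : (2 * c) • Y + (c * c) • (1 : Matrix n n F) = 0 := by
        have h5 : ((2 * c) • (Y * u) + (c * c) • u) * w = 0 := by rw [← h3, zero_mul]
        rw [add_mul, smul_mul_assoc, smul_mul_assoc, mul_assoc, hl, mul_smul_comm, mul_one,
          smul_comm _ l, smul_comm _ l, ← smul_add] at h5
        exact (smul_eq_zero.1 h5).resolve_left hl0
      have h6 := congrFun (congrFun h4 i) i
      simp [hY, hij.symm] at h6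
      rw [h6, zero_smul, sub_eq_zero] at hc
      exact hc.symm
    obtain ⟨c, hc⟩ := hcom
    exact ⟨c, by rw [← hc, Matrix.scalar_apply, Matrix.smul_one_eq_diagonal]⟩
  obtain ⟨c, hc⟩ := hsc
  have hc0 : c ≠ 0 := by rintro rfl; simp [hc] at hu0
  have hw' : w = (c⁻¹ * l) • (1 : Matrix n n F) := by
    rw [hc, smul_mul_assoc, one_mul] at hl
    rw [← smul_smul, ← hl, smul_smul, inv_mul_cancel₀ hc0, one_smul]
  have hd0 : c⁻¹ * l ≠ 0 := mul_ne_zero (inv_ne_zero hc0) hl0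
  constructor
  · intro u' hu'
    obtain ⟨d, hd⟩ := hUW u' hu' w hw
    rw [hw', mul_smul_comm, mul_one] at hd
    exact ⟨(c⁻¹ * l)⁻¹ * d, by rw [← smul_smul, ← hd, smul_smul, inv_mul_cancel₀ hd0, one_smul]⟩
  · intro w' hw'
    obtain ⟨d, hd⟩ := hUW u hu w' hw'
    rw [hc, smul_mul_assoc, one_mul] at hd
    exact ⟨c⁻¹ * d, by rw [← smul_smul, ← hd, smul_smul, inv_mul_cancel₀ hc0, one_smul]⟩

end Alg

section Main
variable (F : Type*) [Field F] (a b : ℕ)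

/-- The sign of an index. -/
def sg (i : Fin (a + b)) : F := if (i : ℕ) < a then 1 else -1

variable {a b}

theorem sg_mul_self (i : Fin (a + b)) : sg F a b i * sg F a b i = 1 := by
  unfold sg; split_ifs <;> simp

theorem sg_cases (i j : Fin (a + b)) :
    sg F a b i * sg F a b j = 1 ∨ sg F a b i * sg F a b j = -1 := by
  unfold sg; split_ifs <;> simp

variable {F}


theorem mem_Mab_iff (h2 : (2 : F) ≠ 0) (M : (Matrix (Fin (a + b)) (Fin (a + b)) (Grassmann F))) :
    M ∈ MabSet F a b ↔ ∀ i j, inv F (M i j) = (sg F a b i * sg F a b j) • M i j := by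
  refine forall_congr' fun i => forall_congr' fun j => ?_
  unfold blk sg
  by_cases hi : (i : ℕ) < a <;> by_cases hj : (j : ℕ) < a <;>
    simp [hi, hj, (mem_GrassComp_zero F h2 (M i j)).1, (mem_GrassComp_zero F h2 (M i j)).2]

theorem Mab_mul (h2 : (2 : F) ≠ 0) {M N : (Matrix (Fin (a + b)) (Fin (a + b)) (Grassmann F))} (hM : M ∈ MabSet F a b)
    (hN : N ∈ MabSet F a b) : M * N ∈ MabSet F a b := by
  rw [mem_Mab_iff h2] at *
  intro i j
  simp only [Matrix.mul_apply, map_sum, map_mul, hM, hN, Finset.smul_sum]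
  refine Finset.sum_congr rfl fun k _ => ?_
  rw [smul_mul_smul_comm]
  congr 1
  linear_combination (sg F a b i * sg F a b j) * sg_mul_self F k

theorem Mab_add {M N : (Matrix (Fin (a + b)) (Fin (a + b)) (Grassmann F))} (hM : M ∈ MabSet F a b)
    (hN : N ∈ MabSet F a b) : M + N ∈ MabSet F a b :=
  fun i j => Submodule.add_mem _ (hM i j) (hN i j)

theorem Mab_sub {M N : (Matrix (Fin (a + b)) (Fin (a + b)) (Grassmann F))} (hM : M ∈ MabSet F a b)
    (hN : N ∈ MabSet F a b) : M - N ∈ MabSet F a b :=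
  fun i j => Submodule.sub_mem _ (hM i j) (hN i j)

theorem Mab_algebraMap (h2 : (2 : F) ≠ 0) (r : F) : algebraMap F (Matrix (Fin (a + b)) (Fin (a + b)) (Grassmann F)) r ∈ MabSet F a b := by
  rw [mem_Mab_iff h2]
  intro i j
  by_cases h : i = j
  · subst h; simp [Matrix.algebraMap_matrix_apply, sg_mul_self]
  · simp [Matrix.algebraMap_matrix_apply, h]

theorem Mab_one (h2 : (2 : F) ≠ 0) : (1 : (Matrix (Fin (a + b)) (Fin (a + b)) (Grassmann F))) ∈ MabSet F a b := by
  simpa using Mab_algebraMap (a := a) (b := b) h2 (1 : F)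

theorem Mab_single (h2 : (2 : F) ≠ 0) (i j : Fin (a + b)) (x : Grassmann F)
    (hx : inv F x = (sg F a b i * sg F a b j) • x) : Matrix.single i j x ∈ MabSet F a b := by
  rw [mem_Mab_iff h2]
  intro k l
  by_cases h : i = k ∧ j = l
  · obtain ⟨rfl, rfl⟩ := h; simp [hx]
  · rw [Matrix.single_apply_of_ne _ _ _ _ _ h]; simp

theorem lift_mem (h2 : (2 : F) ≠ 0) (α : ℕ → (Matrix (Fin (a + b)) (Fin (a + b)) (Grassmann F))) (hα : ∀ k, α k ∈ MabSet F a b)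
    (f : FreeAlgebra F ℕ) : FreeAlgebra.lift F α f ∈ MabSet F a b := by
  induction f using FreeAlgebra.induction with
  | grade0 r => rw [AlgHom.commutes]; exact Mab_algebraMap h2 r
  | grade1 x => rw [FreeAlgebra.lift_ι_apply]; exact hα x
  | mul p q hp hq => rw [map_mul]; exact Mab_mul h2 hp hq
  | add p q hp hq => rw [map_add]; exact Mab_add hp hq

theorem lift_map (τ : Grassmann F →ₐ[F] Grassmann F) (α : ℕ → (Matrix (Fin (a + b)) (Fin (a + b)) (Grassmann F))) (f : FreeAlgebra F ℕ) :
    FreeAlgebra.lift F (fun k => (α k).map τ) f = (FreeAlgebra.lift F α f).map τ := by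
  have : FreeAlgebra.lift F (fun k => (α k).map τ) =
      (τ.mapMatrix (m := Fin (a + b))).comp (FreeAlgebra.lift F α) := by
    apply FreeAlgebra.hom_ext
    funext k
    simp
  exact DFunLike.congr_fun this f

theorem Mab_map (h2 : (2 : F) ≠ 0) (τ : Grassmann F →ₐ[F] Grassmann F)
    (hτ : ∀ x, inv F (τ x) = τ (inv F x)) {M : (Matrix (Fin (a + b)) (Fin (a + b)) (Grassmann F))} (hM : M ∈ MabSet F a b) :
    M.map τ ∈ MabSet F a b := by
  rw [mem_Mab_iff h2] at *
  intro i j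
  simp [hτ, hM]

theorem lift_congr {A : Type*} [Ring A] [Algebra F A] (S : Set ℕ) (α β : ℕ → A)
    (h : ∀ k ∈ S, α k = β k) (f : FreeAlgebra F ℕ)
    (hf : f ∈ Algebra.adjoin F (FreeAlgebra.ι F '' S)) :
    FreeAlgebra.lift F α f = FreeAlgebra.lift F β f := by
  induction hf using Algebra.adjoin_induction with
  | mem x hx => obtain ⟨k, hk, rfl⟩ := hx; simp [h k hk]
  | algebraMap r => simp
  | add x y _ _ hx hy => simp [hx, hy]
  | mul x y _ _ hx hy => simp [hx, hy]

theorem lift_conj {A : Type*} [Ring A] [Algebra F A] (N : A) (hN : N * N = 0) (α : ℕ → A)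
    (f : FreeAlgebra F ℕ) :
    FreeAlgebra.lift F (fun k => (1 - N) * α k * (1 + N)) f =
      (1 - N) * FreeAlgebra.lift F α f * (1 + N) := by
  have h1 : (1 - N) * (1 + N) = 1 := by
    calc (1 - N) * (1 + N) = 1 - N * N := by noncomm_ring
      _ = 1 := by rw [hN, sub_zero]
  have h2 : (1 + N) * (1 - N) = 1 := by
    calc (1 + N) * (1 - N) = 1 - N * N := by noncomm_ring
      _ = 1 := by rw [hN, sub_zero]
  induction f using FreeAlgebra.induction with
  | grade0 r => rw [AlgHom.commutes, AlgHom.commutes, ← Algebra.commutes, mul_assoc, h1, mul_one]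
  | grade1 x => simp
  | mul p q hp hq =>
    rw [map_mul, map_mul, hp, hq]
    calc _ = (1 - N) * FreeAlgebra.lift F α p * ((1 + N) * (1 - N)) *
          FreeAlgebra.lift F α q * (1 + N) := by simp only [mul_assoc]
      _ = _ := by rw [h2]; simp only [mul_assoc, mul_one]
  | add p q hp hq => rw [map_add, map_add, hp, hq]; noncomm_ring

variable (a b) in
/-- Coefficient matrices of the values of `f`. -/
def vals (f : FreeAlgebra F ℕ) : Set (Matrix (Fin (a + b)) (Fin (a + b)) F) :=
  {u | ∃ α : ℕ → (Matrix (Fin (a + b)) (Fin (a + b)) (Grassmann F)), (∀ k, α k ∈ MabSet F a b) ∧ ∃ φ : Grassmann F →ₗ[F] F,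
    u = (FreeAlgebra.lift F α f).map φ}

theorem vals_conj (h2 : (2 : F) ≠ 0) (f : FreeAlgebra F ℕ) (α : ℕ → (Matrix (Fin (a + b)) (Fin (a + b)) (Grassmann F)))
    (hα : ∀ k, α k ∈ MabSet F a b) (φ : Grassmann F →ₗ[F] F)
    (tw : Grassmann F →ₗ[F] Grassmann F) (e : Grassmann F) (δ : Grassmann F →ₗ[F] F)
    (he : e * e = 0) (hδ : δ e = 1) (hδ1 : δ 1 = 0)
    (hc : ∀ x, i2 F e * i1 F x = i1 F (tw x) * i2 F e)
    (Y : Matrix (Fin (a + b)) (Fin (a + b)) F)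
    (hY : ∀ i j, Y i j • inv F e = (sg F a b i * sg F a b j * Y i j) • e) :
    (FreeAlgebra.lift F α f).map φ * Y - Y * (FreeAlgebra.lift F α f).map (φ ∘ₗ tw) ∈
      vals a b f := by
  obtain ⟨θ, hθ⟩ := exists_prod_functional φ δ
  set A := FreeAlgebra.lift F α f with hA
  set E := i2 F e with hE
  have hEE : E * E = 0 := by rw [hE, ← map_mul, he, map_zero]
  let N : (Matrix (Fin (a + b)) (Fin (a + b)) (Grassmann F)) := Matrix.of fun i j => Y i j • E
  have hNN : N * N = 0 := by
    ext i j
    simp [N, Matrix.mul_apply, hEE]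
  have hNM : N ∈ MabSet F a b := by
    rw [mem_Mab_iff h2]
    intro i j
    simp only [N, Matrix.of_apply, map_smul, hE, inv_i2]
    rw [← map_smul, hY, map_smul, smul_smul]
  refine ⟨fun k => (1 - N) * (α k).map (i1 F) * (1 + N), fun k => ?_, θ, ?_⟩
  · exact Mab_mul h2 (Mab_mul h2 (Mab_sub (Mab_one h2) hNM) (Mab_map h2 _ inv_i1 (hα k)))
      (Mab_add (Mab_one h2) hNM)
  rw [lift_conj N hNN, lift_map, ← hA]
  have e1 : A.map (i1 F) * N = Matrix.of fun i j => ∑ k, Y k j • (i1 F (A i k) * E) := by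
    ext i j
    simp [Matrix.mul_apply, N]
  have e2 : N * A.map (i1 F) = Matrix.of fun i j => ∑ k, Y i k • (i1 F (tw (A k j)) * E) := by
    ext i j
    simp [Matrix.mul_apply, N, hc]
  have e3 : N * A.map (i1 F) * N = 0 := by
    rw [e2]
    ext i j
    simp [Matrix.mul_apply, N, Finset.sum_mul, mul_assoc, hEE]
  have e4 : (1 - N) * A.map (i1 F) * (1 + N) =
      A.map (i1 F) + A.map (i1 F) * N - N * A.map (i1 F) := by
    calc _ = A.map (i1 F) + A.map (i1 F) * N - N * A.map (i1 F) - N * A.map (i1 F) * N := by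
          noncomm_ring
      _ = _ := by rw [e3, sub_zero]
  rw [e4, e1, e2]
  ext i j
  have e5 : θ (i1 F (A i j)) = 0 := by
    have := hθ (A i j) 1
    rwa [map_one, mul_one, hδ1, mul_zero] at this
  simp [Matrix.mul_apply, e5, hE, hθ, hδ, mul_comm]

theorem map_inv_eq (h2 : (2 : F) ≠ 0) {A : (Matrix (Fin (a + b)) (Fin (a + b)) (Grassmann F))} (hA : A ∈ MabSet F a b)
    (φ : Grassmann F →ₗ[F] F) :
    A.map (φ ∘ₗ (inv F).toLinearMap) =
      Matrix.diagonal (sg F a b) * A.map φ * Matrix.diagonal (sg F a b) := by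
  rw [mem_Mab_iff h2] at hA
  ext i j
  simp [Matrix.diagonal_mul, Matrix.mul_diagonal, hA]
  ring

theorem exists_even : ∃ (e : Grassmann F) (δ : Grassmann F →ₗ[F] F),
    e * e = 0 ∧ δ e = 1 ∧ δ 1 = 0 ∧ inv F e = e := by
  obtain ⟨φ, h1, h2⟩ := exists_φ0 (F := F)
  obtain ⟨θ, hθ⟩ := exists_prod_functional φ φ
  set v := ExteriorAlgebra.ι F (Finsupp.single 0 1 : ℕ →₀ F) with hv
  have hi : inv F v = -v := inv_ι _
  have hvv : v * v = 0 := ExteriorAlgebra.ι_sq_zero _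
  have hinv : inv F (i1 F v * i2 F v) = i1 F v * i2 F v := by
    rw [map_mul, inv_i1, inv_i2, hi, map_neg, map_neg, neg_mul_neg]
  refine ⟨i1 F v * i2 F v, θ, ?_, ?_, ?_, hinv⟩
  · rw [← mul_assoc, even_central _ hinv, ← mul_assoc, ← map_mul, hvv, map_zero, zero_mul,
      zero_mul]
  · rw [hθ, h2, one_mul]
  · have := hθ 1 1
    rwa [map_one, map_one, mul_one, h1, mul_zero] at this

theorem exists_odd : ∃ (e : Grassmann F) (δ : Grassmann F →ₗ[F] F),
    e * e = 0 ∧ δ e = 1 ∧ δ 1 = 0 ∧ inv F e = -e ∧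
      ∀ x, i2 F e * x = inv F x * i2 F e := by
  obtain ⟨φ, h1, h2⟩ := exists_φ0 (F := F)
  refine ⟨_, φ, ExteriorAlgebra.ι_sq_zero _, h2, h1, inv_ι _, fun x => ?_⟩
  rw [i2, ExteriorAlgebra.map_apply_ι, ι_mul]

theorem exists_par (σ : F) (hσ : σ = 1 ∨ σ = -1) :
    ∃ (e : Grassmann F) (δ : Grassmann F →ₗ[F] F), δ e = 1 ∧ inv F e = σ • e := by
  rcases hσ with rfl | rfl
  · obtain ⟨e, δ, _, h, _, h'⟩ := exists_even (F := F)
    exact ⟨e, δ, h, by rw [h', one_smul]⟩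
  · obtain ⟨e, δ, _, h, _, h', _⟩ := exists_odd (F := F)
    exact ⟨e, δ, h, by rw [h', neg_smul, one_smul]⟩

theorem central_scalar (h2 : (2 : F) ≠ 0) (p : FreeAlgebra F ℕ)
    (hp : ∀ α : ℕ → (Matrix (Fin (a + b)) (Fin (a + b)) (Grassmann F)), (∀ k, α k ∈ MabSet F a b) → ∀ x ∈ MabSet F a b,
      FreeAlgebra.lift F α p * x = x * FreeAlgebra.lift F α p)
    (α : ℕ → (Matrix (Fin (a + b)) (Fin (a + b)) (Grassmann F))) (hα : ∀ k, α k ∈ MabSet F a b) :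
    ∃ c : Grassmann F, FreeAlgebra.lift F α p = Matrix.diagonal fun _ => c := by
  set C := FreeAlgebra.lift F α p with hC
  have hoff : ∀ k i, k ≠ i → C k i = 0 := by
    intro k i hki
    have h := hp α hα (Matrix.single i i 1) (Mab_single h2 i i 1 (by simp [sg_mul_self]))
    have := congrFun (congrFun h k) i
    rw [← hC] at this
    simpa [hki] using this
  have hdiag : ∀ i j, C i i = C j j := by
    intro i j
    obtain ⟨e, δ, hδ, he⟩ := exists_par _ (sg_cases F i j)
    have h := hp (fun k => (α k).map (i1 F)) (fun k => Mab_map h2 _ inv_i1 (hα k))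
      (Matrix.single i j (i2 F e)) (Mab_single h2 i j _ (by rw [inv_i2, he, map_smul]))
    rw [lift_map, ← hC] at h
    have h3 := congrFun (congrFun h i) j
    simp only [Matrix.mul_single_apply_same, Matrix.single_mul_apply_same, Matrix.map_apply] at h3
    have hev : inv F (i1 F (C j j)) = i1 F (C j j) := by
      have := (mem_Mab_iff h2 C).1 (lift_mem h2 α hα p) j j
      rw [inv_i1, this, sg_mul_self, one_smul]
    rw [← even_central _ hev, ← sub_eq_zero, ← sub_mul, ← map_sub] at h3
    rw [← sub_eq_zero]
    apply eq_zero_of_functional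
    intro φ
    obtain ⟨θ, hθ⟩ := exists_prod_functional φ δ
    have := hθ (C i i - C j j) e
    rw [h3, map_zero, hδ, mul_one] at this
    exact this.symm
  rcases isEmpty_or_nonempty (Fin (a + b)) with h | ⟨⟨i⟩⟩
  · exact ⟨0, Subsingleton.elim _ _⟩
  · refine ⟨C i i, ?_⟩
    ext k l
    by_cases hkl : k = l
    · subst hkl; simp [hdiag k i]
    · simp [hkl, hoff k l hkl]

theorem central_of_vals (h2 : (2 : F) ≠ 0) (p : FreeAlgebra F ℕ)
    (hp : ∀ u ∈ vals a b p, ∃ c : F, u = c • (1 : Matrix (Fin (a + b)) (Fin (a + b)) F))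
    (α : ℕ → (Matrix (Fin (a + b)) (Fin (a + b)) (Grassmann F))) (hα : ∀ k, α k ∈ MabSet F a b) (x : (Matrix (Fin (a + b)) (Fin (a + b)) (Grassmann F))) :
    FreeAlgebra.lift F α p * x = x * FreeAlgebra.lift F α p := by
  have hmem := (mem_Mab_iff h2 _).1 (lift_mem h2 α hα p)
  have hv : ∀ φ : Grassmann F →ₗ[F] F, ∃ c : F,
      (FreeAlgebra.lift F α p).map φ = c • (1 : Matrix (Fin (a + b)) (Fin (a + b)) F) :=
    fun φ => hp _ ⟨α, hα, φ, rfl⟩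
  set C := FreeAlgebra.lift F α p with hC
  have hoff : ∀ k i, k ≠ i → C k i = 0 := by
    intro k i hki
    apply eq_zero_of_functional
    intro φ
    obtain ⟨c, hc⟩ := hv φ
    simpa [hki] using congrFun (congrFun hc k) i
  have hdiag : ∀ i j, C i i = C j j := by
    intro i j
    rw [← sub_eq_zero]
    apply eq_zero_of_functional
    intro φ
    obtain ⟨c, hc⟩ := hv φ
    have h1 := congrFun (congrFun hc i) i
    have h3 := congrFun (congrFun hc j) j
    simp at h1 h3
    rw [map_sub, h1, h3, sub_self]
  ext i j
  rw [Matrix.mul_apply, Matrix.mul_apply, Finset.sum_eq_single i, Finset.sum_eq_single j,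
    hdiag i j]
  · exact even_central _ (by rw [hmem, sg_mul_self, one_smul]) _
  · intro k _ hk; rw [hoff k j hk, mul_zero]
  · simp
  · intro k _ hk; rw [hoff i k hk.symm, zero_mul]
  · simp

theorem main (hchar : (2 : F) ≠ 0)
    (S T : Set ℕ) (hST : Disjoint S T)
    (f g : FreeAlgebra F ℕ)
    (hf : f ∈ Algebra.adjoin F (FreeAlgebra.ι F '' S))
    (hg : g ∈ Algebra.adjoin F (FreeAlgebra.ι F '' T))
    (hfg : IsCentralOn F (MabSet F a b) (f * g)) :
    IsCentralOn F (MabSet F a b) f ∧ IsCentralOn F (MabSet F a b) g := by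
  classical
  obtain ⟨hnon, hcen⟩ := hfg
  have hnf : ¬ IsIdentityOn F (MabSet F a b) f := fun h =>
    hnon fun α hα => by rw [map_mul, h α hα, zero_mul]
  have hng : ¬ IsIdentityOn F (MabSet F a b) g := fun h =>
    hnon fun α hα => by rw [map_mul, h α hα, mul_zero]
  set D : Matrix (Fin (a + b)) (Fin (a + b)) F := Matrix.diagonal (sg F a b) with hD
  have hDa : ∀ (Y : Matrix (Fin (a + b)) (Fin (a + b)) F) i j,
      (D * Y * D) i j = sg F a b i * sg F a b j * Y i j := by
    intro Y i j
    simp only [hD, Matrix.diagonal_mul, Matrix.mul_diagonal]; ring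
  have key := alg_core hchar D (by simp [hD, sg_mul_self]) ?_ (vals a b f) (vals a b g)
    ?_ ?_ ?_ ?_ ?_ ?_
  · exact ⟨⟨hnf, fun α hα x _ => central_of_vals hchar f key.1 α hα x⟩,
      ⟨hng, fun α hα x _ => central_of_vals hchar g key.2 α hα x⟩⟩
  · intro i j
    rcases sg_cases F i j with h | h
    · left
      ext k l
      rw [hDa]
      by_cases hkl : i = k ∧ j = l
      · obtain ⟨rfl, rfl⟩ := hkl; simp [h]
      · simp [Matrix.single_apply_of_ne _ _ _ _ _ hkl]
    · right
      ext k l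
      rw [hDa]
      by_cases hkl : i = k ∧ j = l
      · obtain ⟨rfl, rfl⟩ := hkl; simp [h]
      · simp [Matrix.single_apply_of_ne _ _ _ _ _ hkl]
  · rintro u ⟨α, hα, φ, rfl⟩ w ⟨β, hβ, ψ, rfl⟩
    obtain ⟨θ, hθ⟩ := exists_prod_functional φ ψ
    let γ : ℕ → (Matrix (Fin (a + b)) (Fin (a + b)) (Grassmann F)) := fun k => if k ∈ S then (α k).map (i1 F) else (β k).map (i2 F)
    have hγ : ∀ k, γ k ∈ MabSet F a b := fun k => by
      by_cases h : k ∈ S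
      · simp only [γ, h, if_true]; exact Mab_map hchar _ inv_i1 (hα k)
      · simp only [γ, h, if_false]; exact Mab_map hchar _ inv_i2 (hβ k)
    have h1 : FreeAlgebra.lift F γ f = (FreeAlgebra.lift F α f).map (i1 F) := by
      rw [← lift_map]
      exact lift_congr S _ _ (fun k hk => by simp [γ, hk]) f hf
    have h3 : FreeAlgebra.lift F γ g = (FreeAlgebra.lift F β g).map (i2 F) := by
      rw [← lift_map]
      exact lift_congr T _ _ (fun k hk => by
        simp [γ, Set.disjoint_right.1 hST hk]) g hg
    obtain ⟨c, hc⟩ := central_scalar hchar (f * g) hcen γ hγ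
    rw [map_mul, h1, h3] at hc
    refine ⟨θ c, ?_⟩
    ext i j
    have h4 := congrArg θ (congrFun (congrFun hc i) j)
    simp only [Matrix.mul_apply, Matrix.map_apply, map_sum, hθ] at h4
    simp only [Matrix.mul_apply, Matrix.map_apply, h4]
    by_cases hij : i = j
    · subst hij; simp
    · simp [hij]
  · rintro u ⟨α, hα, φ, rfl⟩
    refine ⟨α, hα, φ + φ ∘ₗ (inv F).toLinearMap, ?_⟩
    rw [hD, ← map_inv_eq hchar (lift_mem hchar α hα f)]
    rfl
  · rintro u ⟨α, hα, φ, rfl⟩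
    refine ⟨α, hα, φ - φ ∘ₗ (inv F).toLinearMap, ?_⟩
    rw [hD, ← map_inv_eq hchar (lift_mem hchar α hα f)]
    rfl
  · rintro u ⟨α, hα, φ, rfl⟩ Y hY
    obtain ⟨e, δ, he, hδ, hδ1, hi⟩ := exists_even (F := F)
    refine vals_conj hchar f α hα φ LinearMap.id e δ he hδ hδ1 (fun x => ?_) Y fun i j => ?_
    · exact even_central _ (by rw [inv_i2, hi]) _
    · rw [hi, ← hDa, hY]
  · rintro u ⟨α, hα, φ, rfl⟩ Y hY
    obtain ⟨e, δ, he, hδ, hδ1, hi, hc⟩ := exists_odd (F := F)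
    rw [hD, ← map_inv_eq hchar (lift_mem hchar α hα f)]
    refine vals_conj hchar f α hα φ _ e δ he hδ hδ1 (fun x => ?_) Y fun i j => ?_
    · rw [hc, inv_i1]; rfl
    · rw [hi, ← hDa, hY]; simp
  · by_contra hcon
    push Not at hcon
    apply hnon
    intro α hα
    rw [map_mul]
    ext i j
    rw [Matrix.mul_apply]
    apply sum_mul_eq_zero
    intro φ ψ
    have := hcon _ ⟨α, hα, φ, rfl⟩ _ ⟨α, hα, ψ, rfl⟩
    simpa [Matrix.mul_apply] using congrFun (congrFun this i) j

end Main

end MabP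

/-- Let `F` be an infinite field of characteristic `≠ 2`.  The algebra
`M_{a,b}(E)` satisfies the primeness property for ordinary central polynomials: if
`f` and `g` are polynomials in disjoint sets of variables such that `f * g` is a central
polynomial for `M_{a,b}(E)`, then both `f` and `g` are central polynomials for
`M_{a,b}(E)`. -/
theorem Mab_primeness
    (F : Type*) [Field F] [Infinite F] (hchar : (2 : F) ≠ 0) (a b : ℕ)
    (S T : Set ℕ) (hST : Disjoint S T)
    (f g : FreeAlgebra F ℕ)
    (hf : f ∈ Algebra.adjoin F (FreeAlgebra.ι F '' S))
    (hg : g ∈ Algebra.adjoin F (FreeAlgebra.ι F '' T))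
    (hfg : IsCentralOn F (MabSet F a b) (f * g)) :
    IsCentralOn F (MabSet F a b) f ∧ IsCentralOn F (MabSet F a b) g := by
  exact MabP.main hchar S T hST f g hf hg hfg
end

section
/- Let F be an infinite field of characteristic different from 2 and let A = A_0 ⊕ A_1 be M_{a,b}(E) with its canonical ℤ_2-grading. Let f(x_1,…,x_r) be a polynomial in the free associative algebra F⟨X⟩ such that for some polynomial g(x_{r+1},…,x_s) in disjoint variables the product f·g is an ordinary central polynomial for A. Then there exists i ∈ ℤ_2 such that f(a_1,…,a_r) ∈ A_i for every a_1,…,a_r ∈ A. -/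
namespace MabProof

open Matrix

section Gr

variable (F : Type*) [Field F]

/-- Splitting of the countable dimensional space as a product of two copies of itself. -/
noncomputable def splitL : ((ℕ →₀ F) × (ℕ →₀ F)) ≃ₗ[F] (ℕ →₀ F) :=
  (Finsupp.sumFinsuppLEquivProdFinsupp F).symm.trans
    (Finsupp.domLCongr Equiv.natSumNatEquivNat)

noncomputable def al : Grassmann F →ₐ[F] Grassmann F :=
  ExteriorAlgebra.map ((splitL F).toLinearMap ∘ₗ LinearMap.inl F _ _)

noncomputable def be : Grassmann F →ₐ[F] Grassmann F :=
  ExteriorAlgebra.map ((splitL F).toLinearMap ∘ₗ LinearMap.inr F _ _)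

noncomputable def splitIso : (0 : QuadraticForm F (ℕ →₀ F)) →qᵢ
    ((0 : QuadraticForm F (ℕ →₀ F)).prod (0 : QuadraticForm F (ℕ →₀ F))) where
  toLinearMap := (splitL F).symm.toLinearMap
  map_app' := by intro m; simp

noncomputable def psi : Grassmann F →ₐ[F]
    GradedTensorProduct F (CliffordAlgebra.evenOdd (0 : QuadraticForm F (ℕ →₀ F)))
      (CliffordAlgebra.evenOdd (0 : QuadraticForm F (ℕ →₀ F))) :=
  (CliffordAlgebra.ofProd _ _).comp (CliffordAlgebra.map (splitIso F))

lemma splitIso_apply (m : ℕ →₀ F) : splitIso F m = (splitL F).symm m := rfl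

lemma psi_ι (m : ℕ →₀ F) : psi F (ExteriorAlgebra.ι F (splitL F (m, 0))) =
    GradedTensorProduct.includeLeft _ _ (ExteriorAlgebra.ι F m) := by
  unfold psi
  rw [AlgHom.comp_apply, ExteriorAlgebra.ι, CliffordAlgebra.map_apply_ι, splitIso_apply,
    LinearEquiv.symm_apply_apply, CliffordAlgebra.ofProd_ι_mk]
  simp

lemma psi_ι' (m : ℕ →₀ F) : psi F (ExteriorAlgebra.ι F (splitL F (0, m))) =
    GradedTensorProduct.includeRight _ _ (ExteriorAlgebra.ι F m) := by
  unfold psi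
  rw [AlgHom.comp_apply, ExteriorAlgebra.ι, CliffordAlgebra.map_apply_ι, splitIso_apply,
    LinearEquiv.symm_apply_apply, CliffordAlgebra.ofProd_ι_mk]
  simp

lemma psi_al (u : Grassmann F) :
    psi F (al F u) = GradedTensorProduct.includeLeft _ _ u := by
  have : (psi F).comp (al F) = GradedTensorProduct.includeLeft _ _ := by
    apply ExteriorAlgebra.hom_ext
    ext1 m
    ext1
    simpa [al, ExteriorAlgebra.map_apply_ι] using psi_ι F (Finsupp.single m 1)
  exact DFunLike.congr_fun this u

lemma psi_be (u : Grassmann F) :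
    psi F (be F u) = GradedTensorProduct.includeRight _ _ u := by
  have : (psi F).comp (be F) = GradedTensorProduct.includeRight _ _ := by
    apply ExteriorAlgebra.hom_ext
    ext1 m
    ext1
    simpa [be, ExteriorAlgebra.map_apply_ι] using psi_ι' F (Finsupp.single m 1)
  exact DFunLike.congr_fun this u

lemma tmul_zero_cases {V W : Type*} [AddCommGroup V] [Module F V] [AddCommGroup W] [Module F W]
    (u : V) (w : W) (h : TensorProduct.tmul F u w = 0) : u = 0 ∨ w = 0 := by
  by_contra hc
  push Not at hc
  obtain ⟨p, hp⟩ := Module.Projective.exists_dual_ne_zero F hc.1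
  obtain ⟨q, hq⟩ := Module.Projective.exists_dual_ne_zero F hc.2
  have := congrArg (LinearMap.mul' F F ∘ₗ TensorProduct.map p q) h
  simp at this
  tauto

lemma al_mul_be (u w : Grassmann F) (h : al F u * be F w = 0) : u = 0 ∨ w = 0 := by
  have h1 := congrArg (psi F) h
  rw [map_mul, psi_al, psi_be, map_zero, GradedTensorProduct.includeLeft_apply,
    GradedTensorProduct.includeRight_apply, GradedTensorProduct.tmul_one_mul_one_tmul] at h1
  exact tmul_zero_cases F u w h1

lemma grass_eq (z : ZMod 2) :
    GrassComp F z = CliffordAlgebra.evenOdd (0 : QuadraticForm F (ℕ →₀ F)) z := rfl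

lemma grass_mul {y z : ZMod 2} {u w : Grassmann F} (hu : u ∈ GrassComp F y)
    (hw : w ∈ GrassComp F z) : u * w ∈ GrassComp F (y + z) :=
  SetLike.mul_mem_graded (A := CliffordAlgebra.evenOdd (0 : QuadraticForm F (ℕ →₀ F))) hu hw

lemma grass_one : (1 : Grassmann F) ∈ GrassComp F 0 :=
  SetLike.one_mem_graded (CliffordAlgebra.evenOdd (0 : QuadraticForm F (ℕ →₀ F)))

lemma grass_ι (m : ℕ →₀ F) : ExteriorAlgebra.ι F m ∈ GrassComp F 1 :=
  CliffordAlgebra.ι_mem_evenOdd_one _ m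

lemma grass_map (L : (ℕ →₀ F) →ₗ[F] (ℕ →₀ F)) {z : ZMod 2} {u : Grassmann F}
    (hu : u ∈ GrassComp F z) : ExteriorAlgebra.map L u ∈ GrassComp F z := by
  have : (GrassComp F z).map (ExteriorAlgebra.map L).toLinearMap ≤ GrassComp F z := by
    unfold GrassComp
    rw [Submodule.map_iSup]
    refine iSup_mono fun i => ?_
    rw [Submodule.map_pow, ExteriorAlgebra.ι_range_map_map]
    refine pow_le_pow_left' ?_ _
    rintro _ ⟨x, -, rfl⟩
    exact ⟨x, rfl⟩
  exact this ⟨u, hu, rfl⟩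

lemma al_mem {z : ZMod 2} {u : Grassmann F}
    (hu : u ∈ GrassComp F z) : al F u ∈ GrassComp F z := grass_map F _ hu

lemma be_mem {z : ZMod 2} {u : Grassmann F}
    (hu : u ∈ GrassComp F z) : be F u ∈ GrassComp F z := grass_map F _ hu

/-- A generator. -/
noncomputable def e0 : Grassmann F := ExteriorAlgebra.ι F (Finsupp.single 0 1)

lemma e0_ne : e0 F ≠ 0 := by
  simp [e0]

lemma e0_mem : e0 F ∈ GrassComp F 1 := grass_ι F _

lemma exists_sq_zero (z : ZMod 2) : ∃ x ∈ GrassComp F z, x ≠ 0 ∧ x * x = 0 := by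
  have h0 : e0 F * e0 F = 0 := ExteriorAlgebra.ι_sq_zero _
  have hz : z = 0 ∨ z = 1 := by revert z; decide
  rcases hz with rfl | rfl
  · refine ⟨al F (e0 F) * be F (e0 F), ?_, ?_, ?_⟩
    · have h11 : (1 : ZMod 2) + 1 = 0 := by decide
      have h := grass_mul F (al_mem F (e0_mem F)) (be_mem F (e0_mem F))
      rwa [h11] at h
    · intro h
      rcases al_mul_be F _ _ h with h | h <;> exact e0_ne F h
    · obtain ⟨p, hp⟩ : ∃ p, al F (e0 F) = ExteriorAlgebra.ι F p :=
        ⟨_, by rw [al, e0, ExteriorAlgebra.map_apply_ι]⟩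
      obtain ⟨q, hq⟩ : ∃ q, be F (e0 F) = ExteriorAlgebra.ι F q :=
        ⟨_, by rw [be, e0, ExteriorAlgebra.map_apply_ι]⟩
      rw [hp, hq]
      have h1 := ExteriorAlgebra.ι_add_mul_swap (R := F) p q
      have h2 : ExteriorAlgebra.ι F q * ExteriorAlgebra.ι F p =
        - (ExteriorAlgebra.ι F p * ExteriorAlgebra.ι F q) := (neg_eq_of_add_eq_zero_right h1).symm
      rw [mul_assoc, ← mul_assoc (ExteriorAlgebra.ι F q), h2, neg_mul, mul_assoc,
        ExteriorAlgebra.ι_sq_zero]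
      simp
  · exact ⟨e0 F, e0_mem F, e0_ne F, h0⟩

end Gr

section Mab

variable (F : Type*) [Field F] (a b : ℕ)

lemma blk_add (i j k : Fin (a + b)) : blk a b i j + blk a b j k = blk a b i k := by
  unfold blk
  have : (1 : ZMod 2) + 1 = 0 := by decide
  by_cases h1 : (i : ℕ) < a <;> by_cases h2 : (j : ℕ) < a <;> by_cases h3 : (k : ℕ) < a <;>
    simp [h1, h2, h3, this]

lemma blk_comm (i j : Fin (a + b)) : blk a b i j = blk a b j i := by
  unfold blk
  simp only [iff_comm]

lemma blk_self (i : Fin (a + b)) : blk a b i i = 0 := by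
  simp [blk]

abbrev Mt := Matrix (Fin (a + b)) (Fin (a + b)) (Grassmann F)

/-- `M_{a,b}(E)` as a subalgebra. -/
noncomputable def MabAlg : Subalgebra F (Mt F a b) where
  carrier := MabSet F a b
  mul_mem' := by
    intro x y hx hy i j
    rw [Matrix.mul_apply]
    refine Submodule.sum_mem _ fun k _ => ?_
    rw [← blk_add a b i k j]
    exact grass_mul F (hx i k) (hy k j)
  add_mem' := by
    intro x y hx hy i j
    exact Submodule.add_mem _ (hx i j) (hy i j)
  algebraMap_mem' := by
    intro r i j
    rw [Matrix.algebraMap_matrix_apply]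
    split_ifs with h
    · subst h
      rw [blk_self, Algebra.algebraMap_eq_smul_one]
      exact Submodule.smul_mem _ _ (grass_one F)
    · exact Submodule.zero_mem _

lemma mem_MabAlg (x : Mt F a b) : x ∈ MabAlg F a b ↔ x ∈ MabSet F a b := Iff.rfl

lemma single_mem {i j : Fin (a + b)} {x : Grassmann F} (hx : x ∈ GrassComp F (blk a b i j)) :
    Matrix.single i j x ∈ MabSet F a b := by
  intro k l
  rw [Matrix.single_apply]
  split_ifs with h
  · rw [← h.1, ← h.2]; exact hx
  · exact Submodule.zero_mem _

/-- Span of the values of `f`. -/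
noncomputable def Val (f : FreeAlgebra F ℕ) : Submodule F (Mt F a b) :=
  Submodule.span F {v | ∃ s : ℕ → Mt F a b, (∀ k, s k ∈ MabSet F a b) ∧
    v = FreeAlgebra.lift F s f}

lemma val_hom (f : FreeAlgebra F ℕ) (φ : Mt F a b →ₐ[F] Mt F a b)
    (hφ : ∀ x ∈ MabSet F a b, φ x ∈ MabSet F a b) {v : Mt F a b} (hv : v ∈ Val F a b f) :
    φ v ∈ Val F a b f := by
  have : Val F a b f ≤ (Val F a b f).comap φ.toLinearMap := by
    conv_lhs => unfold Val
    rw [Submodule.span_le]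
    rintro _ ⟨s, hs, rfl⟩
    refine Submodule.subset_span ⟨fun k => φ (s k), fun k => hφ _ (hs k), ?_⟩
    have : φ.comp (FreeAlgebra.lift F s) = FreeAlgebra.lift F (fun k => φ (s k)) := by
      ext1; ext1 k; simp
    exact DFunLike.congr_fun this f
  exact this hv

lemma lift_mem (f : FreeAlgebra F ℕ) (s : ℕ → Mt F a b) (hs : ∀ k, s k ∈ MabSet F a b) :
    FreeAlgebra.lift F s f ∈ MabSet F a b := by
  rw [← mem_MabAlg]
  have : FreeAlgebra.lift F s =
      (MabAlg F a b).val.comp (FreeAlgebra.lift F (fun k => (⟨s k, hs k⟩ : MabAlg F a b))) := by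
    ext1; ext1 k; simp
  rw [this]
  exact Subtype.prop _

/-- Inner automorphism. -/
noncomputable def conj {A : Type*} [Ring A] [Algebra F A] (u u' : A) (h : u * u' = 1)
    (h' : u' * u = 1) : A →ₐ[F] A :=
  AlgHom.ofLinearMap (LinearMap.mulLeft F u ∘ₗ LinearMap.mulRight F u')
    (by simpa using h)
    (by
      intro x y
      simp only [LinearMap.coe_comp, Function.comp_apply, LinearMap.mulRight_apply,
        LinearMap.mulLeft_apply]
      calc u * (x * y * u') = u * x * (1 * (y * u')) := by noncomm_ring
        _ = _ := by rw [← h']; noncomm_ring)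

lemma conj_apply {A : Type*} [Ring A] [Algebra F A] (u u' : A) (h : u * u' = 1)
    (h' : u' * u = 1) (x : A) : conj F u u' h h' x = u * (x * u') := rfl

lemma val_map (f : FreeAlgebra F ℕ) (L : (ℕ →₀ F) →ₗ[F] (ℕ →₀ F)) {v : Mt F a b}
    (hv : v ∈ Val F a b f) : v.map (ExteriorAlgebra.map L) ∈ Val F a b f :=
  val_hom F a b f (AlgHom.mapMatrix (ExteriorAlgebra.map L))
    (fun _ hx i j => grass_map F L (hx i j)) hv

/-- The grading involution. -/
noncomputable def sg (i : Fin (a + b)) : Grassmann F := if (i : ℕ) < a then 1 else -1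

lemma val_sgn (f : FreeAlgebra F ℕ) {v : Mt F a b} (hv : v ∈ Val F a b f) :
    (Matrix.of fun i j => if blk a b i j = 0 then v i j else - v i j) ∈ Val F a b f := by
  have hsg : ∀ i, sg F a b i * sg F a b i = 1 := by
    intro i; unfold sg; split_ifs <;> simp
  have h : Matrix.diagonal (sg F a b) * Matrix.diagonal (sg F a b) = 1 := by
    rw [Matrix.diagonal_mul_diagonal]
    simp [hsg]
  have key : ∀ x : Mt F a b, conj F _ _ h h x =
      (Matrix.of fun i j => if blk a b i j = 0 then x i j else - x i j) := by
    intro x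
    rw [conj_apply]
    ext i j
    rw [Matrix.diagonal_mul, Matrix.mul_diagonal, Matrix.of_apply]
    unfold sg blk
    by_cases h1 : (i : ℕ) < a <;> by_cases h2 : (j : ℕ) < a <;> simp [h1, h2]
  rw [← key]
  refine val_hom F a b f _ ?_ hv
  intro x hx i j
  rw [key, Matrix.of_apply]
  split_ifs
  · exact hx i j
  · exact Submodule.neg_mem _ (hx i j)

lemma val_conj (f : FreeAlgebra F ℕ) {n : Mt F a b} (hn : n ∈ MabSet F a b) (hn2 : n * n = 0)
    {v : Mt F a b} (hv : v ∈ Val F a b f) : (1 + n) * (v * (1 - n)) ∈ Val F a b f := by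
  have h : (1 + n) * (1 - n) = 1 := by
    have : (1 + n) * (1 - n) = 1 - n * n := by noncomm_ring
    rw [this, hn2, sub_zero]
  have h' : (1 - n) * (1 + n) = 1 := by
    have : (1 - n) * (1 + n) = 1 - n * n := by noncomm_ring
    rw [this, hn2, sub_zero]
  rw [← conj_apply F _ _ h h']
  refine val_hom F a b f _ ?_ hv
  intro x hx
  rw [conj_apply, ← mem_MabAlg]
  have hn' : n ∈ MabAlg F a b := hn
  have hx' : x ∈ MabAlg F a b := hx
  exact mul_mem (add_mem (one_mem _) hn') (mul_mem hx' (sub_mem (one_mem _) hn'))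

lemma val_comm (hchar : (2 : F) ≠ 0) (f : FreeAlgebra F ℕ) {n : Mt F a b}
    (hn : n ∈ MabSet F a b) (hn2 : n * n = 0)
    {v : Mt F a b} (hv : v ∈ Val F a b f) : n * v - v * n ∈ Val F a b f := by
  have h1 := val_conj F a b f hn hn2 hv
  have hn' : -n ∈ MabSet F a b := (MabAlg F a b).neg_mem hn
  have h2 := val_conj F a b f hn' (by rw [neg_mul_neg, hn2]) hv
  have h3 := Submodule.smul_mem _ ((2 : F)⁻¹) (Submodule.sub_mem _ h1 h2)
  have : (1 + n) * (v * (1 - n)) - (1 + -n) * (v * (1 - -n)) = (2 : F) • (n * v - v * n) := by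
    rw [two_smul]; noncomm_ring
  rwa [this, smul_smul, inv_mul_cancel₀ hchar, one_smul] at h3

lemma lift_congr {S : Set ℕ} {f : FreeAlgebra F ℕ}
    (hf : f ∈ Algebra.adjoin F (FreeAlgebra.ι F '' S)) (s t : ℕ → Mt F a b)
    (h : ∀ k ∈ S, s k = t k) : FreeAlgebra.lift F s f = FreeAlgebra.lift F t f := by
  have : Algebra.adjoin F (FreeAlgebra.ι F '' S) ≤
      AlgHom.equalizer (FreeAlgebra.lift F s) (FreeAlgebra.lift F t) := by
    rw [Algebra.adjoin_le_iff]
    rintro _ ⟨k, hk, rfl⟩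
    simp [h k hk]
  exact this hf

/-- Products of values of `f` and `g` are central. -/
lemma val_central {S T : Set ℕ} (hST : Disjoint S T) {f g : FreeAlgebra F ℕ}
    (hf : f ∈ Algebra.adjoin F (FreeAlgebra.ι F '' S))
    (hg : g ∈ Algebra.adjoin F (FreeAlgebra.ι F '' T))
    (hfg : IsCentralOn F (MabSet F a b) (f * g)) {v w x : Mt F a b}
    (hv : v ∈ Val F a b f) (hw : w ∈ Val F a b g) (hx : x ∈ MabSet F a b) :
    v * w * x = x * (v * w) := by
  classical
  unfold Val at hv hw
  induction hv using Submodule.span_induction with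
  | zero => simp
  | add p q _ _ hp hq => rw [add_mul, add_mul, hp, hq, mul_add]
  | smul c p _ hp => rw [smul_mul_assoc, smul_mul_assoc, hp, mul_smul_comm]
  | mem p hp =>
    obtain ⟨s, hs, rfl⟩ := hp
    induction hw using Submodule.span_induction with
    | zero => simp
    | add p q _ _ hp hq => rw [mul_add, add_mul, hp, hq, mul_add]
    | smul c p _ hp => rw [mul_smul_comm, smul_mul_assoc, hp, mul_smul_comm]
    | mem p hp =>
      obtain ⟨t, ht, rfl⟩ := hp
      have h := hfg.2 (fun k => if k ∈ S then s k else t k)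
        (by intro k; split_ifs; exacts [hs k, ht k]) x hx
      rw [map_mul, lift_congr F a b hf _ s, lift_congr F a b hg _ t] at h
      · exact h
      · intro k hk
        have : k ∉ S := fun h => Set.disjoint_left.1 hST h hk
        simp [this]
      · intro k hk
        simp [hk]

lemma core (hchar : (2 : F) ≠ 0) (f g : FreeAlgebra F ℕ)
    (hc : ∀ {v w x : Mt F a b}, v ∈ Val F a b f → w ∈ Val F a b g → x ∈ MabSet F a b →
      v * w * x = x * (v * w))
    {v w : Mt F a b} (hv : v ∈ Val F a b f) (hw : w ∈ Val F a b g) (q : ZMod 2)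
    (hvq : ∀ i j, blk a b i j = q → v i j = 0) (hwq : ∀ i j, blk a b i j ≠ q → w i j = 0)
    {j l m : Fin (a + b)} (hjl : w j l ≠ 0) (hm : blk a b l m ≠ 0) : v = 0 := by
  have off : ∀ {v w : Mt F a b}, v ∈ Val F a b f → w ∈ Val F a b g → ∀ k l, k ≠ l →
      (v * w) k l = 0 := by
    intro v w hv hw k l hkl
    have h := hc hv hw (single_mem F a b (i := l) (j := l) (x := 1)
      (by rw [blk_self]; exact grass_one F))
    have h2 := congrFun (congrFun h k) l
    rw [Matrix.mul_single_apply_same, Matrix.single_mul_apply_of_ne _ _ _ _ _ hkl] at h2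
    simpa using h2
  have dia : ∀ {v w : Mt F a b}, v ∈ Val F a b f → w ∈ Val F a b g → ∀ l m, blk a b l m ≠ 0 →
      (v * w) m m = 0 → (v * w) l l = 0 := by
    intro v w hv hw l m hlm h0
    have h1 : blk a b l m = 1 := by
      generalize blk a b l m = z at hlm; revert z; decide
    have hme : be F (e0 F) ∈ GrassComp F (blk a b l m) := by
      rw [h1]; exact grass_map F _ (e0_mem F)
    have h := hc (v := v.map (al F)) (w := w.map (al F)) (val_map F a b f _ hv)
      (val_map F a b g _ hw) (single_mem F a b hme)
    have hh : v.map (al F) * w.map (al F) = (v * w).map (al F) := (Matrix.map_mul).symm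
    rw [hh] at h
    have h2 := congrFun (congrFun h l) m
    rw [Matrix.mul_single_apply_same, Matrix.single_mul_apply_same] at h2
    rw [Matrix.map_apply, Matrix.map_apply, h0, map_zero, mul_zero] at h2
    exact (al_mul_be F _ _ h2).resolve_right (e0_ne F)
  -- work with shifted copies
  have hv1 : (v.map (al F)).map (al F) ∈ Val F a b f := val_map F a b f _ (val_map F a b f _ hv)
  have hw1 : w.map (be F) ∈ Val F a b g := val_map F a b g _ hw
  set v1 := (v.map (al F)).map (al F) with hv1d
  set w1 := w.map (be F) with hw1d
  have hv1e : ∀ i j, v1 i j = al F (al F (v i j)) := fun i j => rfl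
  have hw1e : ∀ i j, w1 i j = be F (w i j) := fun i j => rfl
  have hvw : v1 * w1 = 0 := by
    ext k r
    by_cases hkr : k = r
    · subst hkr
      rw [Matrix.mul_apply]
      refine Finset.sum_eq_zero fun i _ => ?_
      by_cases hb : blk a b k i = q
      · rw [hv1e, hvq _ _ hb]; simp
      · rw [hw1e, hwq i k (by rwa [blk_comm])]; simp
    · exact off hv1 hw1 k r hkr
  ext k i
  obtain ⟨x, hx, hx0, hxx⟩ := exists_sq_zero F (blk a b i j)
  set n : Mt F a b := Matrix.single i j (al F (be F x)) with hn
  have hnm : n ∈ MabSet F a b := single_mem F a b (grass_map F _ (grass_map F _ hx))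
  have hn2 : n * n = 0 := by
    rw [hn]
    by_cases hij : j = i
    · subst hij
      rw [Matrix.single_mul_single_same, ← map_mul, ← map_mul, hxx]; simp
    · rw [Matrix.single_mul_single_of_ne]
      exact hij
  have hD := val_comm F a b hchar f hnm hn2 hv1
  have hDw : (n * v1 - v1 * n) * w1 = -(v1 * n * w1) := by
    rw [sub_mul, mul_assoc n, hvw, mul_zero, zero_sub]
  have hent : ∀ r t, ((n * v1 - v1 * n) * w1) r t =
      -(al F (al F (v r i) * be F x) * be F (w j t)) := by
    intro r t
    rw [hDw, Matrix.neg_apply, mul_assoc, Matrix.mul_apply, Finset.sum_eq_single i]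
    · rw [hn, Matrix.single_mul_apply_same, hv1e, hw1e, map_mul, mul_assoc]
    · intro c _ hci
      rw [hn, Matrix.single_mul_apply_of_ne _ _ _ _ _ hci, mul_zero]
    · simp
  have hkl : ((n * v1 - v1 * n) * w1) k l = 0 := by
    by_cases hkl : k = l
    · subst hkl
      apply dia hD hw1 k m hm
      have : w j m = 0 := by
        by_contra hne
        have e1 : blk a b j m = q := by
          by_contra h; exact hne (hwq _ _ h)
        have e2 : blk a b j k = q := by
          by_contra h; exact hjl (hwq _ _ h)
        have e3 := blk_add a b j k m
        rw [e1, e2] at e3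
        exact hm (by simpa using e3)
      rw [hent, this]; simp
    · exact off hD hw1 k l hkl
  rw [hent, neg_eq_zero] at hkl
  have h1 := (al_mul_be F _ _ hkl).resolve_right hjl
  exact (al_mul_be F _ _ h1).resolve_right hx0

end Mab

end MabProof

/-- Let `A = A₀ ⊕ A₁` be `M_{a,b}(E)` with its canonical `ℤ/2`-grading
(over an infinite field of characteristic `≠ 2`).  If `f * g` is an ordinary central
polynomial for `A`, where `f` and `g` are in disjoint sets of variables, then there is
`i ∈ ℤ/2` such that all values of `f` on `A` lie in `A_i`. -/
theorem values_in_homogeneous_component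
    (F : Type*) [Field F] [Infinite F] (hchar : (2 : F) ≠ 0) (a b : ℕ)
    (S T : Set ℕ) (hST : Disjoint S T)
    (f g : FreeAlgebra F ℕ)
    (hf : f ∈ Algebra.adjoin F (FreeAlgebra.ι F '' S))
    (hg : g ∈ Algebra.adjoin F (FreeAlgebra.ι F '' T))
    (hfg : IsCentralOn F (MabSet F a b) (f * g)) :
    ∃ z : ZMod 2,
      ∀ s : ℕ → Matrix (Fin (a + b)) (Fin (a + b)) (Grassmann F),
        (∀ k, s k ∈ MabSet F a b) → FreeAlgebra.lift F s f ∈ MabComp F a b z := by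
  classical
  have hid : ∃ t : ℕ → Matrix (Fin (a + b)) (Fin (a + b)) (Grassmann F),
      (∀ k, t k ∈ MabSet F a b) ∧ FreeAlgebra.lift F t g ≠ 0 := by
    by_contra hcon
    push Not at hcon
    refine hfg.1 fun t ht => ?_
    rw [map_mul, hcon t ht, mul_zero]
  obtain ⟨t, ht, hne⟩ := hid
  obtain ⟨j, l, hjl⟩ : ∃ j l, FreeAlgebra.lift F t g j l ≠ 0 := by
    by_contra hcon
    push Not at hcon
    exact hne (Matrix.ext hcon)
  refine ⟨blk a b j l, fun s hs => ⟨MabProof.lift_mem F a b f s hs, fun k i hki => ?_⟩⟩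
  obtain ⟨m, hm⟩ : ∃ m, blk a b l m ≠ 0 := by
    by_contra hcon
    push Not at hcon
    apply hki
    rw [← MabProof.blk_add a b k l i, MabProof.blk_comm a b k l, MabProof.blk_comm a b j l,
      hcon, hcon, hcon, add_zero]
  have hv : FreeAlgebra.lift F s f ∈ MabProof.Val F a b f := Submodule.subset_span ⟨s, hs, rfl⟩
  have hw : FreeAlgebra.lift F t g ∈ MabProof.Val F a b g := Submodule.subset_span ⟨t, ht, rfl⟩
  generalize FreeAlgebra.lift F s f = v at hv
  generalize FreeAlgebra.lift F t g = w at hw hjl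
  have hv' := MabProof.val_sgn F a b f hv
  have hw' := MabProof.val_sgn F a b g hw
  have two : ∀ u : Grassmann F, u + u = 0 → u = 0 := by
    intro u hu
    rw [← two_smul F] at hu
    exact (smul_eq_zero.1 hu).resolve_left hchar
  have z01 : ∀ z : ZMod 2, z = 0 ∨ z = 1 := by decide
  have hc : ∀ {v w x : MabProof.Mt F a b}, v ∈ MabProof.Val F a b f → w ∈ MabProof.Val F a b g →
      x ∈ MabSet F a b → v * w * x = x * (v * w) :=
    fun h1 h2 h3 => MabProof.val_central F a b hST hf hg hfg h1 h2 h3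
  rcases z01 (blk a b j l) with hq | hq
  · have h := MabProof.core F a b hchar f g hc (Submodule.sub_mem _ hv hv')
      (Submodule.add_mem _ hw hw') 0
      (by intro i j hij; simp [hij]) (by intro i j hij; simp [hij]) (j := j) (l := l) (m := m)
      (by intro h; apply hjl; apply two; simpa [hq] using h) hm
    have h2 := congrFun (congrFun h k) i
    apply two
    rw [hq] at hki
    simpa [hki] using h2
  · have h := MabProof.core F a b hchar f g hc (Submodule.add_mem _ hv hv')
      (Submodule.sub_mem _ hw hw') 1
      (by intro i j hij; simp [hij])
      (by
        intro i j hij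
        have := (z01 (blk a b i j)).resolve_right hij
        simp [this]) (j := j) (l := l) (m := m)
      (by intro h; apply hjl; apply two; simpa [hq] using h) hm
    have h2 := congrFun (congrFun h k) i
    apply two
    rw [hq] at hki
    have := (z01 (blk a b k i)).resolve_right hki
    simpa [this] using h2
end
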